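/- arXiv:1009.0575 — 2 statements merged into one kernel-verified Lean document; each statement's English description precedes it below -/
import Mathlib

section
/- If 𝒞 is a circle decomposition of a surface S (possibly with boundary), then 𝒞 is upper semicontinuous. -/
open Topology Set

/-- A circle in a topological space `X`: a subset homeomorphic to the unit circle. -/
def IsCircle {X : Type*} [TopologicalSpace X] (C : Set X) : Prop :=
  Nonempty (C ≃ₜ Circle)

/-- A circle decomposition of `X`: a set of pairwise disjoint circles whose union is `X`. -/
def IsCircleDecomposition {X : Type*} [TopologicalSpace X] (𝒞 : Set (Set X)) : Prop :=
  (∀ C ∈ 𝒞, IsCircle C) ∧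
  (∀ C ∈ 𝒞, ∀ D ∈ 𝒞, C ≠ D → Disjoint C D) ∧
  ⋃₀ 𝒞 = Set.univ

/-- A decomposition `𝒞` of `X` is upper semicontinuous if for every `C ∈ 𝒞` and every
open `U ⊇ C` there is an open `V ⊇ C` such that every `D ∈ 𝒞` meeting `V` lies in `U`. -/
def IsUpperSemicontinuousDecomposition {X : Type*} [TopologicalSpace X]
    (𝒞 : Set (Set X)) : Prop :=
  ∀ C ∈ 𝒞, ∀ U : Set X, IsOpen U → C ⊆ U →
    ∃ V : Set X, IsOpen V ∧ C ⊆ V ∧ ∀ D ∈ 𝒞, (D ∩ V) ≠ ∅ → D ⊆ U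

/-- Boundary bumping: in a compact connected Hausdorff space a component of the closure of a
proper open set is not contained in that open set. -/
theorem exists_isPreconnected_subset_closure_not_subset {X : Type*} [TopologicalSpace X] [T2Space X]
    [CompactSpace X] [PreconnectedSpace X] {V : Set X} (hV : IsOpen V) (hne : V ≠ univ) {p : X}
    (hp : p ∈ V) :
    ∃ L : Set X, IsPreconnected L ∧ IsClosed L ∧ p ∈ L ∧ L ⊆ closure V ∧ ¬ L ⊆ V := by
  let y : closure V := ⟨p, subset_closure hp⟩
  have : CompactSpace (closure V) := isCompact_iff_compactSpace.1 isClosed_closure.isCompact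
  refine ⟨Subtype.val '' connectedComponent y,
    isPreconnected_connectedComponent.image _ continuous_subtype_val.continuousOn,
    (isClosed_connectedComponent.isCompact.image continuous_subtype_val).isClosed,
    ⟨y, mem_connectedComponent, rfl⟩, by rintro _ ⟨z, -, rfl⟩; exact z.2, fun hsub => hne ?_⟩
  have hVo : IsOpen (Subtype.val ⁻¹' V : Set (closure V)) := hV.preimage continuous_subtype_val
  have : Nonempty { s : Set (closure V) // IsClopen s ∧ y ∈ s } := ⟨univ, isClopen_univ, mem_univ y⟩
  obtain ⟨⟨Z, hZ, hyZ⟩, hZV⟩ := exists_subset_nhds_of_compactSpace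
    (V := fun s : { s : Set (closure V) // IsClopen s ∧ y ∈ s } => (s : Set (closure V)))
    (U := Subtype.val ⁻¹' V)
    (fun s t => ⟨⟨s.1 ∩ t.1, s.2.1.inter t.2.1, s.2.2, t.2.2⟩, inter_subset_left,
      inter_subset_right⟩) (fun s => s.2.1.1) (fun x hx => by
        rw [← connectedComponent_eq_iInter_isClopen] at hx
        exact hVo.mem_nhds (hsub ⟨x, hx, rfl⟩))
  have hclosed : IsClosed (Subtype.val '' Z) :=
    (hZ.1.isCompact.image continuous_subtype_val).isClosed
  have hsubV : Subtype.val '' Z ⊆ V := by rintro _ ⟨z, hz, rfl⟩; exact hZV hz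
  have hopen : IsOpen (Subtype.val '' Z) := by
    obtain ⟨O, hO, rfl⟩ := isOpen_induced_iff.1 hZ.2
    have : Subtype.val '' (Subtype.val ⁻¹' O : Set (closure V)) = O ∩ V := by
      ext x
      constructor
      · intro hx
        exact ⟨by obtain ⟨z, hz, rfl⟩ := hx; exact hz, hsubV hx⟩
      · rintro ⟨hxO, hxV⟩
        exact ⟨⟨x, subset_closure hxV⟩, hxO, rfl⟩
    rw [this]
    exact hO.inter hV
  have : Subtype.val '' Z = univ := IsClopen.eq_univ ⟨hclosed, hopen⟩ ⟨p, y, hyZ, rfl⟩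
  exact univ_subset_iff.1 (this ▸ hsubV)

/-- A compact connected set meeting two members of a countable disjoint family of closed sets that
covers it contains a compact connected subset with the same property missing a given member. -/
theorem exists_subcontinuum_disjoint {X : Type*} [TopologicalSpace X] [T2Space X]
    {F : ℕ → Set X} (hF : ∀ n, IsClosed (F n)) (hd : ∀ m n, m ≠ n → Disjoint (F m) (F n))
    {K : Set X} (hK : IsCompact K) (hKc : IsPreconnected K) (hcov : K ⊆ ⋃ n, F n)
    (htwo : ∀ n, (K \ F n).Nonempty) (n : ℕ) :
    ∃ L ⊆ K, IsCompact L ∧ IsPreconnected L ∧ (∀ n, (L \ F n).Nonempty) ∧ Disjoint L (F n) := by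
  by_cases hn : Disjoint K (F n)
  · exact ⟨K, Subset.rfl, hK, hKc, htwo, hn⟩
  obtain ⟨q, hqK, hqn⟩ := not_disjoint_iff.1 hn
  obtain ⟨p, hpK, hpn⟩ := htwo n
  obtain ⟨j, hpj⟩ := mem_iUnion.1 (hcov hpK)
  have hjn : j ≠ n := by rintro rfl; exact hpn hpj
  obtain ⟨V, W, hV, hW, hjV, hnW, hVW⟩ := SeparatedNhds.of_isCompact_isCompact
    (hK.inter_right (hF j)) (hK.inter_right (hF n))
    ((hd j n hjn).mono inter_subset_right inter_subset_right)
  have : CompactSpace K := isCompact_iff_compactSpace.1 hK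
  have : PreconnectedSpace K := isPreconnected_iff_preconnectedSpace.1 hKc
  have hcl : ∀ x : K, x ∈ closure (Subtype.val ⁻¹' V : Set K) → (x : X) ∉ F n := by
    intro x hx hxn
    have := closure_minimal (s := (Subtype.val ⁻¹' V : Set K)) (t := Subtype.val ⁻¹' Wᶜ)
      (fun y hy => fun hyW => (disjoint_left.1 hVW) hy hyW)
      (hW.isClosed_compl.preimage continuous_subtype_val) hx
    exact this (hnW ⟨x.2, hxn⟩)
  obtain ⟨L, hLc, hLcl, hpL, hLV, hLnV⟩ := exists_isPreconnected_subset_closure_not_subset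
    (V := (Subtype.val ⁻¹' V : Set K)) (hV.preimage continuous_subtype_val)
    (fun h => hcl ⟨q, hqK⟩ (h ▸ subset_closure (mem_univ _)) hqn) (p := ⟨p, hpK⟩) (hjV ⟨hpK, hpj⟩)
  obtain ⟨r, hrL, hrV⟩ := not_subset.1 hLnV
  refine ⟨Subtype.val '' L, by rintro _ ⟨z, -, rfl⟩; exact z.2,
    hLcl.isCompact.image continuous_subtype_val,
    hLc.image _ continuous_subtype_val.continuousOn, fun m => ?_, disjoint_left.2 ?_⟩
  · by_cases hm : m = j
    · subst hm
      exact ⟨r, ⟨r, hrL, rfl⟩, fun hr => hrV (hjV ⟨r.2, hr⟩)⟩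
    · exact ⟨p, ⟨_, hpL, rfl⟩, fun h => (disjoint_left.1 (hd m j hm)) h hpj⟩
  · rintro _ ⟨z, hz, rfl⟩
    exact hcl z (hLV hz)

/-- Sierpiński's theorem: a compact connected set covered by a sequence of disjoint closed sets
lies in one of them. -/
theorem exists_subset_of_isPreconnected_of_closed_cover {X : Type*} [TopologicalSpace X]
    [T2Space X] {F : ℕ → Set X} (hF : ∀ n, IsClosed (F n))
    (hd : ∀ m n, m ≠ n → Disjoint (F m) (F n))
    {K : Set X} (hK : IsCompact K) (hKc : IsPreconnected K) (hcov : K ⊆ ⋃ n, F n) :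
    ∃ n, K ⊆ F n := by
  by_contra! hcon
  let P : Set X → Prop := fun L =>
    L ⊆ K ∧ IsCompact L ∧ IsPreconnected L ∧ ∀ n, (L \ F n).Nonempty
  have hstep : ∀ (n : ℕ) (L : Subtype P), ∃ L' : Subtype P, L'.1 ⊆ L.1 ∧ Disjoint L'.1 (F n) := by
    rintro n ⟨L, hL⟩
    obtain ⟨L', h1, h2, h3, h4, h5⟩ := exists_subcontinuum_disjoint hF hd hL.2.1 hL.2.2.1
      (hL.1.trans hcov) hL.2.2.2 n
    exact ⟨⟨L', h1.trans hL.1, h2, h3, h4⟩, h1, h5⟩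
  choose g hg1 hg2 using hstep
  let s : ℕ → Subtype P := fun n =>
    Nat.rec ⟨K, Subset.rfl, hK, hKc, fun n => nonempty_of_not_subset (hcon n)⟩ (fun n L => g n L) n
  have hne := IsCompact.nonempty_iInter_of_sequence_nonempty_isCompact_isClosed (fun n => (s n).1)
    (fun n => hg1 n (s n)) (fun n => ((s n).2.2.2.2 0).mono sdiff_subset) (s 0).2.2.1
    (fun n => (s n).2.2.1.isClosed)
  obtain ⟨x, hx⟩ := hne
  rw [mem_iInter] at hx
  obtain ⟨n, hn⟩ := mem_iUnion.1 (hcov (hx 0))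
  exact disjoint_left.1 (hg2 n (s n)) (hx (n + 1)) hn

/-- Sierpiński's theorem for disjoint families: a compact connected set meeting two members of a
disjoint family of closed sets that covers it meets uncountably many of them. -/
theorem not_countable_of_isPreconnected_of_closed_cover {X : Type*} [TopologicalSpace X]
    [T2Space X] {𝒟 : Set (Set X)} (hF : ∀ D ∈ 𝒟, IsClosed D)
    (hd : ∀ C ∈ 𝒟, ∀ D ∈ 𝒟, C ≠ D → Disjoint C D)
    {K : Set X} (hK : IsCompact K) (hKc : IsPreconnected K) (hcov : K ⊆ ⋃₀ 𝒟)
    (htwo : ∀ D ∈ 𝒟, ¬ K ⊆ D) (hne : K.Nonempty) :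
    ¬ {D ∈ 𝒟 | (D ∩ K).Nonempty}.Countable := by
  intro hcount
  obtain ⟨x, hx⟩ := hne
  obtain ⟨D₀, hD₀, hxD₀⟩ := hcov hx
  obtain ⟨e, he⟩ := Set.countable_iff_exists_injOn.1 hcount
  let F : ℕ → Set X := fun n => ⋃ D ∈ {D ∈ {D ∈ 𝒟 | (D ∩ K).Nonempty} | e D = n}, D
  have hFe : ∀ D ∈ {D ∈ 𝒟 | (D ∩ K).Nonempty}, F (e D) = D := by
    intro D hD
    apply Subset.antisymm
    · refine iUnion₂_subset fun D' hD' => ?_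
      rw [he hD'.1 hD hD'.2]
    · exact subset_iUnion₂_of_subset D ⟨hD, rfl⟩ Subset.rfl
  have hF0 : ∀ n, F n = ∅ ∨ ∃ D ∈ {D ∈ 𝒟 | (D ∩ K).Nonempty}, e D = n := by
    intro n
    by_cases h : ∃ D ∈ {D ∈ 𝒟 | (D ∩ K).Nonempty}, e D = n
    · exact .inr h
    · refine .inl (eq_empty_of_subset_empty
        (iUnion₂_subset fun D hD => (h ⟨D, hD.1, hD.2⟩).elim))
  obtain ⟨n, hn⟩ := exists_subset_of_isPreconnected_of_closed_cover (F := F) (K := K)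
    (fun n => by
      rcases hF0 n with h | ⟨D, hD, rfl⟩
      · rw [h]; exact isClosed_empty
      · rw [hFe D hD]; exact hF D hD.1)
    (fun m n hmn => by
      rcases hF0 m with h | ⟨D, hD, rfl⟩
      · rw [h]; exact disjoint_bot_left
      rcases hF0 n with h | ⟨D', hD', rfl⟩
      · rw [h]; exact disjoint_bot_right
      rw [hFe D hD, hFe D' hD']
      exact hd D hD.1 D' hD'.1 fun h => hmn (h ▸ rfl)) hK hKc
    (fun y hy => by
      obtain ⟨D, hD, hyD⟩ := hcov hy
      have hD' : D ∈ {D ∈ 𝒟 | (D ∩ K).Nonempty} := ⟨hD, y, hyD, hy⟩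
      exact mem_iUnion.2 ⟨e D, by rw [hFe D hD']; exact hyD⟩)
  rcases hF0 n with h | ⟨D, hD, rfl⟩
  · rw [h] at hn; exact hn hx
  · rw [hFe D hD] at hn; exact htwo D hD.1 hn

/-- The principal square root. -/
noncomputable def csqrt (z : ℂ) : ℂ := Complex.exp (Complex.log z / 2)

theorem csqrt_ne_zero (z : ℂ) : csqrt z ≠ 0 := Complex.exp_ne_zero _

theorem csqrt_sq {z : ℂ} (hz : z ≠ 0) : csqrt z ^ 2 = z := by
  rw [csqrt, ← Complex.exp_nat_mul]
  convert Complex.exp_log hz using 2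
  push_cast; ring

theorem csqrt_one : csqrt 1 = 1 := by simp [csqrt]

theorem csqrt_mul {z w : ℂ} (hz : 0 < z.re) (hw : 0 < w.re) :
    csqrt (z * w) = csqrt z * csqrt w := by
  have hz0 : z ≠ 0 := by rintro rfl; simp at hz
  have hw0 : w ≠ 0 := by rintro rfl; simp at hw
  have h1 := abs_lt.1 (Complex.abs_arg_lt_pi_div_two_iff.2 (.inl hz))
  have h2 := abs_lt.1 (Complex.abs_arg_lt_pi_div_two_iff.2 (.inl hw))
  rw [csqrt, csqrt, csqrt, Complex.log_mul hz0 hw0 ⟨by linarith [h1.1, h2.1],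
    by linarith [h1.2, h2.2]⟩, ← Complex.exp_add, add_div]

theorem mem_slitPlane_of_re_pos {z : ℂ} (hz : 0 < z.re) : z ∈ Complex.slitPlane := .inl hz

theorem continuousOn_csqrt : ContinuousOn csqrt Complex.slitPlane := by
  unfold csqrt
  exact ((continuousOn_id.clog fun z hz => hz).div_const 2).cexp

/-- `r` is a continuous square root of `g` on `s`. -/
structure IsSqrtOn {X : Type*} [TopologicalSpace X] (r g : X → ℂ) (s : Set X) : Prop where
  continuousOn : ContinuousOn r s
  sq_eq : ∀ x ∈ s, r x ^ 2 = g x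

namespace IsSqrtOn
variable {X Y : Type*} [TopologicalSpace X] [TopologicalSpace Y] {r g r' g' : X → ℂ} {s t : Set X}

theorem mono (h : IsSqrtOn r g s) (hts : t ⊆ s) : IsSqrtOn r g t :=
  ⟨h.1.mono hts, fun x hx => h.2 x (hts hx)⟩

theorem congr (h : IsSqrtOn r g s) (hg : EqOn g' g s) : IsSqrtOn r g' s :=
  ⟨h.1, fun x hx => by rw [h.2 x hx, hg hx]⟩

theorem mul (h : IsSqrtOn r g s) (h' : IsSqrtOn r' g' s) :
    IsSqrtOn (fun x => r x * r' x) (fun x => g x * g' x) s :=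
  ⟨h.1.mul h'.1, fun x hx => by rw [mul_pow, h.2 x hx, h'.2 x hx]⟩

theorem ne_zero (h : IsSqrtOn r g s) {x : X} (hx : x ∈ s) (hg : g x ≠ 0) : r x ≠ 0 := by
  intro h0
  apply hg
  rw [← h.2 x hx, h0]; simp

theorem div (h : IsSqrtOn r g s) (h' : IsSqrtOn r' g' s) (hne : ∀ x ∈ s, g' x ≠ 0) :
    IsSqrtOn (fun x => r x / r' x) (fun x => g x / g' x) s :=
  ⟨h.1.div h'.1 fun x hx => h'.ne_zero hx (hne x hx),
    fun x hx => by rw [div_pow, h.2 x hx, h'.2 x hx]⟩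

theorem comp (h : IsSqrtOn r g s) {f : Y → X} {t : Set Y} (hf : ContinuousOn f t)
    (hm : MapsTo f t s) : IsSqrtOn (fun y => r (f y)) (fun y => g (f y)) t :=
  ⟨h.1.comp hf hm, fun _ hy => h.2 _ (hm hy)⟩

theorem eqOn (h : IsSqrtOn r g s) (h' : IsSqrtOn r' g s) (hs : IsPreconnected s)
    (hg : ∀ x ∈ s, g x ≠ 0) {y : X} (hy : y ∈ s) (hyy : r y = r' y) : EqOn r r' s :=
  hs.eq_of_sq_eq h.1 h'.1 (fun x hx => by simp [h.2 x hx, h'.2 x hx])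
    (fun hx => h'.ne_zero hx (hg _ hx)) hy hyy

theorem div_eq_div (h : IsSqrtOn r g s) (h' : IsSqrtOn r' g s) (hs : IsPreconnected s)
    (hg : ∀ x ∈ s, g x ≠ 0) {a b : X} (ha : a ∈ s) (hb : b ∈ s) : r b / r a = r' b / r' a := by
  rcases hs.eq_or_eq_neg_of_sq_eq h.1 h'.1 (fun x hx => by simp [h.2 x hx, h'.2 x hx])
    (fun hx => h'.ne_zero hx (hg _ hx)) with e | e
  · rw [e ha, e hb]
  · rw [e ha, e hb]; simp [neg_div_neg_eq]

end IsSqrtOn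

theorem isSqrtOn_csqrt {X : Type*} [TopologicalSpace X] {g : X → ℂ} {s : Set X}
    (hg : ContinuousOn g s) (h : ∀ x ∈ s, g x ∈ Complex.slitPlane) :
    IsSqrtOn (fun x => csqrt (g x)) g s :=
  ⟨continuousOn_csqrt.comp hg h, fun x hx => csqrt_sq (Complex.slitPlane_ne_zero (h x hx))⟩

/-- Homotopy lifting of logarithms. -/
theorem exists_log_of_homotopy {X : Type*} [TopologicalSpace X] (H : C(unitInterval × X, ℂ))
    (hne : ∀ p, H p ≠ 0) (h0 : ∀ x, H (0, x) = 1) :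
    ∃ G : C(unitInterval × X, ℂ), (∀ p, Complex.exp (G p) = H p) ∧ ∀ x, G (0, x) = 0 := by
  let H' : C(unitInterval × X, {z : ℂ // z ≠ 0}) :=
    ⟨fun p => ⟨H p, hne p⟩, H.continuous.subtype_mk _⟩
  have hz : ∀ x, H' (0, x) = (⟨Complex.exp 0, Complex.exp_ne_zero 0⟩ : {z : ℂ // z ≠ 0}) :=
    fun x => Subtype.ext (by simpa [H'] using h0 x)
  refine ⟨Complex.isCoveringMap_exp.liftHomotopy H' (.const X 0) hz, fun p => ?_, fun x => ?_⟩
  · have := congrFun (Complex.isCoveringMap_exp.liftHomotopy_lifts H' (.const X 0) hz) p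
    exact congrArg Subtype.val this
  · exact Complex.isCoveringMap_exp.liftHomotopy_zero H' (.const X 0) hz x

/-- A map homotopic to the constant `1` through nonvanishing maps has a square root. -/
theorem exists_isSqrtOn_of_homotopy {X : Type*} [TopologicalSpace X] {s : Set X}
    {H : ℝ × X → ℂ} (hH : ContinuousOn H (Icc 0 1 ×ˢ s)) (hne : ∀ p ∈ Icc 0 1 ×ˢ s, H p ≠ 0)
    (h0 : ∀ x ∈ s, H (0, x) = 1) : ∃ r, IsSqrtOn r (fun x => H (1, x)) s := by
  classical
  let e : unitInterval × s → ℝ × X := fun p => (p.1, p.2)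
  have he : Continuous e := by fun_prop
  have hm : ∀ p, e p ∈ Icc (0 : ℝ) 1 ×ˢ s := fun p => ⟨p.1.2, p.2.2⟩
  obtain ⟨G, hG, -⟩ := exists_log_of_homotopy ⟨H ∘ e, hH.comp_continuous he hm⟩
    (fun p => hne _ (hm p)) (fun x => h0 x x.2)
  let r : X → ℂ := fun x => if hx : x ∈ s then Complex.exp (G (1, ⟨x, hx⟩) / 2) else 0
  have hr : ∀ x : s, r x = Complex.exp (G (1, x) / 2) := fun x => by simp [r]
  refine ⟨r, ?_, fun x hx => ?_⟩
  · rw [continuousOn_iff_continuous_domRestrict]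
    have : s.domRestrict r = fun x : s => Complex.exp (G (1, x) / 2) := funext hr
    rw [this]
    fun_prop
  · have := hG (1, ⟨x, hx⟩)
    rw [hr ⟨x, hx⟩, ← Complex.exp_nat_mul]
    convert this using 2
    · push_cast; ring
    · simp [e]

theorem exists_isSqrtOn_of_segment {X : Type*} [TopologicalSpace X] {s : Set X} {g : X → ℂ}
    {K : ℝ → X → X} (hK : ContinuousOn (fun p : ℝ × X => K p.1 p.2) (Icc 0 1 ×ˢ s))
    (hKs : ∀ τ ∈ Icc (0 : ℝ) 1, ∀ x ∈ s, K τ x ∈ s)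
    (hK1 : ∀ x ∈ s, K 1 x = x) {p : X} (hK0 : ∀ x ∈ s, K 0 x = p) (hp : p ∈ s)
    (hg : ContinuousOn g s) (hne : ∀ x ∈ s, g x ≠ 0) : ∃ r, IsSqrtOn r g s := by
  obtain ⟨r, hr⟩ := exists_isSqrtOn_of_homotopy (s := s)
    (H := fun q => g (K q.1 q.2) / g p)
    ((hg.comp hK fun q hq => hKs _ hq.1 _ hq.2).div_const _)
    (fun q hq => div_ne_zero (hne _ (hKs _ hq.1 _ hq.2)) (hne _ hp))
    (fun x hx => by simp [hK0 x hx, hne _ hp])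
  refine ⟨fun x => r x * csqrt (g p), hr.1.mul_const _, fun x hx => ?_⟩
  rw [mul_pow, hr.2 x hx, csqrt_sq (hne p hp), hK1 x hx, div_mul_cancel₀ _ (hne p hp)]

theorem exists_isSqrtOn_of_starConvex {E : Type*} [AddCommGroup E] [TopologicalSpace E]
    [IsTopologicalAddGroup E] [Module ℝ E] [ContinuousSMul ℝ E] {s : Set E} {p : E}
    (hs : StarConvex ℝ p s) (hp : p ∈ s) {g : E → ℂ}
    (hg : ContinuousOn g s) (hne : ∀ x ∈ s, g x ≠ 0) : ∃ r, IsSqrtOn r g s :=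
  exists_isSqrtOn_of_segment (K := fun τ x => (1 - τ) • p + τ • x) (p := p)
    (by fun_prop) (fun τ hτ x hx => hs hx (by linarith [hτ.2]) hτ.1 (by ring))
    (fun x _ => by simp) (fun x _ => by simp) hp hg hne

theorem exists_isSqrtOn_Icc {a b : ℝ} (hab : a ≤ b) {g : ℝ → ℂ} (hg : ContinuousOn g (Icc a b))
    (hne : ∀ x ∈ Icc a b, g x ≠ 0) : ∃ r, IsSqrtOn r g (Icc a b) :=
  exists_isSqrtOn_of_starConvex ((convex_Icc a b).starConvex (left_mem_Icc.2 hab))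
    (left_mem_Icc.2 hab) hg hne

open Classical in
/-- The ratio of the end values of a continuous square root of `g` along `[a, b]`. -/
noncomputable def sqrtRatio (g : ℝ → ℂ) (a b : ℝ) : ℂ :=
  if h : ∃ r, IsSqrtOn r g (Icc a b) then h.choose b / h.choose a else 1

/-- The discrepancy between `sqrtRatio` and the ratio of principal square roots. -/
noncomputable def sqrtSign (g : ℝ → ℂ) (a b : ℝ) : ℂ :=
  sqrtRatio g a b * csqrt (g a) / csqrt (g b)

/-- `g` is continuous and nonvanishing on `[a, b]`. -/
structure Nonvan (g : ℝ → ℂ) (a b : ℝ) : Prop where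
  le : a ≤ b
  continuousOn : ContinuousOn g (Icc a b)
  ne_zero : ∀ x ∈ Icc a b, g x ≠ 0

namespace Nonvan
variable {g h : ℝ → ℂ} {a b c : ℝ}

theorem exists_sqrt (hg : Nonvan g a b) : ∃ r, IsSqrtOn r g (Icc a b) :=
  exists_isSqrtOn_Icc hg.1 hg.2 hg.3

theorem mul (hg : Nonvan g a b) (hh : Nonvan h a b) : Nonvan (fun θ => g θ * h θ) a b :=
  ⟨hg.1, hg.2.mul hh.2, fun x hx => mul_ne_zero (hg.3 x hx) (hh.3 x hx)⟩

theorem div (hg : Nonvan g a b) (hh : Nonvan h a b) : Nonvan (fun θ => g θ / h θ) a b :=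
  ⟨hg.1, hg.2.div hh.2 hh.3, fun x hx => div_ne_zero (hg.3 x hx) (hh.3 x hx)⟩

theorem mono (hg : Nonvan g a b) {a' b' : ℝ} (h : a' ≤ b') (ha : a ≤ a') (hb : b' ≤ b) :
    Nonvan g a' b' :=
  ⟨h, hg.2.mono (Icc_subset_Icc ha hb), fun x hx => hg.3 x (Icc_subset_Icc ha hb hx)⟩

end Nonvan

theorem sqrtRatio_eq {g r : ℝ → ℂ} {a b : ℝ} (hab : a ≤ b) (hne : ∀ x ∈ Icc a b, g x ≠ 0)
    (hr : IsSqrtOn r g (Icc a b)) : sqrtRatio g a b = r b / r a := by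
  have h : ∃ r, IsSqrtOn r g (Icc a b) := ⟨r, hr⟩
  rw [sqrtRatio, dif_pos h]
  exact h.choose_spec.div_eq_div hr isPreconnected_Icc hne (left_mem_Icc.2 hab)
    (right_mem_Icc.2 hab)

section
variable {g h : ℝ → ℂ} {a b c : ℝ}

theorem sqrtRatio_sq (hg : Nonvan g a b) : sqrtRatio g a b ^ 2 = g b / g a := by
  obtain ⟨r, hr⟩ := hg.exists_sqrt
  rw [sqrtRatio_eq hg.1 hg.3 hr, div_pow, hr.2 _ (left_mem_Icc.2 hg.1),
    hr.2 _ (right_mem_Icc.2 hg.1)]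

theorem sqrtRatio_mul (hg : Nonvan g a b) (hh : Nonvan h a b) :
    sqrtRatio (fun θ => g θ * h θ) a b = sqrtRatio g a b * sqrtRatio h a b := by
  obtain ⟨r, hr⟩ := hg.exists_sqrt
  obtain ⟨q, hq⟩ := hh.exists_sqrt
  rw [sqrtRatio_eq hg.1 hg.3 hr, sqrtRatio_eq hg.1 hh.3 hq,
    sqrtRatio_eq hg.1 (hg.mul hh).3 (hr.mul hq), mul_div_mul_comm]

theorem sqrtRatio_trans (hg : Nonvan g a c) (hab : a ≤ b) (hbc : b ≤ c) :
    sqrtRatio g a c = sqrtRatio g a b * sqrtRatio g b c := by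
  obtain ⟨r, hr⟩ := hg.exists_sqrt
  have h1 := hg.mono hab le_rfl hbc
  have h2 := hg.mono hbc hab le_rfl
  have := hr.ne_zero ⟨hab, hbc⟩ (hg.3 b ⟨hab, hbc⟩)
  rw [sqrtRatio_eq hg.1 hg.3 hr, sqrtRatio_eq hab h1.3 (hr.mono (Icc_subset_Icc_right hbc)),
    sqrtRatio_eq hbc h2.3 (hr.mono (Icc_subset_Icc_left hab))]
  field_simp

theorem sqrtRatio_congr (hg : Nonvan g a b) (hgh : EqOn h g (Icc a b)) :
    sqrtRatio h a b = sqrtRatio g a b := by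
  obtain ⟨r, hr⟩ := hg.exists_sqrt
  rw [sqrtRatio_eq hg.1 hg.3 hr, sqrtRatio_eq hg.1 (fun x hx => by rw [hgh hx]; exact hg.3 x hx)
    (hr.congr hgh)]

theorem sqrtRatio_of_re_pos (hg : Nonvan g a b) (hpos : ∀ x ∈ Icc a b, 0 < (g x).re) :
    sqrtRatio g a b = csqrt (g b) / csqrt (g a) :=
  sqrtRatio_eq hg.1 hg.3 (isSqrtOn_csqrt hg.2 fun x hx => mem_slitPlane_of_re_pos (hpos x hx))

theorem sqrtSign_sq (hg : Nonvan g a b) : sqrtSign g a b ^ 2 = 1 := by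
  have ha := hg.3 a (left_mem_Icc.2 hg.1)
  have hb := hg.3 b (right_mem_Icc.2 hg.1)
  rw [sqrtSign, div_pow, mul_pow, sqrtRatio_sq hg, csqrt_sq ha, csqrt_sq hb]
  field_simp

theorem sqrtSign_mul (hg : Nonvan g a b) (hh : Nonvan h a b) (hga : 0 < (g a).re)
    (hgb : 0 < (g b).re) (hha : 0 < (h a).re) (hhb : 0 < (h b).re) :
    sqrtSign (fun θ => g θ * h θ) a b = sqrtSign g a b * sqrtSign h a b := by
  simp only [sqrtSign, sqrtRatio_mul hg hh, csqrt_mul hga hha, csqrt_mul hgb hhb]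
  ring

theorem sqrtSign_congr (hg : Nonvan g a b) (hgh : EqOn h g (Icc a b)) :
    sqrtSign h a b = sqrtSign g a b := by
  rw [sqrtSign, sqrtSign, sqrtRatio_congr hg hgh, hgh (left_mem_Icc.2 hg.1),
    hgh (right_mem_Icc.2 hg.1)]

theorem sqrtSign_of_re_pos (hg : Nonvan g a b) (hpos : ∀ x ∈ Icc a b, 0 < (g x).re) :
    sqrtSign g a b = 1 := by
  have h1 := csqrt_ne_zero (g a)
  have h2 := csqrt_ne_zero (g b)
  rw [sqrtSign, sqrtRatio_of_re_pos hg hpos]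
  field_simp

theorem sqrtSign_trans (hg : Nonvan g a c) (hab : a ≤ b) (hbc : b ≤ c) :
    sqrtSign g a c = sqrtSign g a b * sqrtSign g b c := by
  have h2 := csqrt_ne_zero (g b)
  simp only [sqrtSign, sqrtRatio_trans hg hab hbc]
  field_simp

/-- Replacing `g` by a function in the same open half-plane direction keeps the sign. -/
theorem sqrtSign_eq_of_re_div_pos (hg : Nonvan g a b) (hh : Nonvan h a b)
    (ha : 0 < (h a).re) (hb : 0 < (h b).re) (hpos : ∀ x ∈ Icc a b, 0 < (g x / h x).re) :
    sqrtSign g a b = sqrtSign h a b := by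
  have hd := hg.div hh
  have := sqrtSign_mul hd hh (hpos _ (left_mem_Icc.2 hg.1)) (hpos _ (right_mem_Icc.2 hg.1)) ha hb
  rw [sqrtSign_of_re_pos hd hpos, one_mul] at this
  rw [← this]
  exact (sqrtSign_congr hg fun x hx => div_mul_cancel₀ _ (hh.3 x hx)).symm

/-- Windows differing by parts on which `g` has positive real part give the same sign. -/
theorem sqrtSign_shift {a b a' b' : ℝ} (haa : a ≤ a') (hbb : b ≤ b') (hab : a' ≤ b)
    (hg : Nonvan g a b') (ha : ∀ x ∈ Icc a a', 0 < (g x).re) (hb : ∀ x ∈ Icc b b', 0 < (g x).re) :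
    sqrtSign g a b = sqrtSign g a' b' := by
  rw [sqrtSign_trans (hg.mono (haa.trans hab) le_rfl hbb) haa hab,
    sqrtSign_trans (hg.mono (hab.trans hbb) haa le_rfl) hab hbb,
    sqrtSign_of_re_pos (hg.mono haa le_rfl (hab.trans hbb)) ha,
    sqrtSign_of_re_pos (hg.mono hbb (haa.trans hab) le_rfl) hb, one_mul, mul_one]

theorem sqrtRatio_comp_add (hg : Nonvan g (a + c) (b + c)) :
    sqrtRatio (fun θ => g (θ + c)) a b = sqrtRatio g (a + c) (b + c) := by
  obtain ⟨r, hr⟩ := hg.exists_sqrt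
  have hm : MapsTo (fun θ => θ + c) (Icc a b) (Icc (a + c) (b + c)) :=
    fun θ hθ => ⟨by linarith [hθ.1], by linarith [hθ.2]⟩
  rw [sqrtRatio_eq hg.1 hg.3 hr, sqrtRatio_eq (by linarith [hg.1]) (fun x hx => hg.3 _ (hm hx))
    (hr.comp (by fun_prop) hm)]

theorem sqrtSign_comp_add (hg : Nonvan g (a + c) (b + c)) :
    sqrtSign (fun θ => g (θ + c)) a b = sqrtSign g (a + c) (b + c) := by
  rw [sqrtSign, sqrtSign, sqrtRatio_comp_add hg]

end

/-- The coordinate `z - p` has no continuous square root on a circle around `p`. -/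
theorem not_isSqrtOn_sub_sphere {p : ℂ} {ρ : ℝ} (hρ : 0 < ρ) {r : ℂ → ℂ}
    (hr : IsSqrtOn r (fun z => z - p) (Metric.sphere p ρ)) : False := by
  have hne : ∀ θ ∈ Icc (0 : ℝ) (2 * Real.pi), (ρ * Complex.exp (θ * Complex.I) : ℂ) ≠ 0 :=
    fun θ _ => mul_ne_zero (by exact_mod_cast hρ.ne') (Complex.exp_ne_zero _)
  have h1 : IsSqrtOn (fun θ : ℝ => r (p + ρ * Complex.exp (θ * Complex.I)))
      (fun θ : ℝ => ρ * Complex.exp (θ * Complex.I)) (Icc 0 (2 * Real.pi)) :=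
    (hr.comp (f := fun θ : ℝ => p + ρ * Complex.exp (θ * Complex.I)) (by fun_prop)
      (fun θ _ => by simp [Complex.norm_exp_ofReal_mul_I, hρ.le])).congr (fun θ _ => by simp)
  have h2 : IsSqrtOn (fun θ : ℝ => (√ρ : ℂ) * Complex.exp (θ / 2 * Complex.I))
      (fun θ : ℝ => ρ * Complex.exp (θ * Complex.I)) (Icc 0 (2 * Real.pi)) := by
    refine ⟨by fun_prop, fun θ _ => ?_⟩
    rw [mul_pow, ← Complex.exp_nat_mul]
    congr 2
    · rw [← Complex.ofReal_pow, Real.sq_sqrt hρ.le]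
    · push_cast; ring
  have h0 : (0 : ℝ) ∈ Icc 0 (2 * Real.pi) := ⟨le_rfl, by positivity⟩
  have hπ : 2 * Real.pi ∈ Icc 0 (2 * Real.pi) := ⟨by positivity, le_rfl⟩
  have := h1.div_eq_div h2 isPreconnected_Icc hne h0 hπ
  have hr0 := h1.ne_zero h0 (hne 0 h0)
  have hs : (√ρ : ℂ) ≠ 0 := by exact_mod_cast (Real.sqrt_pos.2 hρ).ne'
  simp only [Complex.ofReal_mul, Complex.ofReal_ofNat, Complex.exp_two_pi_mul_I, Complex.ofReal_zero,
    zero_mul, Complex.exp_zero, zero_div] at this hr0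
  rw [div_self hr0] at this
  rw [show (2 * (Real.pi : ℂ) / 2 * Complex.I) = Real.pi * Complex.I by ring,
    Complex.exp_pi_mul_I] at this
  have h3 : (√ρ : ℂ) * -1 / (√ρ * 1) = -1 := by field_simp
  rw [h3] at this
  norm_num at this

/-- An even nonvanishing continuous function on a punctured disc has a continuous square root. -/
theorem exists_isSqrtOn_of_even {ρ : ℝ} (hρ : 0 < ρ) {G : ℂ → ℂ}
    (hG : ContinuousOn G (Metric.ball 0 ρ \ {0})) (hne : ∀ z ∈ Metric.ball 0 ρ \ {0}, G z ≠ 0)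
    (heven : ∀ z ∈ Metric.ball 0 ρ \ {0}, G (-z) = G z) :
    ∃ r, IsSqrtOn r G (Metric.ball 0 ρ \ {0}) := by
  let T : Set ℂ := {ζ | ζ.re < Real.log ρ}
  have hT : Convex ℝ T := convex_halfSpace_re_lt _
  have hexp : MapsTo Complex.exp T (Metric.ball 0 ρ \ {0}) := fun ζ hζ =>
    ⟨by rw [mem_ball_zero_iff, Complex.norm_exp]; exact (Real.lt_log_iff_exp_lt hρ).1 hζ,
      Complex.exp_ne_zero ζ⟩
  have hlog : ∀ z ∈ Metric.ball (0 : ℂ) ρ \ {0}, Complex.log z ∈ T := fun z hz => by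
    change (Complex.log z).re < _
    rw [Complex.log_re]
    exact Real.log_lt_log (norm_pos_iff.2 hz.2) (mem_ball_zero_iff.1 hz.1)
  have hneg : ∀ z ∈ Metric.ball (0 : ℂ) ρ \ {0}, -z ∈ Metric.ball (0 : ℂ) ρ \ {0} := fun z hz =>
    ⟨by simpa using hz.1, by simpa using hz.2⟩
  have hT0 : ((Real.log ρ - 1 : ℝ) : ℂ) ∈ T := by simp [T]
  have hGne : ∀ ζ ∈ T, G (Complex.exp ζ) ≠ 0 := fun ζ hζ => hne _ (hexp hζ)
  obtain ⟨W, hW⟩ := exists_isSqrtOn_of_starConvex (hT.starConvex hT0) hT0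
    (hG.comp Complex.continuous_exp.continuousOn hexp) hGne
  have hTπ : ∀ ζ ∈ T, ζ + Real.pi * Complex.I ∈ T := fun ζ hζ => by
    simpa [T] using hζ
  obtain ⟨ε, hε, hWε⟩ : ∃ ε : ℂ, ε * ε = 1 ∧ ∀ ζ ∈ T, W (ζ + Real.pi * Complex.I) = ε * W ζ := by
    have h2 : IsSqrtOn (fun ζ => W (ζ + Real.pi * Complex.I)) (fun ζ => G (Complex.exp ζ)) T :=
      (hW.comp (f := fun ζ => ζ + Real.pi * Complex.I) (by fun_prop) hTπ).congr fun ζ hζ => by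
        simp [Complex.exp_add, Complex.exp_pi_mul_I, heven _ (hexp hζ)]
    rcases hT.isPreconnected.eq_or_eq_neg_of_sq_eq h2.1 hW.1
      (fun x hx => by simp [h2.2 x hx, hW.2 x hx]) (fun hx => hW.ne_zero hx (hGne _ hx)) with h | h
    · exact ⟨1, by ring, fun ζ hζ => by simpa using h hζ⟩
    · exact ⟨-1, by ring, fun ζ hζ => by simpa using h hζ⟩
  have hTn : ∀ ζ ∈ T, ∀ n : ℤ, ζ + n * (2 * Real.pi * Complex.I) ∈ T := fun ζ hζ n => by
    simpa [T] using hζ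
  have hper1 : ∀ ζ ∈ T, W (ζ + 2 * Real.pi * Complex.I) = W ζ := fun ζ hζ => by
    have := hWε _ (hTπ ζ hζ)
    rw [hWε ζ hζ, ← mul_assoc, hε, one_mul] at this
    rw [← this]; congr 1; ring
  have hper : ∀ n : ℤ, ∀ ζ ∈ T, W (ζ + n * (2 * Real.pi * Complex.I)) = W ζ := by
    intro n
    induction n with
    | zero => intro ζ _; simp
    | succ n ih =>
      intro ζ hζ
      rw [← ih ζ hζ, ← hper1 _ (hTn ζ hζ n)]
      congr 1; push_cast; ring
    | pred n ih =>
      intro ζ hζ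
      rw [← ih ζ hζ, ← hper1 _ (hTn ζ hζ _)]
      congr 1; push_cast; ring
  have hrel : ∀ z ∈ Metric.ball (0 : ℂ) ρ \ {0},
      W (Complex.log z) = ε * W (Complex.log (-z)) := by
    intro z hz
    have hz0 : z ≠ 0 := hz.2
    have h1 : Complex.exp (Complex.log z) =
        Complex.exp (Complex.log (-z) + Real.pi * Complex.I) := by
      rw [Complex.exp_add, Complex.exp_pi_mul_I, Complex.exp_log hz0,
        Complex.exp_log (neg_ne_zero.2 hz0)]
      ring
    obtain ⟨n, hn⟩ := Complex.exp_eq_exp_iff_exists_int.1 h1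
    have hm := hlog _ (hneg z hz)
    rw [hn, hper n _ (hTπ _ hm), hWε _ hm]
  have hTo : IsOpen T := isOpen_lt Complex.continuous_re continuous_const
  have hWat : ∀ ζ ∈ T, ContinuousAt W ζ := fun ζ hζ => hW.1.continuousAt (hTo.mem_nhds hζ)
  refine ⟨fun z => W (Complex.log z), fun z hz => ?_, fun z hz => ?_⟩
  · by_cases hs : z ∈ Complex.slitPlane
    · exact ((hWat _ (hlog z hz)).comp
        (f := Complex.log) (continuousAt_clog hs)).continuousWithinAt
    · have hs' : -z ∈ Complex.slitPlane := by
        rw [Complex.mem_slitPlane_iff] at hs ⊢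
        push Not at hs
        have : z.re ≠ 0 := fun h => hz.2 (Complex.ext h hs.2)
        left
        simpa using lt_of_le_of_ne hs.1 this
      have hc : ContinuousAt (fun z => ε * W (Complex.log (-z))) z :=
        continuousAt_const.mul (ContinuousAt.comp (f := fun z => Complex.log (-z))
          (hWat _ (hlog _ (hneg z hz)))
          (ContinuousAt.comp (f := fun z : ℂ => -z) (continuousAt_clog hs') (by fun_prop)))
      exact hc.continuousWithinAt.congr hrel (hrel z hz)
  · rw [hW.2 _ (hlog z hz), Function.comp_apply, Complex.exp_log hz.2]

/-- Odd local degree of injective maps, around the origin. -/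
theorem exists_isSqrtOn_div_ball {ρ : ℝ} (hρ : 0 < ρ) {k : ℂ → ℂ}
    (hk : ContinuousOn k (Metric.ball 0 ρ)) (hinj : InjOn k (Metric.ball 0 ρ)) (hk0 : k 0 = 0) :
    ∃ r, IsSqrtOn r (fun z => k z / z) (Metric.ball 0 ρ \ {0}) := by
  set s : Set ℂ := Metric.ball 0 ρ \ {0}
  have h0 : (0 : ℂ) ∈ Metric.ball (0 : ℂ) ρ := by simpa
  have hneg : ∀ z ∈ Metric.ball (0 : ℂ) ρ, -z ∈ Metric.ball (0 : ℂ) ρ := fun z hz => by simpa using hz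
  have hkne : ∀ z ∈ s, k z ≠ 0 := fun z hz h => hz.2 (hinj hz.1 h0 (h.trans hk0.symm))
  have hscale : ∀ q ∈ Icc (0 : ℝ) 1 ×ˢ s, -((q.1 : ℂ) * q.2) ∈ Metric.ball (0 : ℂ) ρ := by
    rintro ⟨τ, z⟩ ⟨hτ, hz⟩
    have hz1 := mem_ball_zero_iff.1 hz.1
    rw [mem_ball_zero_iff, norm_neg, norm_mul, Complex.norm_real, Real.norm_of_nonneg hτ.1]
    exact (mul_le_of_le_one_left (norm_nonneg _) hτ.2).trans_lt hz1
  obtain ⟨r, hr⟩ := exists_isSqrtOn_of_homotopy (s := s)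
    (H := fun q => (k q.2 - k (-(q.1 * q.2))) / k q.2)
    (((hk.comp continuousOn_snd fun q hq => hq.2.1).sub
      (hk.comp (f := fun q : ℝ × ℂ => -((q.1 : ℂ) * q.2)) (by fun_prop) hscale)).div
      (hk.comp continuousOn_snd fun q hq => hq.2.1) fun q hq => hkne _ hq.2)
    (fun q hq => div_ne_zero (fun h => by
      have h1 := hinj hq.2.1 (hscale q hq) (sub_eq_zero.1 h)
      have h2 : q.2 * (1 + (q.1 : ℂ)) = 0 := by linear_combination h1
      rcases mul_eq_zero.1 h2 with h3 | h3
      · exact hq.2.2 h3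
      · have h4 : (1 : ℝ) + q.1 = 0 := by exact_mod_cast h3
        linarith [hq.1.1]) (hkne _ hq.2))
    (fun z hz => by simp [hk0, hkne z hz])
  have hodd : ∀ z ∈ s, k z - k (-z) ≠ 0 := fun z hz h => by
    have h1 := hinj hz.1 (hneg z hz.1) (sub_eq_zero.1 h)
    exact hz.2 (self_eq_neg.1 h1)
  obtain ⟨q, hq⟩ := exists_isSqrtOn_of_even hρ (G := fun z => (k z - k (-z)) / z)
    (((hk.mono sdiff_subset).sub ((hk.comp (f := fun z : ℂ => -z) (by fun_prop) hneg).mono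
      sdiff_subset)).div continuousOn_id fun z hz => hz.2)
    (fun z hz => div_ne_zero (hodd z hz) hz.2)
    (fun z hz => by rw [neg_neg, div_neg, ← neg_div, neg_sub])
  have hr' : IsSqrtOn r (fun z => (k z - k (-z)) / k z) s := hr.congr fun z _ => by simp
  refine ⟨_, (hq.div hr' fun z hz => div_ne_zero (hodd z hz) (hkne z hz)).congr fun z hz => ?_⟩
  have h1 := hodd z hz
  have h2 := hkne z hz
  have h3 : z ≠ 0 := hz.2
  field_simp

/-- The difference quotient of an injective continuous planar map on a convex set has a continuous
square root off the base point, if that point is interior or the punctured set is star-shaped. -/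
theorem exists_isSqrtOn_div {B : Set ℂ} (hB : Convex ℝ B) {p : ℂ} (hp : p ∈ B)
    (hBp : B ∈ 𝓝 p ∨ ∃ p₀ ∈ B \ {p}, StarConvex ℝ p₀ (B \ {p})) {h : ℂ → ℂ}
    (hh : ContinuousOn h B) (hinj : InjOn h B) :
    ∃ r, IsSqrtOn r (fun z => (h z - h p) / (z - p)) (B \ {p}) := by
  have hne : ∀ z ∈ B \ {p}, h z - h p ≠ 0 := fun z hz h0 => hz.2 (hinj hz.1 hp (sub_eq_zero.1 h0))
  have hne' : ∀ z ∈ B \ {p}, z - p ≠ 0 := fun z hz => sub_ne_zero.2 hz.2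
  rcases hBp with hBp | ⟨p₀, hp₀, hst⟩
  · obtain ⟨ρ, hρ, hρB⟩ := Metric.mem_nhds_iff.1 hBp
    have hball : ∀ u ∈ Metric.ball (0 : ℂ) ρ, p + u ∈ B := fun u hu => hρB (by simpa using hu)
    obtain ⟨r, hr⟩ := exists_isSqrtOn_div_ball hρ (k := fun u => h (p + u) - h p)
      ((hh.comp (f := fun u => p + u) (by fun_prop) hball).sub continuousOn_const)
      (fun u hu v hv huv => by
        simpa using hinj (hball u hu) (hball v hv) (sub_left_injective huv)) (by simp)
    let l : ℂ → ℝ := fun z => ρ / (ρ + ‖z - p‖)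
    have hl0 : ∀ z, 0 < l z := fun z => by positivity
    have hl1 : ∀ z, l z ≤ 1 := fun z => by
      rw [div_le_one (by positivity)]; linarith [norm_nonneg (z - p)]
    have hl : Continuous l := by
      refine continuous_const.div (by fun_prop) fun z => ?_
      positivity
    have hlb : ∀ z, (l z : ℂ) * (z - p) ∈ Metric.ball (0 : ℂ) ρ := fun z => by
      rw [mem_ball_zero_iff, norm_mul, Complex.norm_real, Real.norm_of_nonneg (hl0 z).le]
      simp only [l]
      rw [div_mul_eq_mul_div, div_lt_iff₀ (by positivity)]
      nlinarith [norm_nonneg (z - p)]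
    have hseg : ∀ c : ℝ, 0 < c → c ≤ 1 → ∀ z ∈ B \ {p}, p + (c : ℂ) * (z - p) ∈ B \ {p} := by
      intro c hc hc1 z hz
      refine ⟨?_, ?_⟩
      · have := hB hp hz.1 (sub_nonneg.2 hc1) hc.le (by ring)
        convert this using 1
        simp only [Complex.real_smul]
        push_cast; ring
      · have h1 : (c : ℂ) ≠ 0 := by exact_mod_cast hc.ne'
        simp only [mem_singleton_iff, add_eq_left]
        exact mul_ne_zero h1 (hne' z hz)
    have hm : ∀ q ∈ Icc (0 : ℝ) 1 ×ˢ (B \ {p}),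
        p + (((1 - q.1) * l q.2 + q.1 : ℝ) : ℂ) * (q.2 - p) ∈ B \ {p} := by
      rintro ⟨τ, z⟩ ⟨hτ, hz⟩
      have h1 := hl0 z
      have h2 := hl1 z
      refine hseg _ ?_ ?_ z hz
      · rcases hτ.1.eq_or_lt with h3 | h3
        · simp only at h3; rw [← h3]; simpa using h1
        · have := mul_nonneg (sub_nonneg.2 hτ.2) h1.le
          simp only at h3 this ⊢
          linarith
      · have := mul_le_of_le_one_right (sub_nonneg.2 hτ.2) h2
        simp only at this ⊢
        linarith
    have hml : ∀ z ∈ B \ {p}, p + (l z : ℂ) * (z - p) ∈ B \ {p} := fun z hz =>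
      hseg _ (hl0 z) (hl1 z) z hz
    have hlc : Continuous fun z => (l z : ℂ) := Complex.continuous_ofReal.comp hl
    obtain ⟨q, hq⟩ := exists_isSqrtOn_of_homotopy (s := B \ {p})
      (H := fun q => (h (p + (((1 - q.1) * l q.2 + q.1 : ℝ) : ℂ) * (q.2 - p)) - h p) /
        (h (p + (l q.2 : ℂ) * (q.2 - p)) - h p))
      (by
        refine ContinuousOn.div (ContinuousOn.sub (hh.comp ?_ fun q hq => (hm q hq).1)
          continuousOn_const) (ContinuousOn.sub (hh.comp ?_ fun q hq => (hml _ hq.2).1)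
          continuousOn_const) fun q hq => hne _ (hml _ hq.2)
        · have : Continuous fun q : ℝ × ℂ => (((1 - q.1) * l q.2 + q.1 : ℝ) : ℂ) := by fun_prop
          fun_prop
        · fun_prop)
      (fun q hq => div_ne_zero (hne _ (hm q hq)) (hne _ (hml _ hq.2)))
      (fun z hz => by simp [div_self (hne _ (hml z hz))])
    have hmaps : MapsTo (fun z => (l z : ℂ) * (z - p)) (B \ {p}) (Metric.ball 0 ρ \ {0}) :=
      fun z hz => ⟨hlb z, mul_ne_zero (by exact_mod_cast (hl0 z).ne') (hne' z hz)⟩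
    refine ⟨_, ((hq.mul (hr.comp (f := fun z => (l z : ℂ) * (z - p)) (by fun_prop) hmaps)).mul
      (isSqrtOn_csqrt (g := fun z => (l z : ℂ)) hlc.continuousOn fun z _ =>
        .inl (by simpa using hl0 z))).congr fun z hz => ?_⟩
    have h1 := hne' z hz
    have h2 := hne _ (hml z hz)
    have h3 : (l z : ℂ) ≠ 0 := by exact_mod_cast (hl0 z).ne'
    have h4 : p + (((1 - 1) * l z + 1 : ℝ) : ℂ) * (z - p) = z := by push_cast; ring
    simp only [h4]
    generalize h (p + (l z : ℂ) * (z - p)) - h p = w at h2 ⊢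
    field_simp
  · exact exists_isSqrtOn_of_starConvex hst hp₀
      (((hh.mono sdiff_subset).sub continuousOn_const).div (by fun_prop) hne')
      fun z hz => div_ne_zero (hne z hz) (hne' z hz)

/-- An injective continuous map on a disc does not send the centre to a boundary point of a
half-plane containing the image. -/
theorem not_forall_re_nonneg_of_injOn_ball {p : ℂ} {ρ : ℝ} (hρ : 0 < ρ) {h : ℂ → ℂ}
    (hh : ContinuousOn h (Metric.ball p ρ)) (hinj : InjOn h (Metric.ball p ρ))
    (hre : ∀ z ∈ Metric.ball p ρ, 0 ≤ (h z - h p).re) (him : (h p).re = 0) : False := by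
  have hp := Metric.mem_ball_self (x := p) hρ
  have hne : ∀ z ∈ Metric.ball p ρ \ {p}, h z - h p ≠ 0 := fun z hz h0 =>
    hz.2 (hinj hz.1 hp (sub_eq_zero.1 h0))
  obtain ⟨r, hr⟩ := exists_isSqrtOn_div (convex_ball p ρ) hp (.inl (Metric.ball_mem_nhds p hρ))
    hh hinj
  have hs : IsSqrtOn (fun z => csqrt (h z - h p)) (fun z => h z - h p) (Metric.ball p ρ \ {p}) := by
    refine isSqrtOn_csqrt ((hh.mono sdiff_subset).sub continuousOn_const) fun z hz => ?_
    rcases (hre z hz.1).eq_or_lt with h1 | h1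
    · exact .inr fun h2 => hne z hz (Complex.ext h1.symm h2)
    · exact .inl h1
  have hd := hs.div hr fun z hz => div_ne_zero (hne z hz) (sub_ne_zero.2 hz.2)
  have hsub : Metric.sphere p (ρ / 2) ⊆ Metric.ball p ρ \ {p} := fun z hz => by
    rw [mem_sphere_iff_norm] at hz
    refine ⟨by rw [mem_ball_iff_norm, hz]; linarith, ?_⟩
    rintro rfl
    simp at hz; linarith
  refine not_isSqrtOn_sub_sphere (half_pos hρ) ((hd.mono hsub).congr fun z hz => ?_)
  have h1 := hne z (hsub hz)
  have h2 := sub_ne_zero.2 (hsub hz).2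
  field_simp

/-- An arc in the plane has empty interior. -/
theorem interior_image_Icc_eq_empty {c d : ℝ} {β : ℝ → ℂ} (hβ : ContinuousOn β (Icc c d))
    (hinj : InjOn β (Icc c d)) : interior (β '' Icc c d) = ∅ := by
  by_contra hcon
  obtain ⟨p, hp⟩ := nonempty_iff_ne_empty.2 hcon
  obtain ⟨ρ, hρ, hsub⟩ := Metric.mem_nhds_iff.1 (mem_interior_iff_mem_nhds.1 hp)
  have hemb : IsEmbedding ((Icc c d).domRestrict β) :=
    (IsClosedEmbedding.of_continuous_injective_isClosedMap (continuousOn_iff_continuous_domRestrict.1 hβ)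
      (injOn_iff_injective.1 hinj) (continuousOn_iff_continuous_domRestrict.1 hβ).isClosedMap).isEmbedding
  let w : ℝ → ℂ := fun θ => p + (ρ / 2 : ℝ) * Complex.exp (θ * Complex.I)
  have hw : ∀ θ, w θ ∈ β '' Icc c d := fun θ => hsub (by
    simp only [w, mem_ball_iff_norm, add_sub_cancel_left, norm_mul, Complex.norm_real,
      Complex.norm_exp_ofReal_mul_I, mul_one]
    rw [Real.norm_of_nonneg (half_pos hρ).le]; linarith)
  choose F hF hFw using hw
  have hFc : Continuous F := by
    have : Continuous fun θ => (⟨F θ, hF θ⟩ : Icc c d) := by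
      rw [hemb.continuous_iff]
      have : (Icc c d).domRestrict β ∘ (fun θ => (⟨F θ, hF θ⟩ : Icc c d)) = w := funext hFw
      rw [this]
      fun_prop
    exact continuous_subtype_val.comp this
  have hFeq : ∀ θ θ', w θ = w θ' → F θ = F θ' := fun θ θ' h =>
    hinj (hF θ) (hF θ') (by rw [hFw, hFw, h])
  have hper : F (2 * Real.pi) = F 0 := hFeq _ _ (by
    simp [w, Complex.exp_two_pi_mul_I])
  let D : ℝ → ℝ := fun θ => F θ - F (θ + Real.pi)
  have hD : ContinuousOn D (uIcc 0 Real.pi) := by fun_prop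
  have hDπ : D Real.pi = - D 0 := by
    simp only [D, ← two_mul, hper, zero_add]; ring
  have h0 : (0 : ℝ) ∈ uIcc (D 0) (D Real.pi) := by
    rw [hDπ, mem_uIcc]
    rcases le_total 0 (D 0) with h | h
    · exact .inr ⟨by linarith, h⟩
    · exact .inl ⟨h, by linarith⟩
  obtain ⟨θ, -, hθ⟩ := intermediate_value_uIcc hD h0
  have h1 : w θ = w (θ + Real.pi) := by rw [← hFw, ← hFw, sub_eq_zero.1 hθ]
  simp only [w, add_right_inj, Complex.ofReal_add, add_mul, Complex.exp_add,
    Complex.exp_pi_mul_I] at h1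
  have h2 : ((ρ / 2 : ℝ) : ℂ) * Complex.exp (θ * Complex.I) ≠ 0 :=
    mul_ne_zero (by exact_mod_cast (half_pos hρ).ne') (Complex.exp_ne_zero _)
  apply h2
  linear_combination h1 / 2

/-- A half-disc in the closed right half-plane. -/
def halfDisc (w : ℂ) (ρ : ℝ) : Set ℂ := {z | 0 ≤ z.re} ∩ Metric.ball w ρ

theorem convex_halfDisc (w : ℂ) (ρ : ℝ) : Convex ℝ (halfDisc w ρ) :=
  (convex_halfSpace_re_ge 0).inter (convex_ball w ρ)

theorem halfDisc_mem_nhds {w p : ℂ} {ρ : ℝ} (hp : p ∈ halfDisc w ρ) (hre : 0 < p.re) :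
    halfDisc w ρ ∈ 𝓝 p :=
  Filter.inter_mem (Filter.mem_of_superset
    ((isOpen_lt continuous_const Complex.continuous_re).mem_nhds hre)
    fun z (hz : 0 < z.re) => hz.le) (Metric.isOpen_ball.mem_nhds hp.2)

theorem halfDisc_mem_nhds_or_starConvex {w p : ℂ} {ρ : ℝ} (hp : p ∈ halfDisc w ρ) :
    halfDisc w ρ ∈ 𝓝 p ∨ ∃ p₀ ∈ halfDisc w ρ \ {p}, StarConvex ℝ p₀ (halfDisc w ρ \ {p}) := by
  rcases (show 0 ≤ p.re from hp.1).eq_or_lt with hre | hre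
  · right
    have hev : ∀ᶠ t : ℝ in 𝓝 0, p + (t : ℂ) ∈ Metric.ball w ρ :=
      (show Continuous fun t : ℝ => p + (t : ℂ) by fun_prop).continuousAt.eventually_mem
        (Metric.isOpen_ball.mem_nhds (by simpa using hp.2))
    obtain ⟨ε, hε, hball⟩ := Metric.eventually_nhds_iff.1 hev
    have hmem := hball (y := ε / 2) (by
      rw [Real.dist_0_eq_abs, abs_of_pos (half_pos hε)]; linarith)
    have hre₀ : (p + ((ε / 2 : ℝ) : ℂ)).re = ε / 2 := by
      rw [Complex.add_re, ← hre, Complex.ofReal_re, zero_add]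
    refine ⟨p + ((ε / 2 : ℝ) : ℂ), ⟨⟨by rw [mem_ofPred_eq, hre₀]; positivity, hmem⟩, ?_⟩, ?_⟩
    · intro h
      rw [mem_singleton_iff] at h
      rw [h] at hre₀; linarith
    · intro x hx a b ha hb hab
      refine ⟨convex_halfDisc w ρ ⟨by rw [mem_ofPred_eq, hre₀]; positivity, hmem⟩ hx.1 ha hb hab, ?_⟩
      rintro h
      rw [mem_singleton_iff] at h
      rcases ha.eq_or_lt with h0 | h0
      · rw [← h0, zero_add] at hab
        rw [← h0, hab] at h
        exact hx.2 (by simpa using h)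
      · have h1 := congrArg Complex.re h
        rw [Complex.add_re, Complex.smul_re, Complex.smul_re, hre₀, ← hre] at h1
        have h2 : 0 ≤ x.re := hx.1.1
        simp only [smul_eq_mul] at h1
        nlinarith [mul_pos h0 (half_pos hε), mul_nonneg hb h2]
  · exact .inl (halfDisc_mem_nhds hp hre)

/-- A coordinate patch whose image is a half-disc. -/
structure Patch (S : Type*) [TopologicalSpace S] where
  carrier : Set S
  toFun : S → ℂ
  inv : ℂ → S
  centre : ℂ
  radius : ℝ
  isOpen : IsOpen carrier
  continuousOn : ContinuousOn toFun carrier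
  image_eq : toFun '' carrier = halfDisc centre radius
  continuousOn_inv : ContinuousOn inv (halfDisc centre radius)
  left_inv : ∀ x ∈ carrier, inv (toFun x) = x

namespace Patch
variable {S : Type*} [TopologicalSpace S] (P Q : Patch S)

theorem injOn : InjOn P.toFun P.carrier := fun x hx y hy h => by
  rw [← P.left_inv x hx, h, P.left_inv y hy]

theorem mapsTo : MapsTo P.toFun P.carrier (halfDisc P.centre P.radius) :=
  fun _ hx => P.image_eq ▸ mem_image_of_mem _ hx

theorem mapsTo_inv : MapsTo P.inv (halfDisc P.centre P.radius) P.carrier := fun z hz => by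
  rw [← P.image_eq] at hz
  obtain ⟨x, hx, rfl⟩ := hz
  rwa [P.left_inv x hx]

theorem right_inv {z : ℂ} (hz : z ∈ halfDisc P.centre P.radius) : P.toFun (P.inv z) = z := by
  rw [← P.image_eq] at hz
  obtain ⟨x, hx, rfl⟩ := hz
  rw [P.left_inv x hx]

theorem injOn_inv : InjOn P.inv (halfDisc P.centre P.radius) := fun z hz w hw h => by
  rw [← P.right_inv hz, h, P.right_inv hw]

theorem isPreconnected : IsPreconnected P.carrier := by
  have : P.carrier = P.inv '' halfDisc P.centre P.radius :=
    Subset.antisymm (fun x hx => ⟨_, P.mapsTo hx, P.left_inv x hx⟩)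
      (by rintro _ ⟨z, hz, rfl⟩; exact P.mapsTo_inv hz)
  rw [this]
  exact (convex_halfDisc _ _).isPreconnected.image _ P.continuousOn_inv

variable {P Q} {x y : S}

theorem sub_ne_zero (hx : x ∈ P.carrier) (hy : y ∈ P.carrier) (hxy : y ≠ x) :
    P.toFun y - P.toFun x ≠ 0 := fun h => hxy (P.injOn hy hx (_root_.sub_eq_zero.1 h))

/-- The difference quotient of two coordinates has a continuous square root off the base point. -/
theorem exists_isSqrtOn (hx : x ∈ P.carrier) {g : S → ℂ} (hg : ContinuousOn g P.carrier)
    (hinj : InjOn g P.carrier) :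
    ∃ r, IsSqrtOn r (fun y => (g y - g x) / (P.toFun y - P.toFun x)) (P.carrier \ {x}) := by
  obtain ⟨r, hr⟩ := exists_isSqrtOn_div (convex_halfDisc P.centre P.radius) (P.mapsTo hx)
    (halfDisc_mem_nhds_or_starConvex (P.mapsTo hx)) (h := fun z => g (P.inv z))
    (hg.comp P.continuousOn_inv P.mapsTo_inv) (hinj.comp P.injOn_inv P.mapsTo_inv)
  refine ⟨_, (hr.comp (P.continuousOn.mono sdiff_subset) fun y hy => ⟨P.mapsTo hy.1, fun h =>
    hy.2 (P.injOn hy.1 hx h)⟩).congr fun y hy => ?_⟩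
  simp only [P.left_inv y hy.1, P.left_inv x hx]

/-- Square roots for the change between two coordinates. -/
theorem exists_isSqrtOn_change {P Q R : Patch S} (hx : x ∈ P.carrier)
    (hQ : P.carrier ⊆ Q.carrier) (hR : P.carrier ⊆ R.carrier) :
    ∃ r, IsSqrtOn r (fun y => (Q.toFun y - Q.toFun x) / (R.toFun y - R.toFun x))
      (P.carrier \ {x}) := by
  obtain ⟨r, hr⟩ := exists_isSqrtOn hx (Q.continuousOn.mono hQ) (Q.injOn.mono hQ)
  obtain ⟨q, hq⟩ := exists_isSqrtOn hx (R.continuousOn.mono hR) (R.injOn.mono hR)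
  have h1 : ∀ y ∈ P.carrier \ {x}, P.toFun y - P.toFun x ≠ 0 := fun y hy => sub_ne_zero hx hy.1 hy.2
  have h2 : ∀ y ∈ P.carrier \ {x}, R.toFun y - R.toFun x ≠ 0 := fun y hy =>
    sub_ne_zero (hR hx) (hR hy.1) hy.2
  refine ⟨_, (hr.div hq fun y hy => div_ne_zero (h2 y hy) (h1 y hy)).congr fun y hy => ?_⟩
  have := h1 y hy
  have := h2 y hy
  field_simp

/-- Interior points are interior in every patch. -/
theorem re_pos_of_re_pos (hxP : x ∈ P.carrier) (hxQ : x ∈ Q.carrier) (h : 0 < (P.toFun x).re) :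
    0 < (Q.toFun x).re := by
  by_contra hcon
  have him : (Q.toFun x).re = 0 := le_antisymm (not_lt.1 hcon) (Q.mapsTo hxQ).1
  have hn := halfDisc_mem_nhds (P.mapsTo hxP) h
  have hc : ContinuousAt P.inv (P.toFun x) := P.continuousOn_inv.continuousAt hn
  have hQn : Q.carrier ∈ 𝓝 (P.inv (P.toFun x)) := by
    rw [P.left_inv x hxP]; exact Q.isOpen.mem_nhds hxQ
  obtain ⟨ρ, hρ, hsub⟩ := Metric.mem_nhds_iff.1 (Filter.inter_mem hn (hc hQn))
  refine not_forall_re_nonneg_of_injOn_ball (p := P.toFun x) hρ (h := fun z => Q.toFun (P.inv z))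
    (Q.continuousOn.comp (P.continuousOn_inv.mono fun z hz => (hsub hz).1) fun z hz => (hsub hz).2)
    (Q.injOn.comp (P.injOn_inv.mono fun z hz => (hsub hz).1) fun z hz => (hsub hz).2)
    (fun z hz => ?_) (by simp only [P.left_inv x hxP, him])
  simp only [P.left_inv x hxP, Complex.sub_re, him, sub_zero]
  exact (Q.mapsTo (hsub hz).2).1

theorem tendsto_inv (hx : x ∈ P.carrier) (h : 0 < (P.toFun x).re) :
    Filter.Tendsto P.inv (𝓝 (P.toFun x)) (𝓝 x) := by
  have := P.continuousOn_inv.continuousAt (halfDisc_mem_nhds (P.mapsTo hx) h)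
  rwa [ContinuousAt, P.left_inv x hx] at this

end Patch

/-- Every point has arbitrarily small patches around it. -/
def HasPatches (S : Type*) [TopologicalSpace S] : Prop :=
  ∀ x : S, ∀ U : Set S, IsOpen U → x ∈ U → ∃ P : Patch S, x ∈ P.carrier ∧ P.carrier ⊆ U

theorem HasPatches.locallyConnectedSpace {S : Type*} [TopologicalSpace S] (hS : HasPatches S) :
    LocallyConnectedSpace S := by
  refine locallyConnectedSpace_iff_subsets_isOpen_isConnected.2 fun x U hU => ?_
  obtain ⟨V, hVU, hV, hxV⟩ := mem_nhds_iff.1 hU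
  obtain ⟨P, hxP, hPV⟩ := hS x V hV hxV
  exact ⟨P.carrier, hPV.trans hVU, P.isOpen, hxP, ⟨x, hxP⟩, P.isPreconnected⟩

theorem hasPatches_of_chartedSpace (S : Type*) [TopologicalSpace S]
    [ChartedSpace (EuclideanHalfSpace 2) S] : HasPatches S := by
  intro x U hU hxU
  let e := chartAt (EuclideanHalfSpace 2) x
  let j : EuclideanHalfSpace 2 → ℂ := fun v => ⟨v.1 0, v.1 1⟩
  let k : ℂ → EuclideanHalfSpace 2 := fun z => ⟨!₂[max z.re 0, z.im], by simp⟩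
  have hj : Continuous j := by
    have h : j = fun v => (v.1 0 : ℂ) + (v.1 1 : ℂ) * Complex.I := by
      funext v
      apply Complex.ext <;> simp [j]
    rw [h]
    fun_prop
  have hk : Continuous k := by
    refine Continuous.subtype_mk ?_ _
    refine (PiLp.continuous_toLp 2 _).comp (continuous_pi fun i => ?_)
    fin_cases i
    · exact Complex.continuous_re.max continuous_const
    · exact Complex.continuous_im
  have hkj : ∀ v, k (j v) = v := fun v => by
    apply Subtype.ext
    ext i
    fin_cases i
    · simpa [k, j] using v.2
    · simp [k, j]
  have hjk : ∀ z : ℂ, 0 ≤ z.re → j (k z) = z := fun z hz => by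
    apply Complex.ext <;> simp [k, j, hz]
  have hO : IsOpen (k ⁻¹' (e.target ∩ e.symm ⁻¹' U)) :=
    (e.isOpen_inter_preimage_symm hU).preimage hk
  have hxe : x ∈ e.source := mem_chart_source _ x
  have hw : j (e x) ∈ k ⁻¹' (e.target ∩ e.symm ⁻¹' U) := by
    simp only [mem_preimage, hkj]
    exact ⟨e.map_source hxe, by rw [mem_preimage, e.left_inv hxe]; exact hxU⟩
  obtain ⟨ρ, hρ, hsub⟩ := Metric.isOpen_iff.1 hO _ hw
  refine ⟨{ carrier := e.source ∩ e ⁻¹' (j ⁻¹' Metric.ball (j (e x)) ρ)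
            toFun := fun y => j (e y)
            inv := fun z => e.symm (k z)
            centre := j (e x)
            radius := ρ
            isOpen := e.isOpen_inter_preimage (Metric.isOpen_ball.preimage hj)
            continuousOn := hj.comp_continuousOn (e.continuousOn.mono inter_subset_left)
            image_eq := ?_
            continuousOn_inv := e.continuousOn_symm.comp hk.continuousOn fun z hz => (hsub hz.2).1
            left_inv := fun y hy => by rw [hkj, e.left_inv hy.1] },
    ⟨hxe, Metric.mem_ball_self hρ⟩, ?_⟩
  · apply Subset.antisymm
    · rintro _ ⟨y, hy, rfl⟩
      exact ⟨(e y).2, hy.2⟩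
    · intro z hz
      have ht := (hsub hz.2).1
      have h1 : j (e (e.symm (k z))) = z := by rw [e.right_inv ht, hjk z hz.1]
      exact ⟨e.symm (k z), ⟨e.map_target ht, by simpa only [mem_preimage, h1] using hz.2⟩, h1⟩
  · rintro y ⟨hy, hyb⟩
    have h1 := (hsub hyb).2
    rwa [mem_preimage, hkj, e.left_inv hy] at h1

section
variable {S : Type*} [MetricSpace S]

/-- The value of a loop at an angle. -/
noncomputable def loopAt (s : C(Circle, S)) (θ : ℝ) : S := s (Circle.exp θ)

theorem continuous_loopAt (s : C(Circle, S)) : Continuous (loopAt s) :=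
  s.continuous.comp Circle.exp.continuous

theorem loopAt_add_int (s : C(Circle, S)) (θ : ℝ) (k : ℤ) :
    loopAt s (θ + k * (2 * Real.pi)) = loopAt s θ := by
  rw [loopAt, loopAt, Circle.exp_eq_exp.2 ⟨k, rfl⟩]

theorem loopAt_mem_range (s : C(Circle, S)) (θ : ℝ) : loopAt s θ ∈ range s := mem_range_self _

theorem mem_range_loopAt {s : C(Circle, S)} {y : S} (hy : y ∈ range s) : ∃ θ, loopAt s θ = y := by
  obtain ⟨z, rfl⟩ := hy
  obtain ⟨θ, rfl⟩ := Circle.exp_surjective z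
  exact ⟨θ, rfl⟩

theorem exists_finite_patches (hS : HasPatches S) {K : Set S} (hK : IsCompact K) {l : ℝ}
    (hl : 0 < l) : ∃ F : Set (Patch S), F.Finite ∧ ∃ μ > 0, ∀ y ∈ K, ∃ P ∈ F,
      Metric.ball y μ ⊆ P.carrier ∧ P.carrier ⊆ Metric.ball y l := by
  choose P hP hPb using fun y : S =>
    hS y (Metric.ball y (l / 2)) Metric.isOpen_ball (Metric.mem_ball_self (half_pos hl))
  obtain ⟨t, ht⟩ := hK.elim_finite_subcover (fun y => (P y).carrier) (fun y => (P y).isOpen)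
    fun y _ => mem_iUnion.2 ⟨y, hP y⟩
  obtain ⟨μ, hμ, hb⟩ := lebesgue_number_lemma_of_metric (c := fun i : t => (P i).carrier) hK
    (fun i => (P i).isOpen) (ht.trans (iUnion₂_subset fun i hi => subset_iUnion_of_subset ⟨i, hi⟩ subset_rfl))
  refine ⟨P '' t, t.finite_toSet.image _, μ, hμ, fun y hy => ?_⟩
  obtain ⟨i, hi⟩ := hb y hy
  refine ⟨P i, mem_image_of_mem _ i.2, hi, fun z hz => ?_⟩
  have h1 := hPb i hz
  have h2 := hPb i (hi (Metric.mem_ball_self hμ))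
  rw [Metric.mem_ball] at *
  linarith [dist_triangle_right z y i]

theorem exists_thin (Q : Patch S) {K L : Set S} (hK : IsCompact K) (hL : IsCompact L) {l c : ℝ}
    (hc : 0 < c) (hl : 0 < l) : ∃ ε > 0, ∀ x ∈ K, ∀ y ∈ L, Metric.ball x l ⊆ Q.carrier →
      Metric.ball y l ⊆ Q.carrier → c ≤ dist x y → ∀ w ∈ Metric.ball y ε, ∀ w' ∈ Metric.ball y ε,
        0 < ((Q.toFun w - Q.toFun x) / (Q.toFun w' - Q.toFun x)).re := by
  have hcl : IsClosed {x : S | Metric.ball x l ⊆ Q.carrier} := by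
    have : {x : S | Metric.ball x l ⊆ Q.carrier} = (Metric.thickening l Q.carrierᶜ)ᶜ := by
      ext x
      simp only [mem_ofPred_eq, mem_compl_iff, Metric.mem_thickening_iff, not_exists, not_and,
        not_lt]
      constructor
      · intro h z hz
        by_contra hlt
        exact hz (h (by rw [Metric.mem_ball, dist_comm]; exact not_le.1 hlt))
      · intro h z hz
        by_contra hcon
        have := h z hcon
        rw [Metric.mem_ball, dist_comm] at hz
        linarith
    rw [this]
    exact Metric.isOpen_thickening.isClosed_compl
  have hA : IsCompact (K ×ˢ L ∩ {p : S × S | Metric.ball p.1 l ⊆ Q.carrier ∧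
      Metric.ball p.2 l ⊆ Q.carrier ∧ c ≤ dist p.1 p.2}) :=
    (hK.prod hL).inter_right ((hcl.preimage continuous_fst).inter
      ((hcl.preimage continuous_snd).inter (isClosed_le continuous_const continuous_dist)))
  obtain ⟨δ, hδ, hsub⟩ := (hA.image (f := fun p : S × S => (p.1, p.2, p.2))
    (by fun_prop)).exists_thickening_subset_open (isOpen_interior
      (s := {q : S × S × S | 0 < ((Q.toFun q.2.1 - Q.toFun q.1) /
        (Q.toFun q.2.2 - Q.toFun q.1)).re})) (by
      rintro _ ⟨⟨x, y⟩, ⟨-, hx, hy, hxy⟩, rfl⟩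
      rw [mem_interior_iff_mem_nhds]
      have hxQ := hx (Metric.mem_ball_self hl)
      have hyQ := hy (Metric.mem_ball_self hl)
      have hne : y ≠ x := fun h => by
        simp only [h, dist_self] at hxy; linarith
      have h0 := Patch.sub_ne_zero hxQ hyQ hne
      have hcx := Q.continuousOn.continuousAt (Q.isOpen.mem_nhds hxQ)
      have hcy := Q.continuousOn.continuousAt (Q.isOpen.mem_nhds hyQ)
      have h1 : ContinuousAt (fun q : S × S × S => Q.toFun q.1) (x, y, y) :=
        ContinuousAt.comp (f := fun q : S × S × S => q.1) hcx continuousAt_fst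
      have h2 : ContinuousAt (fun q : S × S × S => Q.toFun q.2.1) (x, y, y) :=
        ContinuousAt.comp (f := fun q : S × S × S => q.2.1) hcy
          (continuous_fst.comp continuous_snd).continuousAt
      have h3 : ContinuousAt (fun q : S × S × S => Q.toFun q.2.2) (x, y, y) :=
        ContinuousAt.comp (f := fun q : S × S × S => q.2.2) hcy
          (continuous_snd.comp continuous_snd).continuousAt
      refine (Complex.continuous_re.continuousAt.comp
        ((h2.sub h1).div (h3.sub h1) h0)).eventually (lt_mem_nhds ?_)
      simp [div_self h0])
  refine ⟨δ, hδ, fun x hx y hy hxl hyl hxy w hw w' hw' => ?_⟩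
  have hm : (x, w, w') ∈ Metric.thickening δ
      ((fun p : S × S => (p.1, p.2, p.2)) '' (K ×ˢ L ∩ {p : S × S | Metric.ball p.1 l ⊆ Q.carrier ∧
      Metric.ball p.2 l ⊆ Q.carrier ∧ c ≤ dist p.1 p.2})) := by
    refine Metric.mem_thickening_iff.2 ⟨(x, y, y), ⟨(x, y), ⟨⟨hx, hy⟩, hxl, hyl, hxy⟩, rfl⟩, ?_⟩
    simp only [Prod.dist_eq, dist_self]
    rw [Metric.mem_ball] at hw hw'
    exact max_lt hδ (max_lt hw hw')
  have := interior_subset (hsub hm)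
  exact this

/-- Scales along which loops near a given embedded circle are compared. -/
structure Windows (γ : C(Circle, S)) where
  fam : Set (Patch S)
  lam : ℝ
  mu : ℝ
  del : ℝ
  c : ℝ
  eps₁ : ℝ
  eps : ℝ
  lam_pos : 0 < lam
  mu_pos : 0 < mu
  del_pos : 0 < del
  del_lt : del < 1
  c_pos : 0 < c
  eps_pos : 0 < eps
  c_le_mu : c ≤ mu
  c_le_lam : c ≤ lam
  eps₁_le_c : eps₁ ≤ c
  eps_le : eps ≤ eps₁
  exists_fam : ∀ θ, ∃ Q ∈ fam, Metric.ball (loopAt γ θ) (5 * lam) ⊆ Q.carrier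
  exists_patch : ∀ θ, ∃ P : Patch S, Metric.ball (loopAt γ θ) (2 * mu) ⊆ P.carrier ∧
    P.carrier ⊆ Metric.ball (loopAt γ θ) lam
  dist_lt_lam : ∀ θ θ', |θ - θ'| ≤ 2 * del → dist (loopAt γ θ) (loopAt γ θ') < lam
  dist_lt_mu : ∀ θ θ', |θ - θ'| ≤ 2 * del → dist (loopAt γ θ) (loopAt γ θ') < mu
  sep : ∀ θ θ', dist (loopAt γ θ) (loopAt γ θ') < 3 * c →
    ∃ k : ℤ, |θ' + k * (2 * Real.pi) - θ| < del / 2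
  thin : ∀ Q ∈ fam, ∀ x θ, Metric.ball x lam ⊆ Q.carrier →
    Metric.ball (loopAt γ θ) lam ⊆ Q.carrier → c / 2 ≤ dist x (loopAt γ θ) →
    (∃ θ', dist x (loopAt γ θ') ≤ c) → ∀ w ∈ Metric.ball (loopAt γ θ) eps₁,
    ∀ w' ∈ Metric.ball (loopAt γ θ) eps₁,
      0 < ((Q.toFun w - Q.toFun x) / (Q.toFun w' - Q.toFun x)).re
  connect : ∀ θ, ∃ M, IsPreconnected M ∧ Metric.ball (loopAt γ θ) eps ⊆ M ∧
    M ⊆ Metric.ball (loopAt γ θ) eps₁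

theorem Windows.eps₁_le_mu {γ : C(Circle, S)} (W : Windows γ) : W.eps₁ ≤ W.mu :=
  W.eps₁_le_c.trans W.c_le_mu

theorem Windows.eps₁_le_lam {γ : C(Circle, S)} (W : Windows γ) : W.eps₁ ≤ W.lam :=
  W.eps₁_le_c.trans W.c_le_lam

theorem exists_windows [LocallyCompactSpace S] (hS : HasPatches S) (γ : C(Circle, S))
    (hγ : Function.Injective γ) : Nonempty (Windows γ) := by
  have hR : IsCompact (range γ) := isCompact_range γ.continuous
  obtain ⟨fam, hfin, μ₀, hμ₀, hfam⟩ := exists_finite_patches hS hR one_pos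
  set lam := μ₀ / 5 with hlam
  have hlam0 : 0 < lam := by positivity
  obtain ⟨F₁, -, μ₁, hμ₁, hmu⟩ := exists_finite_patches hS hR hlam0
  set mu := μ₁ / 2 with hmudef
  have hmu0 : 0 < mu := by positivity
  obtain ⟨del, hdel0, hdel1, hdel⟩ : ∃ del : ℝ, 0 < del ∧ del < 1 ∧ ∀ θ θ', |θ - θ'| ≤ 2 * del →
      dist (loopAt γ θ) (loopAt γ θ') < min lam mu := by
    have hev : ∀ᶠ φ : ℝ in 𝓝 0, ∀ z ∈ (univ : Set Circle),
        dist (γ (z * Circle.exp φ)) (γ z) < min lam mu := by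
      refine isCompact_univ.eventually_forall_of_forall_eventually (x₀ := (0 : ℝ))
        (P := fun φ z => dist (γ (z * Circle.exp φ)) (γ z) < min lam mu) fun z _ => ?_
      have hc : Continuous fun q : ℝ × Circle => dist (γ (q.2 * Circle.exp q.1)) (γ q.2) := by
        fun_prop
      exact hc.continuousAt.eventually (gt_mem_nhds (by simpa using ⟨hlam0, hmu0⟩))
    obtain ⟨r, hr, hb⟩ := Metric.eventually_nhds_iff.1 hev
    have h0 : 0 < min r 1 := lt_min hr one_pos
    refine ⟨min r 1 / 4, by positivity, by linarith [min_le_right r 1], fun θ θ' h => ?_⟩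
    have := hb (y := θ - θ') (by rw [Real.dist_0_eq_abs]; linarith [min_le_left r 1])
      (Circle.exp θ') trivial
    rwa [← Circle.exp_add, add_sub_cancel] at this
  obtain ⟨a, ha, hsep⟩ : ∃ a : ℝ, 0 < a ∧ ∀ θ θ', dist (loopAt γ θ) (loopAt γ θ') < a →
      ∃ k : ℤ, |θ' + k * (2 * Real.pi) - θ| < del / 2 := by
    have hcl : IsClosed {q : Circle × Circle | q.2 / q.1 ∉ Circle.centeredArc (del / 2)} :=
      ((Circle.isOpen_centeredArc (del / 2)).isClosed_compl).preimage
        (continuous_snd.div' continuous_fst)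
    obtain ⟨a, ha, h⟩ := hcl.isCompact.exists_forall_le' (a := (0 : ℝ))
      (f := fun q : Circle × Circle => dist (γ q.1) (γ q.2)) (by fun_prop) (by
        rintro ⟨z, z'⟩ hz
        refine dist_pos.2 fun he => hz ?_
        rw [hγ he]
        exact ⟨0, by simpa using half_pos hdel0, by simp⟩)
    refine ⟨a, ha, fun θ θ' hd => ?_⟩
    by_contra hcon
    refine absurd (h (Circle.exp θ, Circle.exp θ') ?_) (not_le.2 hd)
    rintro ⟨x, hx, hxe⟩
    simp only [← Circle.exp_sub] at hxe
    obtain ⟨m, rfl⟩ := Circle.exp_eq_exp.1 hxe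
    refine hcon ⟨m, ?_⟩
    rw [mem_ofPred_eq] at hx
    convert hx using 2
    ring
  obtain ⟨r, hr, hrc⟩ := hR.exists_isCompact_cthickening
  set c := min (a / 3) (min r (min mu lam)) with hcdef
  have hc0 : 0 < c := by positivity
  have hca : c ≤ a / 3 := min_le_left _ _
  have hcr : c ≤ r := (min_le_right _ _).trans (min_le_left _ _)
  have hcm : c ≤ mu := (min_le_right _ _).trans ((min_le_right _ _).trans (min_le_left _ _))
  have hcl : c ≤ lam := (min_le_right _ _).trans ((min_le_right _ _).trans (min_le_right _ _))
  obtain ⟨e, he0, he⟩ : ∃ e > 0, ∀ Q ∈ fam, ∀ x ∈ Metric.cthickening r (range γ), ∀ y ∈ range γ,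
      Metric.ball x lam ⊆ Q.carrier → Metric.ball y lam ⊆ Q.carrier → c / 2 ≤ dist x y →
      ∀ w ∈ Metric.ball y e, ∀ w' ∈ Metric.ball y e,
        0 < ((Q.toFun w - Q.toFun x) / (Q.toFun w' - Q.toFun x)).re := by
    choose e he0 he using fun Q : Patch S => exists_thin Q hrc hR (half_pos hc0) hlam0
    obtain ⟨m, hm0, hm⟩ : ∃ m > 0, ∀ Q ∈ fam, m ≤ e Q := by
      rcases fam.eq_empty_or_nonempty with h | h
      · exact ⟨1, one_pos, by simp [h]⟩
      · obtain ⟨Q, hQ, hmin⟩ := hfin.exists_minimalFor e fam h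
        exact ⟨e Q, he0 Q, fun Q' hQ' => (le_total (e Q) (e Q')).elim id fun h => hmin hQ' h⟩
    exact ⟨m, hm0, fun Q hQ x hx y hy h1 h2 h3 w hw w' hw' => he Q x hx y hy h1 h2 h3 w
      (Metric.ball_subset_ball (hm Q hQ) hw) w' (Metric.ball_subset_ball (hm Q hQ) hw')⟩
  set e₁ := min e c with he₁
  have he₁0 : 0 < e₁ := by positivity
  obtain ⟨F₂, -, μ₂, hμ₂, hcon⟩ := exists_finite_patches hS hR he₁0
  exact ⟨{
    fam := fam, lam := lam, mu := mu, del := del, c := c, eps₁ := e₁, eps := min μ₂ e₁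
    lam_pos := hlam0, mu_pos := hmu0, del_pos := hdel0, del_lt := hdel1, c_pos := hc0
    eps_pos := by positivity
    c_le_mu := hcm
    c_le_lam := hcl
    eps₁_le_c := min_le_right _ _
    eps_le := min_le_right _ _
    exists_fam := fun θ => by
      obtain ⟨Q, hQ, h, -⟩ := hfam _ (loopAt_mem_range γ θ)
      exact ⟨Q, hQ, by rwa [hlam, mul_div_cancel₀ _ (by norm_num)]⟩
    exists_patch := fun θ => by
      obtain ⟨Q, -, h, h'⟩ := hmu _ (loopAt_mem_range γ θ)
      exact ⟨Q, by rwa [hmudef, mul_div_cancel₀ _ (by norm_num)], h'⟩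
    dist_lt_lam := fun θ θ' h => (hdel θ θ' h).trans_le (min_le_left _ _)
    dist_lt_mu := fun θ θ' h => (hdel θ θ' h).trans_le (min_le_right _ _)
    sep := fun θ θ' h => hsep θ θ' (by linarith)
    thin := fun Q hQ x θ h1 h2 h3 ⟨θ', h4⟩ w hw w' hw' =>
      he Q hQ x (Metric.mem_cthickening_of_dist_le _ _ _ _ (loopAt_mem_range γ θ') (h4.trans hcr))
        _ (loopAt_mem_range γ θ) h1 h2 h3 w (Metric.ball_subset_ball (min_le_left _ _) hw) w'
        (Metric.ball_subset_ball (min_le_left _ _) hw')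
    connect := fun θ => by
      obtain ⟨Q, -, h, h'⟩ := hcon _ (loopAt_mem_range γ θ)
      exact ⟨Q.carrier, Q.isPreconnected,
        (Metric.ball_subset_ball (min_le_left _ _)).trans h, h'⟩ }⟩

end

namespace Windows
variable {S : Type*} [MetricSpace S] {γ : C(Circle, S)} (W : Windows γ)

/-- `s` is so close to `γ` that the windows apply to it. -/
def Good (s : C(Circle, S)) : Prop := ∀ θ, dist (loopAt s θ) (loopAt γ θ) < W.eps

theorem eventually_good : ∀ᶠ s in 𝓝 γ, W.Good s :=
  Filter.mem_of_superset (Metric.ball_mem_nhds γ W.eps_pos) fun _ hs _ =>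
    (ContinuousMap.dist_lt_iff W.eps_pos).1 hs _

/-- The quotient of the positions of two loops relative to `x`, read in a patch. -/
noncomputable def quot (Q : Patch S) (s t : C(Circle, S)) (x : S) (θ : ℝ) : ℂ :=
  (Q.toFun (loopAt s θ) - Q.toFun x) / (Q.toFun (loopAt t θ) - Q.toFun x)

/-- The window at angle `θ₀` in the patch `Q` sees the point `x`. -/
structure Adm (θ₀ : ℝ) (Q : Patch S) (x : S) : Prop where
  mem_fam : Q ∈ W.fam
  dist_lt : dist x (loopAt γ θ₀) < W.c
  ball_subset : Metric.ball (loopAt γ θ₀) (4 * W.lam) ⊆ Q.carrier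

/-- The comparison sign of two loops at `x` as seen in one window. -/
noncomputable def val (Q : Patch S) (s t : C(Circle, S)) (x : S) (θ₀ : ℝ) : ℂ :=
  sqrtSign (quot Q s t x) (θ₀ - W.del) (θ₀ + W.del)

variable {W} {θ₀ θ₁ : ℝ} {Q R : Patch S} {s t u : C(Circle, S)} {x : S}

theorem Good.mem_ball (hs : W.Good s) (θ : ℝ) : loopAt s θ ∈ Metric.ball (loopAt γ θ) W.eps₁ :=
  Metric.ball_subset_ball W.eps_le (hs θ)

namespace Adm

theorem ball_loop_subset (h : W.Adm θ₀ Q x) {θ : ℝ} (hθ : |θ - θ₀| ≤ 2 * W.del) :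
    Metric.ball (loopAt γ θ) W.lam ⊆ Q.carrier := by
  refine subset_trans (Metric.ball_subset_ball' ?_) h.ball_subset
  linarith [W.dist_lt_lam θ θ₀ hθ, W.lam_pos]

theorem ball_point_subset (h : W.Adm θ₀ Q x) : Metric.ball x W.lam ⊆ Q.carrier := by
  refine subset_trans (Metric.ball_subset_ball' ?_) h.ball_subset
  linarith [h.dist_lt, W.lam_pos, W.c_le_lam]

theorem mem (h : W.Adm θ₀ Q x) : x ∈ Q.carrier :=
  h.ball_point_subset (Metric.mem_ball_self W.lam_pos)

theorem loop_mem (h : W.Adm θ₀ Q x) (hs : W.Good s) {θ : ℝ} (hθ : |θ - θ₀| ≤ 2 * W.del) :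
    loopAt s θ ∈ Q.carrier :=
  h.ball_loop_subset hθ (Metric.ball_subset_ball W.eps₁_le_lam (hs.mem_ball θ))

theorem sub_ne_zero (h : W.Adm θ₀ Q x) (hs : W.Good s) (hx : x ∉ range s) {θ : ℝ}
    (hθ : |θ - θ₀| ≤ 2 * W.del) : Q.toFun (loopAt s θ) - Q.toFun x ≠ 0 :=
  Patch.sub_ne_zero h.mem (h.loop_mem hs hθ) fun he => hx (he ▸ loopAt_mem_range s θ)

theorem continuousOn_loop (h : W.Adm θ₀ Q x) (hs : W.Good s) :
    ContinuousOn (fun θ => Q.toFun (loopAt s θ) - Q.toFun x)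
      (Icc (θ₀ - 2 * W.del) (θ₀ + 2 * W.del)) :=
  (Q.continuousOn.comp (continuous_loopAt s).continuousOn fun θ hθ => h.loop_mem hs
    (abs_le.2 ⟨by linarith [hθ.1], by linarith [hθ.2]⟩)).sub continuousOn_const

theorem nonvan (h : W.Adm θ₀ Q x) (hs : W.Good s) (ht : W.Good t) (hxs : x ∉ range s)
    (hxt : x ∉ range t) : Nonvan (quot Q s t x) (θ₀ - 2 * W.del) (θ₀ + 2 * W.del) := by
  have hm : ∀ θ ∈ Icc (θ₀ - 2 * W.del) (θ₀ + 2 * W.del), |θ - θ₀| ≤ 2 * W.del :=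
    fun θ hθ => abs_le.2 ⟨by linarith [hθ.1], by linarith [hθ.2]⟩
  exact ⟨by linarith [W.del_pos], (h.continuousOn_loop hs).div (h.continuousOn_loop ht)
    fun θ hθ => h.sub_ne_zero ht hxt (hm θ hθ),
    fun θ hθ => div_ne_zero (h.sub_ne_zero hs hxs (hm θ hθ)) (h.sub_ne_zero ht hxt (hm θ hθ))⟩

theorem nonvan_del (h : W.Adm θ₀ Q x) (hs : W.Good s) (ht : W.Good t) (hxs : x ∉ range s)
    (hxt : x ∉ range t) : Nonvan (quot Q s t x) (θ₀ - W.del) (θ₀ + W.del) := by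
  have := W.del_pos
  exact (h.nonvan hs ht hxs hxt).mono (by linarith) (by linarith) (by linarith)

theorem thin (h : W.Adm θ₀ Q x) {θ : ℝ} (hθ : |θ - θ₀| ≤ 2 * W.del)
    (hfar : W.c / 2 ≤ dist x (loopAt γ θ)) : ∀ w ∈ Metric.ball (loopAt γ θ) W.eps₁,
    ∀ w' ∈ Metric.ball (loopAt γ θ) W.eps₁,
      0 < ((Q.toFun w - Q.toFun x) / (Q.toFun w' - Q.toFun x)).re :=
  W.thin Q h.mem_fam x θ h.ball_point_subset (h.ball_loop_subset hθ) hfar ⟨θ₀, h.dist_lt.le⟩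

theorem re_pos_of_far (h : W.Adm θ₀ Q x) (hs : W.Good s) (ht : W.Good t) {θ : ℝ}
    (hθ : |θ - θ₀| ≤ 2 * W.del) (hfar : W.c / 2 ≤ dist x (loopAt γ θ)) :
    0 < (quot Q s t x θ).re :=
  h.thin hθ hfar _ (hs.mem_ball θ) _ (ht.mem_ball θ)

theorem far (h : W.Adm θ₀ Q x) {θ : ℝ} (h1 : W.del / 2 ≤ |θ - θ₀|) (h2 : |θ - θ₀| ≤ 2 * W.del) :
    W.c / 2 ≤ dist x (loopAt γ θ) := by
  by_contra! hcon
  obtain ⟨k, hk⟩ := W.sep θ₀ θ (by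
    linarith [dist_triangle_left (loopAt γ θ₀) (loopAt γ θ) x, h.dist_lt, W.c_pos])
  have hpi := Real.pi_gt_three
  have h3 : |(k : ℝ) * (2 * Real.pi)| < 2.5 := by
    rw [abs_lt] at hk ⊢
    rw [abs_le] at h2
    constructor <;> linarith [hk.1, hk.2, h2.1, h2.2, W.del_lt]
  have hk0 : k = 0 := by
    by_contra hk0
    have : (1 : ℝ) ≤ |(k : ℝ)| := by exact_mod_cast Int.one_le_abs hk0
    rw [abs_mul, abs_of_pos (by positivity : 0 < 2 * Real.pi)] at h3
    nlinarith
  rw [hk0] at hk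
  simp only [Int.cast_zero, zero_mul, add_zero] at hk
  linarith

theorem re_pos (h : W.Adm θ₀ Q x) (hs : W.Good s) (ht : W.Good t) {θ : ℝ}
    (h1 : W.del / 2 ≤ |θ - θ₀|) (h2 : |θ - θ₀| ≤ 2 * W.del) : 0 < (quot Q s t x θ).re :=
  h.re_pos_of_far hs ht h2 (h.far h1 h2)

theorem re_pos_left (h : W.Adm θ₀ Q x) (hs : W.Good s) (ht : W.Good t) :
    0 < (quot Q s t x (θ₀ - W.del)).re := by
  have := W.del_pos
  apply h.re_pos hs ht <;> rw [sub_sub_cancel_left, abs_neg, abs_of_pos this] <;> linarith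

theorem re_pos_right (h : W.Adm θ₀ Q x) (hs : W.Good s) (ht : W.Good t) :
    0 < (quot Q s t x (θ₀ + W.del)).re := by
  have := W.del_pos
  apply h.re_pos hs ht <;> rw [add_sub_cancel_left, abs_of_pos this] <;> linarith

theorem sqrt_end_eq (h : W.Adm θ₀ Q x) (h' : W.Adm θ₀ R x) (hs : W.Good s) (ht : W.Good t)
    {P : Patch S} (hP : Metric.ball (loopAt γ θ₀) (2 * W.mu) ⊆ P.carrier) {v : S → ℂ}
    (hv : IsSqrtOn v (fun y => (Q.toFun y - Q.toFun x) / (R.toFun y - R.toFun x))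
      (P.carrier \ {x})) {θ : ℝ} (h1 : W.del / 2 ≤ |θ - θ₀|) (h2 : |θ - θ₀| ≤ 2 * W.del) :
    v (loopAt s θ) / v (loopAt t θ) = csqrt (quot Q s t x θ) / csqrt (quot R s t x θ) := by
  obtain ⟨M, hM, hbM, hMb⟩ := W.connect θ
  have hQ := h.thin h2 (h.far h1 h2)
  have hR := h'.thin h2 (h'.far h1 h2)
  have hsub : ∀ {T : Patch S} (_ : W.Adm θ₀ T x), Metric.ball (loopAt γ θ) W.eps₁ ⊆ T.carrier :=
    fun hT => (Metric.ball_subset_ball W.eps₁_le_lam).trans (hT.ball_loop_subset h2)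
  have hxM : ∀ w ∈ M, w ≠ x := by
    rintro w hw rfl
    simpa using hQ w (hMb hw) w (hMb hw)
  have hMP : M ⊆ P.carrier \ {x} := fun w hw => ⟨hP (by
    have h3 := hMb hw
    rw [Metric.mem_ball] at h3 ⊢
    linarith [dist_triangle w (loopAt γ θ) (loopAt γ θ₀), W.dist_lt_mu θ θ₀ h2, W.eps₁_le_mu]),
    hxM w hw⟩
  have hne : ∀ {T : Patch S} (_ : W.Adm θ₀ T x), ∀ w ∈ M, T.toFun w - T.toFun x ≠ 0 :=
    fun hT w hw => Patch.sub_ne_zero hT.mem (hsub hT (hMb hw)) (hxM w hw)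
  have hvM := hv.mono hMP
  have hv0 : ∀ w ∈ M, v w ≠ 0 := fun w hw => hvM.ne_zero hw (div_ne_zero (hne h w hw) (hne h' w hw))
  have hcont : ∀ {T : Patch S} (_ : W.Adm θ₀ T x), ContinuousOn
      (fun q : S × S => (T.toFun q.1 - T.toFun x) / (T.toFun q.2 - T.toFun x)) (M ×ˢ M) := by
    intro T hT
    have hc := T.continuousOn.mono (hMb.trans (hsub hT))
    exact ((hc.comp continuousOn_fst fun q hq => hq.1).sub continuousOn_const).div
      ((hc.comp continuousOn_snd fun q hq => hq.2).sub continuousOn_const)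
      fun q hq => hne hT _ hq.2
  have e1 := (hvM.comp (f := Prod.fst) (t := M ×ˢ M) continuousOn_fst fun q hq => hq.1).div
    (hvM.comp (f := Prod.snd) (t := M ×ˢ M) continuousOn_snd fun q hq => hq.2)
    fun q hq => div_ne_zero (hne h _ hq.2) (hne h' _ hq.2)
  have e2 := ((isSqrtOn_csqrt (hcont h) fun q hq => mem_slitPlane_of_re_pos
    (hQ _ (hMb hq.1) _ (hMb hq.2))).div (isSqrtOn_csqrt (hcont h') fun q hq =>
      mem_slitPlane_of_re_pos (hR _ (hMb hq.1) _ (hMb hq.2)))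
    fun q hq => div_ne_zero (hne h' _ hq.1) (hne h' _ hq.2)).congr
      (g' := fun q => (Q.toFun q.1 - Q.toFun x) / (R.toFun q.1 - R.toFun x) /
        ((Q.toFun q.2 - Q.toFun x) / (R.toFun q.2 - R.toFun x)))
      fun q _ => div_div_div_comm _ _ _ _
  have hms : loopAt s θ ∈ M := hbM (hs θ)
  have hmt : loopAt t θ ∈ M := hbM (ht θ)
  refine e1.eqOn e2 (hM.prod hM) (fun q hq => div_ne_zero (div_ne_zero (hne h _ hq.1)
    (hne h' _ hq.1)) (div_ne_zero (hne h _ hq.2) (hne h' _ hq.2)))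
    (y := (loopAt t θ, loopAt t θ)) ⟨hmt, hmt⟩ ?_ (show (loopAt s θ, loopAt t θ) ∈ M ×ˢ M from ⟨hms, hmt⟩)
  simp only [div_self (hv0 _ hmt), div_self (hne h _ hmt), div_self (hne h' _ hmt), csqrt_one,
    div_one]

theorem val_change (h : W.Adm θ₀ Q x) (h' : W.Adm θ₀ R x) (hs : W.Good s) (ht : W.Good t)
    (hxs : x ∉ range s) (hxt : x ∉ range t) : W.val Q s t x θ₀ = W.val R s t x θ₀ := by
  obtain ⟨P, hP, hPl⟩ := W.exists_patch θ₀
  have hdel := W.del_pos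
  have hxP : x ∈ P.carrier := hP (by
    rw [Metric.mem_ball]; linarith [h.dist_lt, W.c_le_mu, W.mu_pos])
  have h4 : P.carrier ⊆ Metric.ball (loopAt γ θ₀) (4 * W.lam) :=
    hPl.trans (Metric.ball_subset_ball (by linarith [W.lam_pos]))
  obtain ⟨v, hv⟩ := Patch.exists_isSqrtOn_change hxP (h4.trans h.ball_subset)
    (h4.trans h'.ball_subset)
  have habs : ∀ θ ∈ Icc (θ₀ - W.del) (θ₀ + W.del), |θ - θ₀| ≤ 2 * W.del := fun θ hθ =>
    abs_le.2 ⟨by linarith [hθ.1], by linarith [hθ.2]⟩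
  have hmaps : ∀ {s : C(Circle, S)} (_ : W.Good s) (_ : x ∉ range s),
      MapsTo (loopAt s) (Icc (θ₀ - W.del) (θ₀ + W.del)) (P.carrier \ {x}) := by
    refine fun {s} hs hxs θ hθ => ⟨hP ?_, fun he => hxs (he ▸ loopAt_mem_range s θ)⟩
    rw [Metric.mem_ball]
    linarith [dist_triangle (loopAt s θ) (loopAt γ θ) (loopAt γ θ₀), hs θ, W.eps_le,
      W.dist_lt_mu θ θ₀ (habs θ hθ), W.eps₁_le_mu]
  have hd := (h.nonvan_del hs ht hxs hxt).div (h'.nonvan_del hs ht hxs hxt)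
  have hsq : IsSqrtOn (fun θ => v (loopAt s θ) / v (loopAt t θ))
      (fun θ => quot Q s t x θ / quot R s t x θ) (Icc (θ₀ - W.del) (θ₀ + W.del)) :=
    ((hv.comp (continuous_loopAt s).continuousOn (hmaps hs hxs)).div
      (hv.comp (continuous_loopAt t).continuousOn (hmaps ht hxt)) fun θ hθ =>
      div_ne_zero (h.sub_ne_zero ht hxt (habs θ hθ)) (h'.sub_ne_zero ht hxt (habs θ hθ))).congr
      fun θ _ => div_div_div_comm _ _ _ _
  have hr := sqrtRatio_eq hd.1 hd.3 hsq
  have hl : |θ₀ - W.del - θ₀| = W.del := by rw [sub_sub_cancel_left, abs_neg, abs_of_pos hdel]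
  have hr' : |θ₀ + W.del - θ₀| = W.del := by rw [add_sub_cancel_left, abs_of_pos hdel]
  rw [sqrt_end_eq h h' hs ht hP hv (by rw [hr']; linarith) (by rw [hr']; linarith),
    sqrt_end_eq h h' hs ht hP hv (by rw [hl]; linarith) (by rw [hl]; linarith)] at hr
  have hm := sqrtRatio_mul hd (h'.nonvan_del hs ht hxs hxt)
  have hn := h'.nonvan_del hs ht hxs hxt
  rw [← sqrtRatio_congr (h := quot Q s t x) (hd.mul hn) (fun θ hθ =>
    (div_mul_cancel₀ _ (hn.3 θ hθ)).symm), hr] at hm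
  have c1 := csqrt_ne_zero (quot Q s t x (θ₀ - W.del))
  have c2 := csqrt_ne_zero (quot Q s t x (θ₀ + W.del))
  have c3 := csqrt_ne_zero (quot R s t x (θ₀ - W.del))
  have c4 := csqrt_ne_zero (quot R s t x (θ₀ + W.del))
  rw [val, val, sqrtSign, sqrtSign, hm]
  field_simp

end Adm
end Windows

namespace Windows
variable {S : Type*} [MetricSpace S] {γ : C(Circle, S)} {W : Windows γ}
  {θ₀ θ₁ : ℝ} {Q R : Patch S} {s t u : C(Circle, S)} {x : S}

namespace Adm

theorem val_le_shift (h : W.Adm θ₀ Q x) (hs : W.Good s) (ht : W.Good t)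
    (hxs : x ∉ range s) (hxt : x ∉ range t) (hle : θ₀ ≤ θ₁) (hθ : θ₁ < θ₀ + W.del / 2) :
    W.val Q s t x θ₀ = W.val Q s t x θ₁ := by
  have hdel := W.del_pos
  refine sqrtSign_shift (by linarith) (by linarith) (by linarith)
    ((h.nonvan hs ht hxs hxt).mono (by linarith) (by linarith) (by linarith)) (fun θ hθ => ?_)
    fun θ hθ => ?_
  · refine h.re_pos hs ht (le_abs.2 (.inr ?_)) (abs_le.2 ⟨?_, ?_⟩) <;> linarith [hθ.1, hθ.2]
  · refine h.re_pos hs ht (le_abs.2 (.inl ?_)) (abs_le.2 ⟨?_, ?_⟩) <;> linarith [hθ.1, hθ.2]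

theorem val_shift (h : W.Adm θ₀ Q x) (h' : W.Adm θ₁ Q x) (hs : W.Good s) (ht : W.Good t)
    (hxs : x ∉ range s) (hxt : x ∉ range t) (hθ : |θ₁ - θ₀| < W.del / 2) :
    W.val Q s t x θ₀ = W.val Q s t x θ₁ := by
  have := abs_lt.1 hθ
  rcases le_total θ₀ θ₁ with hle | hle
  · exact h.val_le_shift hs ht hxs hxt hle (by linarith)
  · exact (h'.val_le_shift hs ht hxs hxt hle (by linarith)).symm

theorem add_int (h : W.Adm θ₀ Q x) (k : ℤ) : W.Adm (θ₀ + k * (2 * Real.pi)) Q x :=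
  ⟨h.1, by rw [loopAt_add_int]; exact h.2, by rw [loopAt_add_int]; exact h.3⟩

theorem val_period (h : W.Adm θ₀ Q x) (hs : W.Good s) (ht : W.Good t)
    (hxs : x ∉ range s) (hxt : x ∉ range t) (k : ℤ) :
    W.val Q s t x (θ₀ + k * (2 * Real.pi)) = W.val Q s t x θ₀ := by
  have hn := (h.add_int k).nonvan_del hs ht hxs hxt
  rw [add_sub_right_comm, add_right_comm] at hn
  rw [val, val, add_sub_right_comm, add_right_comm, ← sqrtSign_comp_add hn]
  congr 1
  funext θ
  simp only [quot, loopAt_add_int]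

theorem val_eq (h : W.Adm θ₀ Q x) (h' : W.Adm θ₁ R x) (hs : W.Good s) (ht : W.Good t)
    (hxs : x ∉ range s) (hxt : x ∉ range t) : W.val Q s t x θ₀ = W.val R s t x θ₁ := by
  have hd : dist (loopAt γ θ₀) (loopAt γ θ₁) < 3 * W.c := by
    linarith [dist_triangle_left (loopAt γ θ₀) (loopAt γ θ₁) x, h.dist_lt, h'.dist_lt, W.c_pos]
  obtain ⟨k, hk⟩ := W.sep _ _ hd
  obtain ⟨T, hT, hTb⟩ := W.exists_fam θ₀
  have hlam := W.lam_pos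
  have a0 : W.Adm θ₀ T x := ⟨hT, h.dist_lt, (Metric.ball_subset_ball (by linarith)).trans hTb⟩
  have a1 : W.Adm (θ₁ + k * (2 * Real.pi)) T x :=
    ⟨hT, (h'.add_int k).dist_lt, (Metric.ball_subset_ball' (by
      linarith [W.dist_lt_lam (θ₁ + k * (2 * Real.pi)) θ₀ (by linarith [W.del_pos])])).trans hTb⟩
  rw [h.val_change a0 hs ht hxs hxt, a0.val_shift a1 hs ht hxs hxt hk,
    a1.val_change (h'.add_int k) hs ht hxs hxt, h'.val_period hs ht hxs hxt]

end Adm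

variable (W) in
open Classical in
/-- The sign comparing the two loops `s` and `t` at a point `x` off both of them. -/
noncomputable def compSign (s t : C(Circle, S)) (x : S) : ℂ :=
  if h : ∃ p : ℝ × Patch S, W.Adm p.1 p.2 x then W.val h.choose.2 s t x h.choose.1 else 1

theorem Adm.compSign_eq (h : W.Adm θ₀ Q x) (hs : W.Good s) (ht : W.Good t)
    (hxs : x ∉ range s) (hxt : x ∉ range t) : W.compSign s t x = W.val Q s t x θ₀ := by
  have he : ∃ p : ℝ × Patch S, W.Adm p.1 p.2 x := ⟨(θ₀, Q), h⟩
  rw [compSign, dif_pos he]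
  exact he.choose_spec.val_eq h hs ht hxs hxt

theorem compSign_eq_one_of_not (h : ∀ θ Q, ¬ W.Adm θ Q x) : W.compSign s t x = 1 :=
  dif_neg fun ⟨_, hp⟩ => h _ _ hp

theorem exists_adm (W : Windows γ) {θ : ℝ} (h : dist x (loopAt γ θ) < W.c) :
    ∃ Q, W.Adm θ Q x := by
  obtain ⟨T, hT, hTb⟩ := W.exists_fam θ
  exact ⟨T, hT, h, (Metric.ball_subset_ball (by linarith [W.lam_pos])).trans hTb⟩

theorem compSign_sq (hs : W.Good s) (ht : W.Good t) (hxs : x ∉ range s) (hxt : x ∉ range t) :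
    W.compSign s t x ^ 2 = 1 := by
  by_cases h : ∃ θ Q, W.Adm θ Q x
  · obtain ⟨θ, Q, h⟩ := h
    rw [h.compSign_eq hs ht hxs hxt]
    exact sqrtSign_sq (h.nonvan_del hs ht hxs hxt)
  · push Not at h
    rw [compSign_eq_one_of_not h, one_pow]

theorem compSign_mul (hs : W.Good s) (ht : W.Good t) (hu : W.Good u) (hxs : x ∉ range s)
    (hxt : x ∉ range t) (hxu : x ∉ range u) :
    W.compSign s t x * W.compSign t u x = W.compSign s u x := by
  by_cases h : ∃ θ Q, W.Adm θ Q x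
  · obtain ⟨θ, Q, h⟩ := h
    have n1 := h.nonvan_del hs ht hxs hxt
    have n2 := h.nonvan_del ht hu hxt hxu
    rw [h.compSign_eq hs ht hxs hxt, h.compSign_eq ht hu hxt hxu, h.compSign_eq hs hu hxs hxu,
      val, val, val, ← sqrtSign_mul n1 n2 (h.re_pos_left hs ht) (h.re_pos_right hs ht)
      (h.re_pos_left ht hu) (h.re_pos_right ht hu)]
    refine sqrtSign_congr (h.nonvan_del hs hu hxs hxu) fun θ' hθ' => ?_
    refine div_mul_div_cancel₀ (h.sub_ne_zero ht hxt (abs_le.2 ⟨?_, ?_⟩)) <;>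
      linarith [hθ'.1, hθ'.2, W.del_pos]
  · push Not at h
    simp only [compSign_eq_one_of_not h, one_mul]

theorem compSign_eq_one_of_far (hs : W.Good s) (ht : W.Good t) (hxs : x ∉ range s)
    (hxt : x ∉ range t) (hfar : ∀ θ, W.c / 2 ≤ dist x (loopAt γ θ)) : W.compSign s t x = 1 := by
  by_cases h : ∃ θ Q, W.Adm θ Q x
  · obtain ⟨θ, Q, h⟩ := h
    rw [h.compSign_eq hs ht hxs hxt]
    refine sqrtSign_of_re_pos (h.nonvan_del hs ht hxs hxt) fun θ' hθ' =>
      h.re_pos_of_far hs ht (abs_le.2 ⟨?_, ?_⟩) (hfar θ') <;> linarith [hθ'.1, hθ'.2, W.del_pos]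
  · push Not at h
    exact compSign_eq_one_of_not h

theorem isOpen_off (s : C(Circle, S)) : IsOpen (range s)ᶜ :=
  (isCompact_range s.continuous).isClosed.isOpen_compl

/-- The comparison sign is locally constant off the two loops. -/
theorem eventually_compSign_eq (hs : W.Good s) (ht : W.Good t) (hxs : x ∉ range s)
    (hxt : x ∉ range t) : ∀ᶠ y in 𝓝 x, W.compSign s t y = W.compSign s t x := by
  have hos := (isOpen_off s).mem_nhds hxs
  have hot := (isOpen_off t).mem_nhds hxt
  by_cases h : ∃ θ, dist x (loopAt γ θ) < W.c
  · obtain ⟨θ₀, hd⟩ := h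
    obtain ⟨Q, h⟩ := W.exists_adm hd
    have hev : ∀ᶠ y in 𝓝 x, dist y (loopAt γ θ₀) < W.c :=
      (continuous_id.dist continuous_const).continuousAt.eventually (gt_mem_nhds hd)
    have hpos : ∀ᶠ y in 𝓝 x, ∀ θ ∈ Icc (θ₀ - W.del) (θ₀ + W.del),
        0 < (quot Q s t y θ / quot Q s t x θ).re := by
      refine isCompact_Icc.eventually_forall_of_forall_eventually (x₀ := x)
        (P := fun y θ => 0 < (quot Q s t y θ / quot Q s t x θ).re) fun θ hθ => ?_
      have hθ' : |θ - θ₀| ≤ 2 * W.del := abs_le.2 ⟨by linarith [hθ.1, W.del_pos],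
        by linarith [hθ.2, W.del_pos]⟩
      have c0 : ContinuousAt (fun q : S × ℝ => Q.toFun q.1) (x, θ) :=
        ContinuousAt.comp (f := fun q : S × ℝ => q.1)
          (Q.continuousOn.continuousAt (Q.isOpen.mem_nhds h.mem)) continuousAt_fst
      have cl : ∀ {s : C(Circle, S)} (_ : W.Good s),
          ContinuousAt (fun q : S × ℝ => Q.toFun (loopAt s q.2)) (x, θ) := fun {s} hs =>
        ContinuousAt.comp (f := fun q : S × ℝ => loopAt s q.2)
          (Q.continuousOn.continuousAt (Q.isOpen.mem_nhds (h.loop_mem hs hθ')))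
          ((continuous_loopAt s).comp continuous_snd).continuousAt
      have cx : ContinuousAt (fun _ : S × ℝ => Q.toFun x) (x, θ) := continuousAt_const
      have n1 := h.sub_ne_zero hs hxs hθ'
      have n2 := h.sub_ne_zero ht hxt hθ'
      refine (Complex.continuous_re.continuousAt.comp
        ((((cl hs).sub c0).div ((cl ht).sub c0) n2).div
        (((cl hs).sub cx).div ((cl ht).sub cx) n2) (div_ne_zero n1 n2))).eventually (lt_mem_nhds ?_)
      simp [div_self (div_ne_zero n1 n2)]
    filter_upwards [hos, hot, hev, hpos] with y hys hyt hyd hyp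
    have hy : W.Adm θ₀ Q y := ⟨h.1, hyd, h.3⟩
    rw [h.compSign_eq hs ht hxs hxt, hy.compSign_eq hs ht hys hyt]
    exact sqrtSign_eq_of_re_div_pos (hy.nonvan_del hs ht hys hyt) (h.nonvan_del hs ht hxs hxt)
      (h.re_pos_left hs ht) (h.re_pos_right hs ht) hyp
  · push Not at h
    rw [compSign_eq_one_of_far hs ht hxs hxt fun θ => by linarith [h θ, W.c_pos]]
    filter_upwards [hos, hot, Metric.ball_mem_nhds x (half_pos W.c_pos)] with y hys hyt hy
    refine compSign_eq_one_of_far hs ht hys hyt fun θ => ?_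
    rw [Metric.mem_ball] at hy
    linarith [h θ, dist_triangle_left x (loopAt γ θ) y]

/-- Nearby loops have trivial comparison sign at a fixed point. -/
theorem eventually_compSign_eq_one (hs : W.Good s) (hxs : x ∉ range s)
    (hgood : ∀ᶠ t in 𝓝 s, W.Good t) : ∀ᶠ t in 𝓝 s, W.compSign s t x = 1 := by
  have hoff : ∀ᶠ t : C(Circle, S) in 𝓝 s, x ∉ range t := by
    filter_upwards [(ContinuousMap.isOpen_setOfPred_mapsTo (isCompact_univ (X := Circle))
      (isOpen_compl_singleton (x := x))).mem_nhds (fun z _ hz => hxs ⟨z, hz⟩)] with t ht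
    rintro ⟨z, hz⟩
    exact ht trivial hz
  by_cases h : ∃ θ Q, W.Adm θ Q x
  · obtain ⟨θ₀, Q, h⟩ := h
    have hpos : ∀ᶠ t in 𝓝 s, ∀ θ ∈ Icc (θ₀ - W.del) (θ₀ + W.del), 0 < (quot Q s t x θ).re := by
      refine isCompact_Icc.eventually_forall_of_forall_eventually (x₀ := s)
        (P := fun t θ => 0 < (quot Q s t x θ).re) fun θ hθ => ?_
      have hθ' : |θ - θ₀| ≤ 2 * W.del := abs_le.2 ⟨by linarith [hθ.1, W.del_pos],
        by linarith [hθ.2, W.del_pos]⟩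
      have hQ := Q.continuousOn.continuousAt (Q.isOpen.mem_nhds (h.loop_mem hs hθ'))
      have cs : ContinuousAt (fun q : C(Circle, S) × ℝ => Q.toFun (loopAt s q.2)) (s, θ) :=
        ContinuousAt.comp (f := fun q : C(Circle, S) × ℝ => loopAt s q.2) hQ
          ((continuous_loopAt s).comp continuous_snd).continuousAt
      have ct : ContinuousAt (fun q : C(Circle, S) × ℝ => Q.toFun (loopAt q.1 q.2)) (s, θ) :=
        ContinuousAt.comp (f := fun q : C(Circle, S) × ℝ => loopAt q.1 q.2) hQ
          (by unfold loopAt; fun_prop)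
      have n := h.sub_ne_zero hs hxs hθ'
      refine (Complex.continuous_re.continuousAt.comp
        ((cs.sub continuousAt_const).div (ct.sub continuousAt_const) n)).eventually (lt_mem_nhds ?_)
      simp [div_self n]
    filter_upwards [hoff, hpos, hgood] with t hxt hp ht
    rw [h.compSign_eq hs ht hxs hxt]
    exact sqrtSign_of_re_pos (h.nonvan_del hs ht hxs hxt) hp
  · push Not at h
    exact .of_forall fun t => compSign_eq_one_of_not h

end Windows

/-- The end ratio of the square root of `β - p` depends continuously on `p` off the path. -/
theorem continuousAt_sqrtRatio_sub {β : ℝ → ℂ} {a b : ℝ} (hab : a ≤ b)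
    (hβ : ContinuousOn β (Icc a b)) {p₀ : ℂ} (hp : ∀ θ ∈ Icc a b, β θ ≠ p₀) :
    ContinuousAt (fun p => sqrtRatio (fun θ => β θ - p) a b) p₀ := by
  have hoff : ∀ᶠ p in 𝓝 p₀, p ∈ (β '' Icc a b)ᶜ :=
    (isCompact_Icc.image_of_continuousOn hβ).isClosed.isOpen_compl.mem_nhds
      fun ⟨θ, hθ, h⟩ => hp θ hθ h
  have hre : ∀ᶠ p in 𝓝 p₀, ∀ q ∈ β '' Icc a b, 0 < ((q - p) / (q - p₀)).re := by
    refine (isCompact_Icc.image_of_continuousOn hβ).eventually_forall_of_forall_eventually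
      (x₀ := p₀) (P := fun p q => 0 < ((q - p) / (q - p₀)).re) ?_
    rintro _ ⟨θ, hθ, rfl⟩
    have hne : β θ - p₀ ≠ 0 := sub_ne_zero.2 (hp θ hθ)
    have hc : ContinuousAt (fun z : ℂ × ℂ => ((z.2 - z.1) / (z.2 - p₀)).re) (p₀, β θ) :=
      Complex.continuous_re.continuousAt.comp
        (ContinuousAt.div (by fun_prop) (by fun_prop) hne)
    exact hc.eventually (lt_mem_nhds (by simp [div_self hne]))
  have hn0 : Nonvan (fun θ => β θ - p₀) a b :=
    ⟨hab, hβ.sub continuousOn_const, fun θ hθ => sub_ne_zero.2 (hp θ hθ)⟩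
  have hcs : ∀ c ∈ Icc a b, ContinuousAt (fun p => csqrt ((β c - p) / (β c - p₀))) p₀ := by
    intro c hc
    have hne : β c - p₀ ≠ 0 := sub_ne_zero.2 (hp c hc)
    refine ContinuousAt.comp (g := csqrt) (continuousOn_csqrt.continuousAt
      (Complex.isOpen_slitPlane.mem_nhds ?_)) (by fun_prop)
    rw [div_self hne]; exact Complex.one_mem_slitPlane
  refine ContinuousAt.congr (f := fun p => csqrt ((β b - p) / (β b - p₀)) /
    csqrt ((β a - p) / (β a - p₀)) * sqrtRatio (fun θ => β θ - p₀) a b)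
    (((hcs b (right_mem_Icc.2 hab)).div (hcs a (left_mem_Icc.2 hab)) (csqrt_ne_zero _)).mul
      continuousAt_const) ?_
  filter_upwards [hoff, hre] with p hpo hpr
  have hn : Nonvan (fun θ => β θ - p) a b := ⟨hab, hβ.sub continuousOn_const,
    fun θ hθ => sub_ne_zero.2 fun h => hpo ⟨θ, hθ, h⟩⟩
  rw [← sqrtRatio_of_re_pos (hn.div hn0) fun θ hθ => hpr _ ⟨θ, hθ, rfl⟩,
    ← sqrtRatio_mul (hn.div hn0) hn0]
  exact sqrtRatio_congr hn fun θ hθ => div_mul_cancel₀ _ (hn0.3 θ hθ)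

/-- The end ratio of the square root of `β - p` jumps somewhere across an arc. -/
theorem not_forall_tendsto_sqrtRatio {β : ℝ → ℂ} {c d : ℝ} (hcd : c < d)
    (hβ : ContinuousOn β (Icc c d)) (hinj : InjOn β (Icc c d))
    (hlim : ∀ θ ∈ Ioo c d, ∃ l, Filter.Tendsto (fun p => sqrtRatio (fun θ' => β θ' - p) c d)
      (𝓝[(β '' Icc c d)ᶜ] (β θ)) (𝓝 l)) : False := by
  set A := (β '' Icc c d)ᶜ with hA
  set τ := fun p => sqrtRatio (fun θ' => β θ' - p) c d with hτ
  have hc : c ∈ Icc c d := left_mem_Icc.2 hcd.le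
  have hd : d ∈ Icc c d := right_mem_Icc.2 hcd.le
  have hdense : Dense A := by
    rw [← interior_eq_empty_iff_dense_compl]
    exact interior_image_Icc_eq_empty hβ hinj
  have hcl : ∀ p, (𝓝[A] p).NeBot := fun p => mem_closure_iff_nhdsWithin_neBot.1 (hdense p)
  have hn : ∀ p ∈ A, Nonvan (fun θ => β θ - p) c d := fun p hp =>
    ⟨hcd.le, hβ.sub continuousOn_const, fun θ hθ => sub_ne_zero.2 fun h => hp ⟨θ, hθ, h⟩⟩
  have hlim' : ∀ p ∈ ({β c, β d} : Set ℂ)ᶜ, ∃ l, Filter.Tendsto τ (𝓝[A] p) (𝓝 l) := by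
    intro p hp
    by_cases hpA : p ∈ A
    · exact ⟨τ p, (continuousAt_sqrtRatio_sub hcd.le hβ fun θ hθ h =>
        hpA ⟨θ, hθ, h⟩).tendsto.mono_left nhdsWithin_le_nhds⟩
    · obtain ⟨θ, hθ, rfl⟩ := not_not.1 hpA
      refine hlim θ ⟨lt_of_le_of_ne hθ.1 fun h => hp ?_, lt_of_le_of_ne hθ.2 fun h => hp ?_⟩
      · simp [h]
      · simp [h]
  have hext := continuousOn_extendFrom (B := ({β c, β d} : Set ℂ)ᶜ)
    (fun p _ => hdense p) hlim'
  have hsq : IsSqrtOn (extendFrom A τ) (fun p => (β d - p) / (β c - p)) ({β c, β d} : Set ℂ)ᶜ := by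
    refine ⟨hext, fun p hp => ?_⟩
    have h1 := (tendsto_extendFrom (hlim' p hp)).pow 2
    have hne : β c - p ≠ 0 := sub_ne_zero.2 fun h => hp (by simp [h])
    have h2 : Filter.Tendsto (fun p => (β d - p) / (β c - p)) (𝓝[A] p)
        (𝓝 ((β d - p) / (β c - p))) :=
      (ContinuousAt.div (by fun_prop) (by fun_prop) hne).tendsto.mono_left nhdsWithin_le_nhds
    have := hcl p
    refine tendsto_nhds_unique_of_eventuallyEq h1 h2 ?_
    filter_upwards [self_mem_nhdsWithin] with q hq
    exact sqrtRatio_sq (hn q hq)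
  have hne : β c ≠ β d := fun h => hcd.ne (hinj hc hd h)
  have hr : 0 < dist (β c) (β d) := dist_pos.2 hne
  obtain ⟨q, hq⟩ := exists_isSqrtOn_of_starConvex (g := fun p => β c - p)
    ((convex_ball (β d) (dist (β c) (β d))).starConvex (Metric.mem_ball_self hr))
    (Metric.mem_ball_self hr) (by fun_prop) (by
      intro p hp h
      rw [sub_eq_zero] at h
      rw [← h] at hp
      exact lt_irrefl _ (Metric.mem_ball.1 hp))
  have hI : IsSqrtOn (fun _ : ℂ => Complex.I) (fun _ => -1)
      (Metric.sphere (β d) (dist (β c) (β d) / 2)) := ⟨continuousOn_const, fun _ _ => by simp⟩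
  have hsub1 : Metric.sphere (β d) (dist (β c) (β d) / 2) ⊆ ({β c, β d} : Set ℂ)ᶜ := by
    rintro p hp (rfl | rfl)
    · rw [Metric.mem_sphere] at hp; linarith
    · rw [Metric.mem_sphere, dist_self] at hp; linarith
  have hsub2 : Metric.sphere (β d) (dist (β c) (β d) / 2) ⊆ Metric.ball (β d) (dist (β c) (β d)) :=
    fun p hp => by
      rw [Metric.mem_sphere] at hp
      rw [Metric.mem_ball]; linarith
  refine not_isSqrtOn_sub_sphere (half_pos hr)
    ((((hsq.mono hsub1).mul (hq.mono hsub2)).mul hI).congr fun p hp => ?_)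
  have : β c - p ≠ 0 := sub_ne_zero.2 fun h => hsub1 hp (by simp [h])
  field_simp
  ring

theorem sqrtRatio_ne_zero {g : ℝ → ℂ} {a b : ℝ} (hg : Nonvan g a b) : sqrtRatio g a b ≠ 0 := by
  intro h
  have := sqrtRatio_sq hg
  rw [h, zero_pow two_ne_zero] at this
  exact div_ne_zero (hg.3 b (right_mem_Icc.2 hg.1)) (hg.3 a (left_mem_Icc.2 hg.1)) this.symm

namespace Windows
variable {S : Type*} [MetricSpace S] {γ : C(Circle, S)} {W : Windows γ} {s t : C(Circle, S)}

theorem eventually_adm {θ₀ : ℝ} {Q : Patch S} {x : S} (h : W.Adm θ₀ Q x) :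
    ∀ᶠ y in 𝓝 x, W.Adm θ₀ Q y :=
  ((continuous_id.dist continuous_const).continuousAt.eventually (gt_mem_nhds h.2)).mono
    fun _ hy => ⟨h.1, hy, h.3⟩

theorem injOn_loopAt (W : Windows γ) (ht : Function.Injective t) (θ₀ : ℝ) :
    InjOn (loopAt t) (Icc (θ₀ - W.del) (θ₀ + W.del)) :=
  ht.injOn.comp (Circle.exp_injOn_Icc (by linarith [W.del_lt, Real.pi_gt_three]))
    (mapsTo_univ _ _)

theorem sqrtRatio_eq_compSign {θ₀ c d : ℝ} {Q : Patch S} {x : S} (h : W.Adm θ₀ Q x)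
    (hs : W.Good s) (ht : W.Good t) (hxs : x ∉ range s) (hxt : x ∉ range t)
    (hc : θ₀ - W.del ≤ c) (hcd : c ≤ d) (hd : d ≤ θ₀ + W.del) :
    sqrtRatio (fun θ => Q.toFun (loopAt t θ) - Q.toFun x) c d =
      sqrtRatio (fun θ => Q.toFun (loopAt s θ) - Q.toFun x) (θ₀ - W.del) (θ₀ + W.del) *
      (csqrt (quot Q s t x (θ₀ - W.del)) / csqrt (quot Q s t x (θ₀ + W.del))) /
      (sqrtRatio (fun θ => Q.toFun (loopAt t θ) - Q.toFun x) (θ₀ - W.del) c *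
        sqrtRatio (fun θ => Q.toFun (loopAt t θ) - Q.toFun x) d (θ₀ + W.del)) *
      (W.compSign s t x)⁻¹ := by
  have hdel := W.del_pos
  have hn : ∀ {s : C(Circle, S)} (_ : W.Good s) (_ : x ∉ range s),
      Nonvan (fun θ => Q.toFun (loopAt s θ) - Q.toFun x) (θ₀ - W.del) (θ₀ + W.del) :=
    fun {s} hs hxs => ⟨by linarith, (h.continuousOn_loop hs).mono
      (Icc_subset_Icc (by linarith) (by linarith)), fun θ hθ => h.sub_ne_zero hs hxs
        (abs_le.2 ⟨by linarith [hθ.1], by linarith [hθ.2]⟩)⟩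
  have hnt := hn ht hxt
  have hq := h.nonvan_del hs ht hxs hxt
  have e1 := sqrtRatio_mul hq hnt
  rw [← sqrtRatio_congr (h := fun θ => Q.toFun (loopAt s θ) - Q.toFun x) (hq.mul hnt)
    (fun θ hθ => (div_mul_cancel₀ _ (hnt.3 θ hθ)).symm),
    sqrtRatio_trans hnt hc (hcd.trans hd), sqrtRatio_trans (hnt.mono (hcd.trans hd) hc le_rfl) hcd hd]
    at e1
  have n1 := sqrtRatio_ne_zero (hnt.mono hc le_rfl (hcd.trans hd))
  have n2 := sqrtRatio_ne_zero (hnt.mono hd (hc.trans hcd) le_rfl)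
  have n3 := sqrtRatio_ne_zero hq
  have c1 := csqrt_ne_zero (quot Q s t x (θ₀ - W.del))
  have c2 := csqrt_ne_zero (quot Q s t x (θ₀ + W.del))
  rw [h.compSign_eq hs ht hxs hxt, val, sqrtSign, e1]
  field_simp

theorem not_forall_eventually_compSign_eq (hs : W.Good s) (ht : W.Good t)
    (hinj : Function.Injective t) (hdisj : Disjoint (range s) (range t)) {y : S}
    (hy : y ∈ range t) {P : Patch S} (hyP : y ∈ P.carrier) (hre : 0 < (P.toFun y).re) :
    ¬ ∀ z ∈ range t, ∃ e : ℂ, ∀ᶠ p in 𝓝 z, p ∉ range t → W.compSign s t p = e := by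
  intro hconst
  have hdel := W.del_pos
  obtain ⟨θ₀, rfl⟩ := mem_range_loopAt hy
  obtain ⟨Q, hQ⟩ := W.exists_adm (x := loopAt t θ₀) (θ := θ₀)
    ((ht θ₀).trans_le (W.eps_le.trans W.eps₁_le_c))
  have hQre := Patch.re_pos_of_re_pos hyP hQ.mem hre
  have hev : ∀ᶠ x in 𝓝 (loopAt t θ₀), W.Adm θ₀ Q x ∧ 0 < (Q.toFun x).re :=
    (eventually_adm hQ).and (((Complex.continuous_re.continuousAt.comp
      (Q.continuousOn.continuousAt (Q.isOpen.mem_nhds hQ.mem))).eventually (lt_mem_nhds hQre)))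
  obtain ⟨r, hr, hball⟩ := Metric.eventually_nhds_iff.1
    ((continuous_loopAt t).continuousAt.eventually hev)
  obtain ⟨δ, hδ, hδr, hδd⟩ : ∃ δ > 0, δ < r ∧ δ < W.del :=
    ⟨min r W.del / 2, by positivity, by linarith [min_le_left r W.del, lt_min hr hdel],
      by linarith [min_le_right r W.del, lt_min hr hdel]⟩
  set β : ℝ → ℂ := fun θ => Q.toFun (loopAt t θ) with hβ
  set σ : ℝ → ℂ := fun θ => Q.toFun (loopAt s θ) with hσ
  have hmaps : ∀ {s : C(Circle, S)} (_ : W.Good s), MapsTo (loopAt s)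
      (Icc (θ₀ - W.del) (θ₀ + W.del)) Q.carrier := fun hs θ hθ =>
    hQ.loop_mem hs (abs_le.2 ⟨by linarith [hθ.1], by linarith [hθ.2]⟩)
  have hβc : ContinuousOn β (Icc (θ₀ - W.del) (θ₀ + W.del)) :=
    Q.continuousOn.comp (continuous_loopAt t).continuousOn (hmaps ht)
  have hσc : ContinuousOn σ (Icc (θ₀ - W.del) (θ₀ + W.del)) :=
    Q.continuousOn.comp (continuous_loopAt s).continuousOn (hmaps hs)
  have hβi : InjOn β (Icc (θ₀ - W.del) (θ₀ + W.del)) :=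
    Q.injOn.comp (W.injOn_loopAt hinj θ₀) (hmaps ht)
  have hsub : Icc (θ₀ - δ) (θ₀ + δ) ⊆ Icc (θ₀ - W.del) (θ₀ + W.del) :=
    Icc_subset_Icc (by linarith) (by linarith)
  refine not_forall_tendsto_sqrtRatio (c := θ₀ - δ) (d := θ₀ + δ) (by linarith) (hβc.mono hsub)
    (hβi.mono hsub) fun θ hθ => ?_
  have hθI := hsub (Ioo_subset_Icc_self hθ)
  obtain ⟨ha, hare⟩ := hball (y := θ) (by
    rw [Real.dist_eq, abs_lt]; constructor <;> linarith [hθ.1, hθ.2])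
  have has : loopAt t θ ∉ range s := fun h => hdisj.le_bot ⟨h, loopAt_mem_range t θ⟩
  obtain ⟨e, he⟩ := hconst _ (loopAt_mem_range t θ)
  set K : Set S := t '' (Circle.exp '' Icc (θ₀ + δ) (θ₀ - δ + 2 * Real.pi)) with hK
  have hKc : IsClosed K :=
    ((isCompact_Icc.image Circle.exp.continuous).image t.continuous).isClosed
  have haK : loopAt t θ ∉ K := by
    rintro ⟨-, ⟨θ', hθ', rfl⟩, h⟩
    obtain ⟨m, rfl⟩ := Circle.exp_eq_exp.1 (hinj h)
    have hpi := Real.pi_pos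
    have h1 : 0 < (m : ℝ) := by
      by_contra! hcon
      nlinarith [hθ'.1, hθ.2]
    have h2 : (m : ℝ) < 1 := by
      by_contra! hcon
      nlinarith [hθ'.2, hθ.1]
    have h3 : 0 < m := by exact_mod_cast h1
    have h4 : m < 1 := by exact_mod_cast h2
    omega
  have hKcov : ∀ x ∈ range t, x ∉ K → ∃ θ' ∈ Icc (θ₀ - δ) (θ₀ + δ), loopAt t θ' = x := by
    rintro _ ⟨z, rfl⟩ hx
    obtain ⟨θ', rfl⟩ := Circle.exp_surjective z
    obtain ⟨θ'', h1, h2⟩ := Circle.periodic_exp.exists_mem_Ico Real.two_pi_pos θ' (θ₀ - δ)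
    refine ⟨θ'', ⟨h1.1, ?_⟩, by rw [loopAt, ← h2]⟩
    by_contra! hcon
    exact hx ⟨_, ⟨θ'', ⟨hcon.le, h1.2.le⟩, rfl⟩, by rw [h2]⟩
  have htend := Patch.tendsto_inv ha.mem hare
  have hevp : ∀ᶠ p in 𝓝[(β '' Icc (θ₀ - δ) (θ₀ + δ))ᶜ] (β θ),
      sqrtRatio (fun θ' => σ θ' - p) (θ₀ - W.del) (θ₀ + W.del) *
      (csqrt ((σ (θ₀ - W.del) - p) / (β (θ₀ - W.del) - p)) /
        csqrt ((σ (θ₀ + W.del) - p) / (β (θ₀ + W.del) - p))) /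
      (sqrtRatio (fun θ' => β θ' - p) (θ₀ - W.del) (θ₀ - δ) *
        sqrtRatio (fun θ' => β θ' - p) (θ₀ + δ) (θ₀ + W.del)) * e⁻¹ =
      sqrtRatio (fun θ' => β θ' - p) (θ₀ - δ) (θ₀ + δ) := by
    filter_upwards [nhdsWithin_le_nhds (htend.eventually (eventually_adm ha)),
      nhdsWithin_le_nhds (htend.eventually ((isOpen_off s).mem_nhds has)),
      nhdsWithin_le_nhds (htend.eventually (hKc.isOpen_compl.mem_nhds haK)),
      nhdsWithin_le_nhds (htend.eventually he),
      nhdsWithin_le_nhds (halfDisc_mem_nhds (Q.mapsTo ha.mem) hare),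
      self_mem_nhdsWithin] with p h1 h2 h3 h4 h5 h6
    have hp := Q.right_inv h5
    have h7 : Q.inv p ∉ range t := by
      intro hx
      obtain ⟨θ', hθ', h⟩ := hKcov _ hx h3
      exact h6 ⟨θ', hθ', by rw [hβ]; simp only [h, hp]⟩
    have := sqrtRatio_eq_compSign h1 hs ht h2 h7 (c := θ₀ - δ) (d := θ₀ + δ) (by linarith)
      (by linarith) (by linarith)
    simp only [hp, h4 h7, quot] at this
    exact this.symm
  have hA : θ₀ - W.del ∈ Icc (θ₀ - W.del) (θ₀ + W.del) := left_mem_Icc.2 (by linarith)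
  have hB : θ₀ + W.del ∈ Icc (θ₀ - W.del) (θ₀ + W.del) := right_mem_Icc.2 (by linarith)
  have hβne : ∀ θ' ∈ Icc (θ₀ - W.del) (θ₀ + W.del), θ' ≠ θ → β θ' ≠ β θ :=
    fun θ' h1 h2 h => h2 (hβi h1 hθI h)
  have hσne : ∀ θ' ∈ Icc (θ₀ - W.del) (θ₀ + W.del), σ θ' ≠ β θ := fun θ' h1 h =>
    has (Q.injOn (hmaps hs h1) ha.mem h ▸ loopAt_mem_range s θ')
  have hcs : ∀ θ' ∈ Icc (θ₀ - W.del) (θ₀ + W.del), W.del / 2 ≤ |θ' - θ₀| → θ' ≠ θ →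
      ContinuousAt (fun p => csqrt ((σ θ' - p) / (β θ' - p))) (β θ) := fun θ' h1 h2 h3 => by
    refine ContinuousAt.comp (g := csqrt) (continuousOn_csqrt.continuousAt
      (Complex.isOpen_slitPlane.mem_nhds (mem_slitPlane_of_re_pos
      (ha.re_pos hs ht h2 (abs_le.2 ⟨?_, ?_⟩)))))
      (ContinuousAt.div (by fun_prop) (by fun_prop) (sub_ne_zero.2 (hβne θ' h1 h3))) <;>
      linarith [h1.1, h1.2]
  have hneA : θ₀ - W.del ≠ θ := (show θ₀ - W.del < θ by linarith [hθ.1]).ne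
  have hneB : θ₀ + W.del ≠ θ := (show θ < θ₀ + W.del by linarith [hθ.2]).ne'
  have hcA := hcs _ hA (by rw [sub_sub_cancel_left, abs_neg, abs_of_pos hdel]; linarith) hneA
  have hcB := hcs _ hB (by rw [add_sub_cancel_left, abs_of_pos hdel]; linarith) hneB
  have hl1 : Icc (θ₀ - W.del) (θ₀ - δ) ⊆ Icc (θ₀ - W.del) (θ₀ + W.del) :=
    Icc_subset_Icc_right (by linarith)
  have hl2 : Icc (θ₀ + δ) (θ₀ + W.del) ⊆ Icc (θ₀ - W.del) (θ₀ + W.del) :=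
    Icc_subset_Icc_left (by linarith)
  have hn1 : ∀ θ' ∈ Icc (θ₀ - W.del) (θ₀ - δ), β θ' ≠ β θ := fun θ' h =>
    hβne θ' (hl1 h) (h.2.trans_lt hθ.1).ne
  have hn2 : ∀ θ' ∈ Icc (θ₀ + δ) (θ₀ + W.del), β θ' ≠ β θ := fun θ' h =>
    hβne θ' (hl2 h) (hθ.2.trans_le h.1).ne'
  have hle1 : θ₀ - W.del ≤ θ₀ - δ := by linarith
  have hle2 : θ₀ + δ ≤ θ₀ + W.del := by linarith
  have hcont := (((continuousAt_sqrtRatio_sub (by linarith) hσc hσne).mul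
    (hcA.div hcB (csqrt_ne_zero _))).div
    ((continuousAt_sqrtRatio_sub hle1 (hβc.mono hl1) hn1).mul
      (continuousAt_sqrtRatio_sub hle2 (hβc.mono hl2) hn2)) (mul_ne_zero
      (sqrtRatio_ne_zero ⟨hle1, (hβc.mono hl1).sub continuousOn_const,
        fun θ' h => sub_ne_zero.2 (hn1 θ' h)⟩)
      (sqrtRatio_ne_zero ⟨hle2, (hβc.mono hl2).sub continuousOn_const,
        fun θ' h => sub_ne_zero.2 (hn2 θ' h)⟩))).mul (continuousAt_const (y := e⁻¹))
  exact ⟨_, (hcont.tendsto.mono_left nhdsWithin_le_nhds).congr' hevp⟩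

/-- Along a circle with an interior point, the comparison sign takes both values near some point. -/
theorem exists_compSign_jump (hs : W.Good s) (ht : W.Good t)
    (hinj : Function.Injective t) (hdisj : Disjoint (range s) (range t)) {y : S}
    (hy : y ∈ range t) {P : Patch S} (hyP : y ∈ P.carrier) (hre : 0 < (P.toFun y).re) :
    ∃ z ∈ range t, ∀ O ∈ 𝓝 z,
      (∃ p ∈ O, p ∉ range s ∧ p ∉ range t ∧ W.compSign s t p = -1) ∧
      ∃ q ∈ O, q ∉ range s ∧ q ∉ range t ∧ W.compSign s t q = 1 := by
  by_contra hcon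
  push Not at hcon
  refine not_forall_eventually_compSign_eq hs ht hinj hdisj hy hyP hre fun z hz => ?_
  obtain ⟨O, hO, h⟩ := hcon z hz
  have hzs := (isOpen_off s).mem_nhds fun h => hdisj.le_bot ⟨h, hz⟩
  have hsign : ∀ p, p ∉ range s → p ∉ range t → W.compSign s t p = 1 ∨ W.compSign s t p = -1 :=
    fun p h1 h2 => sq_eq_one_iff.1 (compSign_sq hs ht h1 h2)
  by_cases h1 : ∃ p ∈ O, p ∉ range s ∧ p ∉ range t ∧ W.compSign s t p = -1
  · refine ⟨-1, ?_⟩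
    filter_upwards [hO, hzs] with p hp hps hpt
    exact (hsign p hps hpt).resolve_left (h h1 p hp hps hpt)
  · refine ⟨1, ?_⟩
    filter_upwards [hO, hzs] with p hp hps hpt
    exact (hsign p hps hpt).resolve_right fun h2 => h1 ⟨p, hp, hps, hpt, h2⟩

end Windows

section
variable {X : Type*} [TopologicalSpace X]

/-- An uncountable set has a condensation point. -/
theorem exists_condensation_point [SecondCountableTopology X] {T : Set X} (hT : ¬ T.Countable) :
    ∃ x ∈ T, ∀ O ∈ 𝓝 x, ¬ (T ∩ O).Countable := by
  by_contra! hcon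
  choose! O hO hc using hcon
  obtain ⟨t, htT, htc, hcov⟩ := TopologicalSpace.countable_cover_nhdsWithin (s := T) (f := O)
    fun x hx => mem_nhdsWithin_of_mem_nhds (hO x hx)
  refine hT ((htc.biUnion fun x hx => hc x (htT hx)).mono fun y hy => ?_)
  obtain ⟨x, hx, hyx⟩ := mem_iUnion₂.1 (hcov hy)
  exact mem_iUnion₂.2 ⟨x, hx, hy, hyx⟩

theorem subset_connectedComponentIn_or {C D E : Set X} {p : X}
    (hC : IsPreconnected C) (hD : IsPreconnected D) (hCD : Disjoint C D) (hCE : Disjoint C E)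
    (hDE : Disjoint D E) (hpC : p ∈ (E ∪ C)ᶜ)
    (hcl : (closure (connectedComponentIn (E ∪ C)ᶜ p) ∩ C).Nonempty) :
    D ⊆ connectedComponentIn (E ∪ C)ᶜ p ∨ C ⊆ connectedComponentIn (E ∪ D)ᶜ p := by
  set U := connectedComponentIn (E ∪ C)ᶜ p with hU
  by_cases h : (D ∩ U).Nonempty
  · left
    obtain ⟨x, hxD, hxU⟩ := h
    rw [hU, connectedComponentIn_eq hxU]
    refine hD.subset_connectedComponentIn hxD fun y hy => ?_
    rintro (h | h)
    · exact hDE.le_bot ⟨hy, h⟩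
    · exact hCD.le_bot ⟨h, hy⟩
  · right
    obtain ⟨w, hwU, hwC⟩ := hcl
    have hsub : U ⊆ (E ∪ C)ᶜ := connectedComponentIn_subset _ _
    have h1 : IsPreconnected (insert w U) :=
      isPreconnected_connectedComponentIn.subset_closure (subset_insert _ _)
        (insert_subset hwU subset_closure)
    have h2 := h1.union w (mem_insert _ _) hwC hC
    refine subset_trans subset_union_right (h2.subset_connectedComponentIn
      (.inl (.inr (mem_connectedComponentIn hpC))) ?_)
    rintro y ((rfl | hy) | hy) (hy' | hy')
    · exact hCE.le_bot ⟨hwC, hy'⟩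
    · exact hCD.le_bot ⟨hwC, hy'⟩
    · exact hsub hy (.inl hy')
    · exact h ⟨y, hy', hy⟩
    · exact hCE.le_bot ⟨hy, hy'⟩
    · exact hCD.le_bot ⟨hy, hy'⟩

/-- A component of the complement of `E ∪ C` that meets a connected set touching `C` but not `E`
has points of `C` in its closure. -/
theorem closure_connectedComponentIn_inter_nonempty [LocallyConnectedSpace X] {C E O : Set X}
    {p z : X} (hC : IsClosed C) (hE : IsClosed E) (hO : IsPreconnected O) (hOE : Disjoint O E)
    (hp : p ∈ (E ∪ C)ᶜ) (hpO : p ∈ O) (hz : z ∈ O) (hzC : z ∈ C) :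
    (closure (connectedComponentIn (E ∪ C)ᶜ p) ∩ C).Nonempty := by
  set U := connectedComponentIn (E ∪ C)ᶜ p with hU
  have hG : IsOpen (E ∪ C)ᶜ := (hE.union hC).isOpen_compl
  have hUo : IsOpen U := hG.connectedComponentIn
  by_contra hcon
  rw [not_nonempty_iff_eq_empty, ← disjoint_iff_inter_eq_empty] at hcon
  have hclO : O ∩ closure U ⊆ U := by
    rintro w ⟨hwO, hwU⟩
    have hwG : w ∈ (E ∪ C)ᶜ := by
      rintro (h | h)
      · exact hOE.le_bot ⟨hwO, h⟩
      · exact hcon.le_bot ⟨hwU, h⟩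
    obtain ⟨v, hv1, hv2⟩ := mem_closure_iff.1 hwU _ hG.connectedComponentIn
      (mem_connectedComponentIn hwG)
    rw [hU, connectedComponentIn_eq hv2, ← connectedComponentIn_eq hv1]
    exact mem_connectedComponentIn hwG
  have hOU : O ⊆ U := hO.subset_of_closure_inter_subset hUo
    ⟨p, hpO, mem_connectedComponentIn hp⟩ (by rwa [inter_comm])
  exact connectedComponentIn_subset _ _ (hOU hz) (.inr hzC)

end

namespace Windows
variable {S : Type*} [MetricSpace S] {γ : C(Circle, S)} {W : Windows γ} {s t : C(Circle, S)}

theorem compSign_eq_of_isPreconnected (hs : W.Good s) (ht : W.Good t) {A : Set S}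
    (hA : IsPreconnected A) (hAs : Disjoint A (range s)) (hAt : Disjoint A (range t)) {a b : S}
    (ha : a ∈ A) (hb : b ∈ A) : W.compSign s t a = W.compSign s t b := by
  have h1 : ∀ x ∈ A, x ∉ range s := fun x hx h => hAs.le_bot ⟨hx, h⟩
  have h2 : ∀ x ∈ A, x ∉ range t := fun x hx h => hAt.le_bot ⟨hx, h⟩
  have hsq := fun x hx => compSign_sq hs ht (h1 x hx) (h2 x hx)
  refine hA.eq_of_sq_eq (f := W.compSign s t) (g := fun _ => W.compSign s t b) (fun x hx =>
    (continuousAt_const.congr ((eventually_compSign_eq hs ht (h1 x hx) (h2 x hx)).mono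
      fun y hy => hy.symm)).continuousWithinAt) continuousOn_const (fun x hx => ?_)
    (fun _ h => ?_) hb rfl ha
  · simp [hsq x hx, hsq b hb]
  · have := hsq b hb
    rw [h] at this
    simp at this

theorem Good.eventually (hs : W.Good s) : ∀ᶠ t in 𝓝 s, W.Good t := by
  have : dist s γ < W.eps := (ContinuousMap.dist_lt_iff W.eps_pos).2 fun z => by
    obtain ⟨θ, rfl⟩ := Circle.exp_surjective z
    exact hs θ
  filter_upwards [Metric.isOpen_ball.mem_nhds (show s ∈ Metric.ball γ W.eps from this)] with t ht θ
  exact (ContinuousMap.dist_lt_iff W.eps_pos).1 ht _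

end Windows

/-- Three distinct points of a tournament can be arranged in a directed path. -/
theorem exists_path_of_tournament {α : Type*} {R : α → α → Prop} {T : Set α}
    (hR : ∀ a ∈ T, ∀ b ∈ T, a ≠ b → R a b ∨ R b a) {a b c : α} (ha : a ∈ T) (hb : b ∈ T)
    (hc : c ∈ T) (hab : a ≠ b) (hac : a ≠ c) (hbc : b ≠ c) :
    ∃ i ∈ T, ∃ j ∈ T, ∃ k ∈ T, R i j ∧ R j k := by
  rcases hR a ha b hb hab with h1 | h1 <;> rcases hR b hb c hc hbc with h2 | h2
  · exact ⟨a, ha, b, hb, c, hc, h1, h2⟩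
  · rcases hR a ha c hc hac with h3 | h3
    · exact ⟨a, ha, c, hc, b, hb, h3, h2⟩
    · exact ⟨c, hc, a, ha, b, hb, h3, h1⟩
  · rcases hR a ha c hc hac with h3 | h3
    · exact ⟨b, hb, a, ha, c, hc, h1, h3⟩
    · exact ⟨b, hb, c, hc, a, ha, h2, h3⟩
  · exact ⟨c, hc, b, hb, a, ha, h2, h1⟩

theorem Set.Countable.of_sdiff_singleton {α : Type*} {T : Set α} {a : α}
    (h : (T \ {a}).Countable) : T.Countable :=
  (h.union (countable_singleton a)).mono fun x hx => by
    by_cases hxa : x = a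
    · exact .inr hxa
    · exact .inl ⟨hx, hxa⟩

namespace Windows
variable {S : Type*} [MetricSpace S] {γ : C(Circle, S)} {W : Windows γ} {s t : C(Circle, S)}

theorem isPreconnected_range (s : C(Circle, S)) : IsPreconnected (range s) := by
  rw [← Circle.exp_surjective.range_comp]
  exact _root_.isPreconnected_range (continuous_loopAt s)

theorem isClosed_range (s : C(Circle, S)) : IsClosed (range s) :=
  (isCompact_range s.continuous).isClosed

theorem exists_compSign_jump_mem_dense [LocallyConnectedSpace S] {Z : Set S} (hZ : Dense Z)
    (hs : W.Good s) (ht : W.Good t) (hinj : Function.Injective t)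
    (hdisj : Disjoint (range s) (range t)) {y : S} (hy : y ∈ range t) {P : Patch S}
    (hyP : y ∈ P.carrier) (hre : 0 < (P.toFun y).re) :
    (∃ p ∈ Z, p ∈ (range s ∪ range t)ᶜ ∧ W.compSign s t p = -1 ∧
      (closure (connectedComponentIn (range s ∪ range t)ᶜ p) ∩ range t).Nonempty) ∧
    ∃ q ∈ Z, q ∈ (range s ∪ range t)ᶜ ∧ W.compSign s t q = 1 ∧
      (closure (connectedComponentIn (range s ∪ range t)ᶜ q) ∩ range t).Nonempty := by
  obtain ⟨z, hz, hjump⟩ := exists_compSign_jump hs ht hinj hdisj hy hyP hre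
  have hzs : z ∈ (range s)ᶜ := fun h => hdisj.le_bot ⟨h, hz⟩
  set O := connectedComponentIn (range s)ᶜ z with hO
  have hOn : O ∈ 𝓝 z := (isOpen_off s).connectedComponentIn.mem_nhds
    (mem_connectedComponentIn hzs)
  have hOs : Disjoint O (range s) := disjoint_left.2 (connectedComponentIn_subset _ _)
  have hmove : ∀ p ∈ O, p ∉ range s → p ∉ range t → ∃ p' ∈ Z, p' ∈ (range s ∪ range t)ᶜ ∧
      W.compSign s t p' = W.compSign s t p ∧
      (closure (connectedComponentIn (range s ∪ range t)ᶜ p') ∩ range t).Nonempty := by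
    intro p hpO hps hpt
    have hp : p ∈ (range s ∪ range t)ᶜ := fun h => h.elim hps hpt
    have hcl := closure_connectedComponentIn_inter_nonempty (isClosed_range t) (isClosed_range s)
      isPreconnected_connectedComponentIn hOs hp hpO (mem_connectedComponentIn hzs) hz
    have hG := ((isClosed_range s).union (isClosed_range t)).isOpen_compl
    obtain ⟨p', hp', hp'Z⟩ := hZ.inter_open_nonempty _ (hG.connectedComponentIn (x := p))
      ⟨p, mem_connectedComponentIn hp⟩
    refine ⟨p', hp'Z, connectedComponentIn_subset _ _ hp', ?_, ?_⟩
    · have hsub := connectedComponentIn_subset (range s ∪ range t)ᶜ p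
      exact compSign_eq_of_isPreconnected hs ht isPreconnected_connectedComponentIn
        (disjoint_left.2 fun x hx h => hsub hx (.inl h))
        (disjoint_left.2 fun x hx h => hsub hx (.inr h)) hp' (mem_connectedComponentIn hp)
    · rwa [← connectedComponentIn_eq hp']
  obtain ⟨⟨p, hp, hps, hpt, hp1⟩, q, hq, hqs, hqt, hq1⟩ := hjump O hOn
  rw [← hp1, ← hq1]
  exact ⟨hmove p hp hps hpt, hmove q hq hqs hqt⟩

end Windows

/-- A net of connected sets disjoint from each member of an uncountable disjoint family of simple
loops cannot accumulate at an interior point of each of them. -/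
theorem not_frequently_accumulate_of_uncountable {S : Type*} [MetricSpace S]
    [LocallyCompactSpace S] [SecondCountableTopology S] (hS : HasPatches S)
    {T : Set C(Circle, S)} (hT : ¬ T.Countable)
    (hinj : ∀ t ∈ T, Function.Injective t)
    (hdisj : ∀ s ∈ T, ∀ t ∈ T, s ≠ t → Disjoint (range s) (range t))
    (hint : ∀ t ∈ T, ∃ y ∈ range t, ∃ P : Patch S, y ∈ P.carrier ∧ 0 < (P.toFun y).re)
    {ι : Type*} {𝒰 : Filter ι} [𝒰.NeBot] {A : ι → Set S} (hA : ∀ᶠ z in 𝒰, IsPreconnected (A z))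
    {y : C(Circle, S) → S} (hy : ∀ t ∈ T, y t ∈ range t)
    (hacc : ∀ t ∈ T, ∀ O ∈ 𝓝 (y t), ∀ᶠ z in 𝒰, (A z ∩ O).Nonempty)
    (hoff : ∀ t ∈ T, ∀ᶠ z in 𝒰, Disjoint (A z) (range t)) : False := by
  have := hS.locallyConnectedSpace
  classical
  obtain ⟨γ, hγT, hγ⟩ := exists_condensation_point hT
  obtain ⟨W⟩ := exists_windows hS γ (hinj γ hγT)
  have hγg : W.Good γ := W.eventually_good.self_of_nhds
  set T₁ := (T ∩ {t | W.Good t}) \ {γ} with hT₁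
  have hT₁c : ¬ T₁.Countable := fun h => hγ _ W.eventually_good h.of_sdiff_singleton
  obtain ⟨Z, hZc, hZ⟩ := TopologicalSpace.exists_countable_dense S
  have hjump : ∀ t : T₁, ∃ pq ∈ Z ×ˢ Z, (pq.1 ∈ (range γ ∪ range t.1)ᶜ ∧
      W.compSign γ t.1 pq.1 = -1 ∧
      (closure (connectedComponentIn (range γ ∪ range t.1)ᶜ pq.1) ∩ range t.1).Nonempty) ∧
      (pq.2 ∈ (range γ ∪ range t.1)ᶜ ∧ W.compSign γ t.1 pq.2 = 1 ∧
      (closure (connectedComponentIn (range γ ∪ range t.1)ᶜ pq.2) ∩ range t.1).Nonempty) := by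
    rintro ⟨t, ⟨htT, htg⟩, htγ⟩
    obtain ⟨w, hw, P, hwP, hre⟩ := hint t htT
    obtain ⟨⟨p, hp, h1⟩, q, hq, h2⟩ := Windows.exists_compSign_jump_mem_dense hZ hγg htg
      (hinj t htT) (hdisj γ hγT t htT (Ne.symm htγ)) hw hwP hre
    exact ⟨(p, q), ⟨hp, hq⟩, h1, h2⟩
  choose! f hfZ hf using hjump
  obtain ⟨⟨p, q⟩, hpq⟩ : ∃ pq, ¬ {t | ∃ h : t ∈ T₁, f ⟨t, h⟩ = pq}.Countable := by
    by_contra! hcon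
    refine hT₁c (((hZc.prod hZc).biUnion fun pq _ => hcon pq).mono fun t ht => ?_)
    exact mem_iUnion₂.2 ⟨_, hfZ ⟨t, ht⟩, ht, rfl⟩
  set T₂ := {t | ∃ h : t ∈ T₁, f ⟨t, h⟩ = (p, q)} with hT₂
  have hT₂T : ∀ t ∈ T₂, t ∈ T ∧ W.Good t ∧ γ ≠ t := fun t ⟨ht, _⟩ => ⟨ht.1.1, ht.1.2, Ne.symm ht.2⟩
  have hT₂d : ∀ t ∈ T₂, Disjoint (range γ) (range t) := fun t ht =>
    hdisj γ hγT t (hT₂T t ht).1 (hT₂T t ht).2.2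
  set U : S → C(Circle, S) → Set S := fun p t => connectedComponentIn (range γ ∪ range t)ᶜ p with hU
  have hp : ∀ t ∈ T₂, p ∈ (range γ ∪ range t)ᶜ ∧ W.compSign γ t p = -1 ∧
      (closure (U p t) ∩ range t).Nonempty := by
    rintro t ⟨ht, he⟩
    have := (hf ⟨t, ht⟩).1
    rwa [he] at this
  have hq : ∀ t ∈ T₂, q ∈ (range γ ∪ range t)ᶜ ∧ W.compSign γ t q = 1 ∧
      (closure (U q t) ∩ range t).Nonempty := by
    rintro t ⟨ht, he⟩
    have := (hf ⟨t, ht⟩).2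
    rwa [he] at this
  have hsign : ∀ t ∈ T₂, ∀ r ∈ (range γ ∪ range t)ᶜ, ∀ x ∈ U r t,
      W.compSign γ t x = W.compSign γ t r := by
    intro t ht r hr x hx
    have hsub := connectedComponentIn_subset (range γ ∪ range t)ᶜ r
    exact Windows.compSign_eq_of_isPreconnected hγg (hT₂T t ht).2.1
      isPreconnected_connectedComponentIn (disjoint_left.2 fun x hx h => hsub hx (.inl h))
      (disjoint_left.2 fun x hx h => hsub hx (.inr h)) hx (mem_connectedComponentIn hr)
  have hor : ∀ r, (∀ t ∈ T₂, r ∈ (range γ ∪ range t)ᶜ ∧ (closure (U r t) ∩ range t).Nonempty) →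
      ∀ i ∈ T₂, ∀ j ∈ T₂, i ≠ j → range j ⊆ U r i ∨ range i ⊆ U r j := by
    intro r hr i hi j hj hij
    exact subset_connectedComponentIn_or (Windows.isPreconnected_range i)
      (Windows.isPreconnected_range j) (hdisj i (hT₂T i hi).1 j (hT₂T j hj).1 hij)
      (hT₂d i hi).symm (hT₂d j hj).symm (hr i hi).1 (hr i hi).2
  obtain ⟨m, hm, hmc⟩ := exists_condensation_point hpq
  have hmg := (hT₂T m hm).2.1
  have hym : y γ ∉ range m := fun h => (hT₂d m hm).le_bot ⟨hy γ hγT, h⟩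
  have hnear := Windows.eventually_compSign_eq_one hmg hym hmg.eventually
  set T₃ := (T₂ ∩ {t | W.compSign m t (y γ) = 1}) with hT₃
  have hT₃c : ¬ T₃.Countable := hmc _ hnear
  obtain ⟨F, hFT, hF⟩ := Set.Infinite.exists_subset_card_eq (fun h => hT₃c h.countable) 3
  obtain ⟨a, b, c, hab, hac, hbc, rfl⟩ := Finset.card_eq_three.1 hF
  have htour : ∀ a ∈ T₃, ∀ b ∈ T₃, a ≠ b →
      (a ≠ b ∧ range a ⊆ U p b) ∨ (b ≠ a ∧ range b ⊆ U p a) := by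
    intro a ha b hb hab
    rcases hor p (fun t ht => ⟨(hp t ht).1, (hp t ht).2.2⟩) a ha.1 b hb.1 hab with h | h
    · exact .inr ⟨hab.symm, h⟩
    · exact .inl ⟨hab, h⟩
  obtain ⟨i, hi, j, hj, k, hk, ⟨hij, hDij⟩, hjk, hDjk⟩ :=
    exists_path_of_tournament (R := fun i j : C(Circle, S) => i ≠ j ∧ range i ⊆ U p j) htour
      (hFT (by simp)) (hFT (by simp)) (hFT (by simp)) hab hac hbc
  have hji : range j ⊆ U q i := by
    refine (hor q (fun t ht => ⟨(hq t ht).1, (hq t ht).2.2⟩) i hi.1 j hj.1 hij).resolve_right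
      fun h => ?_
    have hx := mem_range_self (f := i) 1
    have h1 := hsign j hj.1 p (hp j hj.1).1 _ (hDij hx)
    have h2 := hsign j hj.1 q (hq j hj.1).1 _ (h hx)
    rw [h1, (hp j hj.1).2.1, (hq j hj.1).2.1] at h2
    norm_num at h2
  obtain ⟨-, hig, -⟩ := hT₂T i hi.1
  obtain ⟨-, hkg, -⟩ := hT₂T k hk.1
  have hyi : y γ ∉ range i := fun h => (hT₂d i hi.1).le_bot ⟨hy γ hγT, h⟩
  have hyk : y γ ∉ range k := fun h => (hT₂d k hk.1).le_bot ⟨hy γ hγT, h⟩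
  have hik : W.compSign i k (y γ) = 1 := by
    have := Windows.compSign_mul hmg hig hkg hym hyi hyk
    rwa [show W.compSign m i (y γ) = 1 from hi.2, show W.compSign m k (y γ) = 1 from hk.2,
      one_mul] at this
  have hUo : ∀ r t, IsOpen (U r t) := fun r t =>
    ((Windows.isClosed_range γ).union (Windows.isClosed_range t)).isOpen_compl.connectedComponentIn
  have hyj := hy j (hT₂T j hj.1).1
  have hnj : U p k ∩ U q i ∈ 𝓝 (y j) :=
    ((hUo p k).inter (hUo q i)).mem_nhds ⟨hDjk hyj, hji hyj⟩
  obtain ⟨z, hzc, ⟨x, hxA, hxk, hxi⟩, ⟨w, hwA, hw⟩, hzi, hzk⟩ :=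
    (hA.and ((hacc j (hT₂T j hj.1).1 _ hnj).and ((hacc γ hγT _
      (Windows.eventually_compSign_eq hig hkg hyi hyk)).and
      ((hoff i (hT₂T i hi.1).1).and (hoff k (hT₂T k hk.1).1))))).exists
  have hxi' := connectedComponentIn_subset _ _ hxi
  have hxk' := connectedComponentIn_subset _ _ hxk
  have hmul := Windows.compSign_mul hγg hig hkg (fun h => hxi' (.inl h)) (fun h => hxi' (.inr h))
    (fun h => hxk' (.inr h))
  rw [hsign i hi.1 q (hq i hi.1).1 x hxi, (hq i hi.1).2.1,
    hsign k hk.1 p (hp k hk.1).1 x hxk, (hp k hk.1).2.1, one_mul,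
    Windows.compSign_eq_of_isPreconnected hig hkg hzc hzi hzk hxA hwA,
    show W.compSign i k w = _ from hw, hik] at hmul
  norm_num at hmul

theorem IsCircle.exists_loop {S : Type*} [TopologicalSpace S] {D : Set S} (hD : IsCircle D) :
    ∃ γ : C(Circle, S), Function.Injective γ ∧ range γ = D := by
  obtain ⟨e⟩ := hD
  refine ⟨⟨fun z => e.symm z, by fun_prop⟩, Subtype.val_injective.comp e.symm.injective, ?_⟩
  exact (e.symm.surjective.range_comp Subtype.val).trans Subtype.range_coe

theorem interior_nonempty_of_isPreconnected {J : Set ℝ} (hJ : IsPreconnected J)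
    (h : J.Nontrivial) : (interior J).Nonempty := by
  obtain ⟨a, ha, b, hb, hab⟩ := h.exists_lt
  refine (nonempty_Ioo.2 hab).mono ?_
  rw [← interior_Icc]
  exact interior_mono (hJ.Icc_subset ha hb)

/-- A circle that reaches a patch along the boundary line covers a segment of that line. -/
theorem interior_image_im_nonempty {S : Type*} [MetricSpace S] {γ : C(Circle, S)}
    (hγ : Function.Injective γ) (P : Patch S)
    (hbd : ∀ y ∈ range γ ∩ P.carrier, (P.toFun y).re = 0) (hne : (range γ ∩ P.carrier).Nonempty) :
    (interior ((fun y => (P.toFun y).im) '' (range γ ∩ P.carrier))).Nonempty := by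
  obtain ⟨y, hy, hyP⟩ := hne
  obtain ⟨θ₀, rfl⟩ := mem_range_loopAt hy
  obtain ⟨ε, hε, hball⟩ := Metric.isOpen_iff.1 (P.isOpen.preimage (continuous_loopAt γ)) θ₀ hyP
  set δ := min (ε / 2) 1 with hδ
  have hδ0 : 0 < δ := lt_min (half_pos hε) one_pos
  have hδε : δ < ε := (min_le_left _ _).trans_lt (half_lt_self hε)
  have hδ1 : δ ≤ 1 := min_le_right _ _
  have hmem : ∀ θ ∈ Icc θ₀ (θ₀ + δ), loopAt γ θ ∈ P.carrier := fun θ hθ => hball (by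
    rw [Metric.mem_ball, Real.dist_eq, abs_lt]
    constructor <;> linarith [hθ.1, hθ.2])
  have hsub : (fun θ => (P.toFun (loopAt γ θ)).im) '' Icc θ₀ (θ₀ + δ) ⊆
      (fun y => (P.toFun y).im) '' (range γ ∩ P.carrier) := by
    rintro _ ⟨θ, hθ, rfl⟩
    exact ⟨loopAt γ θ, ⟨loopAt_mem_range γ θ, hmem θ hθ⟩, rfl⟩
  refine (interior_nonempty_of_isPreconnected (isPreconnected_Icc.image _ ?_) ?_).mono
    (interior_mono hsub)
  · exact Complex.continuous_im.comp_continuousOn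
      (P.continuousOn.comp (continuous_loopAt γ).continuousOn hmem)
  · have hl : θ₀ ∈ Icc θ₀ (θ₀ + δ) := ⟨le_rfl, by linarith⟩
    have hr : θ₀ + δ ∈ Icc θ₀ (θ₀ + δ) := ⟨by linarith, le_rfl⟩
    refine ⟨_, mem_image_of_mem _ hl, _, mem_image_of_mem _ hr, fun h => ?_⟩
    have h1 : P.toFun (loopAt γ θ₀) = P.toFun (loopAt γ (θ₀ + δ)) := Complex.ext
      ((hbd _ ⟨loopAt_mem_range γ _, hmem _ hl⟩).trans
        (hbd _ ⟨loopAt_mem_range γ _, hmem _ hr⟩).symm) h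
    obtain ⟨k, hk⟩ := Circle.exp_eq_exp.1 (hγ (P.injOn (hmem _ hl) (hmem _ hr) h1))
    have hpi := Real.pi_gt_three
    rcases lt_trichotomy k 0 with h0 | h0 | h0
    · have : (k : ℝ) ≤ -1 := by exact_mod_cast Int.le_sub_one_of_lt h0
      nlinarith
    · rw [h0] at hk
      push_cast at hk
      linarith
    · have : (1 : ℝ) ≤ k := by exact_mod_cast h0
      nlinarith

/-- Only countably many members of a disjoint family of circles lie in the boundary. -/
theorem countable_boundary_circles {S : Type*} [MetricSpace S] [SecondCountableTopology S]
    (hS : HasPatches S) {𝒟 : Set (Set S)} (hcirc : ∀ D ∈ 𝒟, IsCircle D)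
    (hdisj : ∀ C ∈ 𝒟, ∀ D ∈ 𝒟, C ≠ D → Disjoint C D) :
    {D ∈ 𝒟 | ¬ ∃ y ∈ D, ∃ P : Patch S, y ∈ P.carrier ∧ 0 < (P.toFun y).re}.Countable := by
  choose P hP _ using fun y : S => hS y univ isOpen_univ trivial
  obtain ⟨t, htc, ht⟩ := TopologicalSpace.countable_cover_nhds
    (f := fun y => (P y).carrier) fun y => (P y).isOpen.mem_nhds (hP y)
  set ℬ := {D ∈ 𝒟 | ¬ ∃ y ∈ D, ∃ P : Patch S, y ∈ P.carrier ∧ 0 < (P.toFun y).re} with hℬ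
  have hbd : ∀ D ∈ ℬ, ∀ P : Patch S, ∀ y ∈ D ∩ P.carrier, (P.toFun y).re = 0 := by
    intro D hD P y hy
    by_contra h
    exact hD.2 ⟨y, hy.1, P, hy.2, lt_of_le_of_ne (P.mapsTo hy.2).1 (Ne.symm h)⟩
  have hcount : ∀ x ∈ t, {D ∈ ℬ | (D ∩ (P x).carrier).Nonempty}.Countable := by
    intro x _
    refine PairwiseDisjoint.countable_of_nonempty_interior
      (s := fun D => (fun y => ((P x).toFun y).im) '' (D ∩ (P x).carrier)) ?_ ?_
    · rintro C ⟨hC, -⟩ D ⟨hD, -⟩ hCD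
      refine disjoint_left.2 ?_
      rintro _ ⟨y, hy, rfl⟩ ⟨w, hw, hyw⟩
      have : w = y := (P x).injOn hw.2 hy.2
        (Complex.ext ((hbd D hD _ w hw).trans (hbd C hC _ y hy).symm) hyw)
      exact (hdisj C hC.1 D hD.1 hCD).le_bot ⟨hy.1, this ▸ hw.1⟩
    · rintro D ⟨hD, hne⟩
      obtain ⟨γ, hγ, rfl⟩ := (hcirc D hD.1).exists_loop
      exact interior_image_im_nonempty hγ _ (hbd _ hD _) hne
  refine (htc.biUnion hcount).mono fun D hD => ?_
  obtain ⟨γ, -, rfl⟩ := (hcirc D hD.1).exists_loop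
  obtain ⟨x, hx, hxP⟩ := mem_iUnion₂.1 (ht ▸ mem_univ (γ 1))
  exact mem_iUnion₂.2 ⟨x, hx, hD, γ 1, mem_range_self _, hxP⟩

/-- The points near which a set-valued map is eventually present. -/
def limitSet {ι S : Type*} [TopologicalSpace S] (𝒰 : Filter ι) (A : ι → Set S) : Set S :=
  {y | ∀ O ∈ 𝓝 y, ∀ᶠ z in 𝒰, (A z ∩ O).Nonempty}

section
variable {ι S : Type*} [TopologicalSpace S] {A : ι → Set S}

theorem isClosed_limitSet (𝒰 : Filter ι) (A : ι → Set S) : IsClosed (limitSet 𝒰 A) := by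
  refine isClosed_of_closure_subset fun y hy O hO => ?_
  obtain ⟨y', hy'O, hy'⟩ := mem_closure_iff_nhds.1 hy _ (interior_mem_nhds.2 hO)
  exact hy' O (mem_interior_iff_mem_nhds.1 hy'O)

theorem limitSet_subset {𝒰 : Filter ι} [𝒰.NeBot] {F : Set S} (hF : IsClosed F)
    (h : ∀ᶠ z in 𝒰, A z ⊆ F) : limitSet 𝒰 A ⊆ F := by
  intro y hy
  by_contra hyF
  obtain ⟨z, hz, w, hw, hwF⟩ := (h.and (hy _ (hF.isOpen_compl.mem_nhds hyF))).exists
  exact hwF (hz hw)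

theorem limitSet_inter_nonempty {𝒰 : Ultrafilter ι} {F : Set S} (hF : IsCompact F)
    (h : ∀ᶠ z in (𝒰 : Filter ι), (A z ∩ F).Nonempty) : (limitSet (𝒰 : Filter ι) A ∩ F).Nonempty := by
  obtain ⟨z₀, s₀, -, -⟩ := h.exists
  have : Nonempty S := ⟨s₀⟩
  choose! w hw using fun z (hz : (A z ∩ F).Nonempty) => hz
  obtain ⟨y, hyF, hy⟩ := hF.ultrafilter_le_nhds (𝒰.map w)
    (Filter.le_principal_iff.2 (h.mono fun z hz => (hw z hz).2))
  refine ⟨y, fun O hO => ?_, hyF⟩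
  filter_upwards [h, (hy hO : w ⁻¹' O ∈ 𝒰)] with z hz hzO using ⟨w z, (hw z hz).1, hzO⟩

theorem isPreconnected_limitSet [T2Space S] [NormalSpace S] {𝒰 : Ultrafilter ι} {F : Set S}
    (hF : IsCompact F) (hA : ∀ᶠ z in (𝒰 : Filter ι), A z ⊆ F)
    (hc : ∀ᶠ z in (𝒰 : Filter ι), IsPreconnected (A z)) :
    IsPreconnected (limitSet (𝒰 : Filter ι) A) := by
  rw [isPreconnected_iff_subset_of_fully_disjoint_closed (isClosed_limitSet _ _)]
  intro u v hu hv huv hdisj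
  by_contra! hcon
  obtain ⟨⟨a, ha, hau⟩, b, hb, hbv⟩ := And.intro (not_subset.1 hcon.1) (not_subset.1 hcon.2)
  obtain ⟨u', v', hu', hv', huu', hvv', huv'⟩ := normal_separation hu hv hdisj
  obtain ⟨y, hy, -, hyuv⟩ := limitSet_inter_nonempty (𝒰 := 𝒰) (A := A)
    (hF.inter_right (hu'.union hv').isClosed_compl) (by
      filter_upwards [hA, hc, ha v' (hv'.mem_nhds (hvv' ((huv ha).resolve_left hau))),
        hb u' (hu'.mem_nhds (huu' ((huv hb).resolve_right hbv)))] with z hzF hzc hzv hzu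
      by_contra hempty
      obtain ⟨w, -, hwu, hwv⟩ := hzc u' v' hu' hv' (fun w hw => by
        by_contra h
        exact hempty ⟨w, hw, hzF hw, h⟩) hzu hzv
      exact huv'.le_bot ⟨hwu, hwv⟩)
  exact hyuv ((huv hy).imp (fun h => huu' h) fun h => hvv' h)

/-- A compact connected set that leaves an open set contains a continuum that starts at a given
point and stops at the frontier. -/
theorem exists_continuum_of_not_subset [T2Space S] {D U : Set S} (hD : IsCompact D)
    (hDc : IsPreconnected D) (hU : IsOpen U) (h : ¬ D ⊆ U) {z : S} (hz : z ∈ D) (hzU : z ∈ U) :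
    ∃ A ⊆ D, IsPreconnected A ∧ A ⊆ closure U ∧ z ∈ A ∧ ¬ A ⊆ U := by
  have : CompactSpace D := isCompact_iff_compactSpace.1 hD
  have : PreconnectedSpace D := isPreconnected_iff_preconnectedSpace.1 hDc
  obtain ⟨L, hL, -, hzL, hLU, hnot⟩ := exists_isPreconnected_subset_closure_not_subset
    (V := (Subtype.val ⁻¹' U : Set D)) (hU.preimage continuous_subtype_val)
    (fun he => h fun w hw => (he ▸ mem_univ (⟨w, hw⟩ : D) : (⟨w, hw⟩ : D) ∈ Subtype.val ⁻¹' U))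
    (p := ⟨z, hz⟩) hzU
  refine ⟨Subtype.val '' L, by rintro _ ⟨w, -, rfl⟩; exact w.2,
    hL.image _ continuous_subtype_val.continuousOn, ?_, ⟨_, hzL, rfl⟩, fun hs => hnot ?_⟩
  · rintro _ ⟨w, hw, rfl⟩
    exact continuous_subtype_val.closure_preimage_subset _ (hLU hw)
  · exact fun w hw => hs ⟨w, hw, rfl⟩

end

theorem isUpperSemicontinuousDecomposition_of_hasPatches {S : Type*} [MetricSpace S]
    [LocallyCompactSpace S] [SecondCountableTopology S] (hS : HasPatches S) {𝒞 : Set (Set S)}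
    (h𝒞 : IsCircleDecomposition 𝒞) : IsUpperSemicontinuousDecomposition 𝒞 := by
  obtain ⟨hcirc, hdisj, hcov⟩ := h𝒞
  intro C hC U hU hCU
  obtain ⟨γ, -⟩ := (hcirc C hC).exists_loop
  have : Nonempty C(Circle, S) := ⟨γ⟩
  choose! g hginj hgrange using fun D hD => (hcirc D hD).exists_loop
  have hcomp : ∀ D ∈ 𝒞, IsCompact D := fun D hD =>
    hgrange D hD ▸ isCompact_range (g D).continuous
  have hconn : ∀ D ∈ 𝒞, IsPreconnected D := fun D hD =>
    hgrange D hD ▸ Windows.isPreconnected_range (g D)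
  have heq : ∀ C ∈ 𝒞, ∀ D ∈ 𝒞, ∀ x ∈ C, x ∈ D → C = D := fun C hC D hD x hxC hxD =>
    by_contra fun h => (hdisj C hC D hD h).le_bot ⟨hxC, hxD⟩
  obtain ⟨U', hU', hCU', hU'U, hU'c⟩ := exists_open_between_and_isCompact_closure (hcomp C hC) hU hCU
  set B := {z | ∃ D ∈ 𝒞, z ∈ D ∧ ¬ D ⊆ U} with hB
  by_cases hCB : Disjoint C (closure B)
  · refine ⟨(closure B)ᶜ, isClosed_closure.isOpen_compl, subset_compl_iff_disjoint_right.2 hCB,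
      fun D hD hne => ?_⟩
    obtain ⟨z, hzD, hz⟩ := nonempty_iff_ne_empty.2 hne
    by_contra h
    exact hz (subset_closure ⟨D, hD, hzD, h⟩)
  obtain ⟨x, hxC, hxB⟩ := not_disjoint_iff.1 hCB
  obtain ⟨𝒰, hB𝒰, h𝒰⟩ := mem_closure_iff_ultrafilter.1 hxB
  have hcont : ∀ z, z ∈ B → z ∈ U' → ∃ AD : Set S × Set S, AD.2 ∈ 𝒞 ∧ AD.1 ⊆ AD.2 ∧
      IsPreconnected AD.1 ∧ AD.1 ⊆ closure U' ∧ z ∈ AD.1 ∧ ¬ AD.1 ⊆ U' := by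
    rintro z ⟨D, hD, hzD, hDU⟩ hzU
    obtain ⟨A, hAD, hA⟩ := exists_continuum_of_not_subset (hcomp D hD) (hconn D hD) hU'
      (fun h => hDU (h.trans (subset_closure.trans hU'U))) hzD hzU
    exact ⟨(A, D), hD, hAD, hA⟩
  choose! AD hAD using hcont
  set A : S → Set S := fun z => (AD z).1 with hA
  have hev : ∀ᶠ z in (𝒰 : Filter S), (AD z).2 ∈ 𝒞 ∧ A z ⊆ (AD z).2 ∧
      IsPreconnected (A z) ∧ A z ⊆ closure U' ∧ z ∈ A z ∧ ¬ A z ⊆ U' := by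
    filter_upwards [hB𝒰, h𝒰 (hU'.mem_nhds (hCU' hxC))] with z hz hz' using hAD z hz hz'
  set K := limitSet (𝒰 : Filter S) A with hK
  have hAcl : ∀ᶠ z in (𝒰 : Filter S), A z ⊆ closure U' := hev.mono fun z h => h.2.2.2.1
  have hApre : ∀ᶠ z in (𝒰 : Filter S), IsPreconnected (A z) := hev.mono fun z h => h.2.2.1
  have hKc : IsCompact K :=
    hU'c.of_isClosed_subset (isClosed_limitSet _ _) (limitSet_subset isClosed_closure hAcl)
  have hKpre : IsPreconnected K := isPreconnected_limitSet hU'c hAcl hApre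
  have hxK : x ∈ K := fun O hO => by
    filter_upwards [hev, h𝒰 hO] with z hz hzO using ⟨z, hz.2.2.2.2.1, hzO⟩
  obtain ⟨w, hwK, -, hwU⟩ : (K ∩ (closure U' ∩ U'ᶜ)).Nonempty :=
    limitSet_inter_nonempty (hU'c.inter_right hU'.isClosed_compl) (hev.mono fun z hz => by
      obtain ⟨w, hw, hwU⟩ := not_subset.1 hz.2.2.2.2.2
      exact ⟨w, hw, hz.2.2.2.1 hw, hwU⟩)
  have hKD : ∀ D ∈ 𝒞, ¬ K ⊆ D := by
    intro D hD h
    rw [← heq C hC D hD x hxC (h hxK)] at h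
    exact hwU (hCU' (h hwK))
  have hoff : ∀ D ∈ 𝒞, ∀ᶠ z in (𝒰 : Filter S), Disjoint (A z) D := by
    intro D hD
    rcases 𝒰.eventually_or.1 (.of_forall fun z => em ((AD z).2 = D)) with h | h
    · refine absurd (limitSet_subset (hcomp D hD).isClosed ?_) (hKD D hD)
      filter_upwards [h, hev] with z hz hz' using hz ▸ hz'.2.1
    · filter_upwards [h, hev] with z hz hz' using
        (hdisj _ hz'.1 D hD hz).mono_left hz'.2.1
  have hunc := not_countable_of_isPreconnected_of_closed_cover
    (fun D hD => (hcomp D hD).isClosed) hdisj hKc hKpre (hcov ▸ subset_univ K) hKD ⟨x, hxK⟩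
  set 𝒟 := {D ∈ 𝒞 | (D ∩ K).Nonempty ∧
    ∃ y ∈ D, ∃ P : Patch S, y ∈ P.carrier ∧ 0 < (P.toFun y).re} with h𝒟
  have h𝒟c : ¬ 𝒟.Countable := fun h => hunc
    ((h.union (countable_boundary_circles hS hcirc hdisj)).mono fun D hD => by
      by_cases hi : ∃ y ∈ D, ∃ P : Patch S, y ∈ P.carrier ∧ 0 < (P.toFun y).re
      · exact .inl ⟨hD.1, hD.2, hi⟩
      · exact .inr ⟨hD.1, hi⟩)
  have hT : ∀ t ∈ g '' 𝒟, ∃ D ∈ 𝒟, g D = t ∧ range t = D := by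
    rintro _ ⟨D, hD, rfl⟩
    exact ⟨D, hD, rfl, hgrange D hD.1⟩
  have hTK : ∀ t : C(Circle, S), t ∈ g '' 𝒟 → ∃ y ∈ range t, y ∈ K := by
    intro t ht
    obtain ⟨D, hD, -, hr⟩ := hT t ht
    rw [hr]
    exact hD.2.1
  have : Nonempty S := ⟨x⟩
  choose! y hy hyK using hTK
  refine (not_frequently_accumulate_of_uncountable hS (T := g '' 𝒟) (𝒰 := (𝒰 : Filter S)) (A := A)
    (y := y) (fun h => h𝒟c ?_) ?_ ?_ ?_ hApre hy (fun t ht => hyK t ht) ?_).elim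
  · refine (h.image fun t : C(Circle, S) => range t).mono fun D hD => ?_
    exact ⟨g D, mem_image_of_mem _ hD, hgrange D hD.1⟩
  · rintro _ ⟨D, hD, rfl⟩
    exact hginj D hD.1
  · rintro _ ⟨D, hD, rfl⟩ _ ⟨E, hE, rfl⟩ hne
    rw [hgrange D hD.1, hgrange E hE.1]
    exact hdisj D hD.1 E hE.1 fun h => hne (h ▸ rfl)
  · rintro _ ⟨D, hD, rfl⟩
    rw [hgrange D hD.1]
    exact hD.2.2
  · rintro _ ⟨D, hD, rfl⟩
    rw [hgrange D hD.1]
    exact hoff D hD.1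

/-- Any circle decomposition of a surface (possibly with boundary) is upper
semicontinuous. -/
theorem circle_decomposition_usc
    {S : Type*} [TopologicalSpace S] [T2Space S] [SecondCountableTopology S]
    [ConnectedSpace S] [Nonempty S] [ChartedSpace (EuclideanHalfSpace 2) S]
    (𝒞 : Set (Set S)) (h𝒞 : IsCircleDecomposition 𝒞) :
    IsUpperSemicontinuousDecomposition 𝒞 := by
  have : LocallyCompactSpace (EuclideanHalfSpace 2) :=
    (isClosed_le continuous_const (EuclideanSpace.proj (𝕜 := ℝ) (0 : Fin 2)).continuous).locallyCompactSpace
  have : LocallyCompactSpace S := ChartedSpace.locallyCompactSpace (EuclideanHalfSpace 2) S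
  have := TopologicalSpace.metrizableSpace_of_t3_secondCountable S
  let _ := TopologicalSpace.metrizableSpaceMetric S
  exact isUpperSemicontinuousDecomposition_of_hasPatches (hasPatches_of_chartedSpace S) h𝒞
end

section
/- If a surface S admits a circle decomposition, then no connected component of the boundary ∂S is homeomorphic to the real line ℝ. -/
open Topology Set

/-- A point `x` of a surface is a manifold-interior point if it has an open neighborhood
homeomorphic to the plane `ℝ²`. -/
def IsManifoldInteriorPt {S : Type*} [TopologicalSpace S] (x : S) : Prop :=
  ∃ U : Set S, IsOpen U ∧ x ∈ U ∧ Nonempty (U ≃ₜ EuclideanSpace ℝ (Fin 2))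

/-- Sierpiński's theorem for a countable closed partition of the real line. -/
theorem exists_eq_univ_of_countable_closed_partition {ι : Type*} [Countable ι] {E : ι → Set ℝ}
    (hclosed : ∀ i, IsClosed (E i)) (hdisj : ∀ i j, i ≠ j → Disjoint (E i) (E j))
    (hcover : ⋃ i, E i = univ) : ∃ i, E i = univ := by
  have hmem : ∀ x, ∃ i, x ∈ E i := fun x => mem_iUnion.1 (hcover ▸ mem_univ x)
  have huniq : ∀ {x i j}, x ∈ E i → x ∈ E j → i = j := fun {x i j} hi hj => by
    by_contra hne
    exact disjoint_left.1 (hdisj i j hne) hi hj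
  set F : Set ℝ := (⋃ i, interior (E i))ᶜ with hF
  have hFclosed : IsClosed F := (isOpen_iUnion fun i => isOpen_interior).isClosed_compl
  have hint : ∀ {x i}, x ∈ E i → x ∉ F → x ∈ interior (E i) := fun {x i} hx hxF => by
    obtain ⟨j, hj⟩ := mem_iUnion.1 (not_not.1 hxF)
    rwa [huniq hx (interior_subset hj)]
  rcases F.eq_empty_or_nonempty with hempty | hne
  · obtain ⟨i, hi⟩ := hmem 0
    have hopen : IsOpen (E i) := by
      rw [← subset_interior_iff_isOpen]
      exact fun x hx => hint hx (hempty ▸ notMem_empty x)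
    exact ⟨i, IsClopen.eq_univ ⟨hclosed i, hopen⟩ ⟨0, hi⟩⟩
  · exfalso
    have : Nonempty F := hne.to_subtype
    have : CompleteSpace F := hFclosed.completeSpace_coe
    obtain ⟨i, x, hx⟩ := nonempty_interior_of_iUnion_of_closed
      (f := fun i => ((↑) : F → ℝ) ⁻¹' E i) (fun i => (hclosed i).preimage continuous_subtype_val)
      (by rw [← preimage_iUnion, hcover, preimage_univ])
    rw [mem_interior_iff_mem_nhds, mem_nhds_subtype] at hx
    obtain ⟨u, hu, hux⟩ := hx
    obtain ⟨ε, hε, hball⟩ := Metric.mem_nhds_iff.1 hu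
    have hFE : ∀ y ∈ Metric.ball (x : ℝ) ε, y ∈ F → y ∈ E i := fun y hy hyF =>
      hux (show (⟨y, hyF⟩ : F) ∈ _ from hball hy)
    have hxE : (x : ℝ) ∈ E i := hFE x (Metric.mem_ball_self hε) x.2
    have hsub : Metric.ball (x : ℝ) ε ⊆ E i := by
      intro y hy
      obtain ⟨m, hm⟩ := hmem y
      by_contra hyi
      have hmi : m ≠ i := fun h => hyi (h ▸ hm)
      have hpre : IsPreconnected (Metric.ball (x : ℝ) ε) := (convex_ball _ _).isPreconnected
      obtain ⟨z, hz, hz1, hz2⟩ := hpre (interior (E m)) (E m)ᶜ isOpen_interior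
        (hclosed m).isOpen_compl
        (fun z hz => by
          by_cases hzm : z ∈ E m
          · exact Or.inl (hint hzm fun hzF => hmi (huniq hzm (hFE z hz hzF)))
          · exact Or.inr hzm)
        ⟨y, hy, hint hm fun hyF => hyi (hFE y hy hyF)⟩
        ⟨x, Metric.mem_ball_self hε, fun h => hmi (huniq h hxE)⟩
      exact hz2 (interior_subset hz1)
    exact x.2 (mem_iUnion.2 ⟨i, mem_interior.2 ⟨_, hsub, Metric.isOpen_ball,
      Metric.mem_ball_self hε⟩⟩)

/-- A continuous angle with nonnegative sine which starts at `0` stays in `[0, π]`. -/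
theorem mem_Icc_zero_pi_of_sin_nonneg {u : ℝ → ℝ} (hu : Continuous u) (h0 : u 0 = 0 ∨ u 0 = Real.pi)
    (hsin : ∀ s, 0 ≤ Real.sin (u s)) (s : ℝ) : u s ∈ Icc 0 Real.pi := by
  have hpi := Real.pi_pos
  have hconn : (range u).OrdConnected := (isPreconnected_range hu).ordConnected
  have h0' : u 0 ∈ range u := mem_range_self 0
  have hs' : u s ∈ range u := mem_range_self s
  have h0l : 0 ≤ u 0 := by rcases h0 with h | h <;> rw [h]; exact hpi.le
  have h0r : u 0 ≤ Real.pi := by rcases h0 with h | h <;> rw [h]; exact hpi.le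
  constructor
  · by_contra! hlt
    obtain ⟨r, hr⟩ := hconn.out hs' h0' (show max (u s) (-(Real.pi / 2)) ∈ _ from
      ⟨le_max_left _ _, max_le (hlt.le.trans h0l) (by linarith)⟩)
    refine (hsin r).not_gt (Real.sin_neg_of_neg_of_neg_pi_lt ?_ ?_) <;> rw [hr]
    · exact max_lt hlt (by linarith)
    · exact lt_max_of_lt_right (by linarith)
  · by_contra! hlt
    obtain ⟨r, hr⟩ := hconn.out h0' hs' (show min (u s) (Real.pi + Real.pi / 2) ∈ _ from
      ⟨le_min (h0r.trans hlt.le) (by linarith), min_le_left _ _⟩)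
    have : Real.sin (u r - Real.pi) ≤ 0 := by rw [Real.sin_sub_pi]; linarith [hsin r]
    refine this.not_gt (Real.sin_pos_of_pos_of_lt_pi ?_ ?_) <;> rw [hr]
    · linarith [lt_min hlt (show Real.pi < Real.pi + Real.pi / 2 by linarith)]
    · linarith [min_le_right (u s) (Real.pi + Real.pi / 2)]

/-- Two disjoint curves in the closed upper half-plane based at points of the real axis:
along the antidiagonal segment, some chord `f s - g t` has the same direction as `f t - g s`. -/
theorem exists_parallel_chords_of_lt {f g : ℝ → ℂ} (hf : Continuous f) (hg : Continuous g)
    (hfim : ∀ s, 0 ≤ (f s).im) (hgim : ∀ s, 0 ≤ (g s).im) (hf0 : (f 0).im = 0)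
    (hg0 : (g 0).im = 0) (hne : ∀ s t, f s ≠ g t) (hlt : (g 0).re < (f 0).re) :
    ∃ r ∈ Icc (0 : ℝ) 1, ∃ c : ℝ, 0 < c ∧ f (1 - r) - g (-r) = c * (f (-r) - g (1 - r)) := by
  let F : C(ℝ × ℝ, ℂ) := ⟨fun p => f p.1 - g p.2, by fun_prop⟩
  have hF : ∀ p, F p ≠ 0 := fun p => sub_ne_zero.2 (hne _ _)
  obtain ⟨L, ⟨hL0, hL⟩, -⟩ := Complex.isCoveringMapOn_exp.existsUnique_continuousMap_lifts F
    (a₀ := (0, 0)) (Complex.exp_log (hF _)) (fun p => hF p)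
  have hexp : ∀ s t, Complex.exp (L (s, t)) = f s - g t := fun s t => congrFun hL (s, t)
  have hθ0 : (L (0, 0)).im = 0 := by
    rw [hL0, Complex.log_im, Complex.arg_eq_zero_iff]
    simp only [F, ContinuousMap.coe_mk, Complex.sub_re, Complex.sub_im, hf0, hg0]
    exact ⟨by linarith, by simp⟩
  have hsin : ∀ s t, 0 ≤ Real.sin (L (s, t)).im ↔ 0 ≤ (f s).im - (g t).im := fun s t => by
    rw [← Complex.sub_im, ← hexp, Complex.exp_im, mul_nonneg_iff_of_pos_left (Real.exp_pos _)]
  have hsin' : ∀ s t, Real.sin (L (s, t)).im ≤ 0 ↔ (f s).im - (g t).im ≤ 0 := fun s t => by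
    rw [← Complex.sub_im, ← hexp, Complex.exp_im, ← not_lt, ← not_lt,
      mul_pos_iff_of_pos_left (Real.exp_pos _)]
  have hupper : ∀ s, (L (s, 0)).im ∈ Icc 0 Real.pi :=
    mem_Icc_zero_pi_of_sin_nonneg (u := fun s => (L (s, 0)).im) (by fun_prop) (Or.inl hθ0)
      fun s => (hsin s 0).2 (by rw [hg0, sub_zero]; exact hfim s)
  have hlower : ∀ t, -(L (0, t)).im ∈ Icc 0 Real.pi :=
    mem_Icc_zero_pi_of_sin_nonneg (u := fun t => -(L (0, t)).im) (by fun_prop)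
      (Or.inl (by simp [hθ0])) fun t => by
        rw [Real.sin_neg, neg_nonneg]
        exact (hsin' 0 t).2 (by rw [hf0, zero_sub, neg_nonpos]; exact hgim t)
  let ψ : ℝ → ℝ := fun r => (L (1 - r, -r)).im - (L (-r, 1 - r)).im
  have hψ : Continuous ψ := by fun_prop
  have hψ0 : 0 ≤ ψ 0 := by
    have h1 := (hupper 1).1
    have h2 := (hlower 1).1
    simp only [ψ, sub_zero, neg_zero]
    linarith
  have hψ1 : ψ 1 ≤ 0 := by
    have h1 := (hupper (-1)).1
    have h2 := (hlower (-1)).1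
    simp only [ψ, sub_self]
    linarith
  obtain ⟨r, hr, hr0⟩ := intermediate_value_Icc' zero_le_one hψ.continuousOn ⟨hψ1, hψ0⟩
  refine ⟨r, hr, Real.exp ((L (1 - r, -r)).re - (L (-r, 1 - r)).re), Real.exp_pos _, ?_⟩
  rw [← hexp, ← hexp, Complex.ofReal_exp, ← Complex.exp_add]
  congr 1
  apply Complex.ext
  · simp
  · simpa [ψ, sub_eq_zero] using hr0

theorem exists_parallel_chords {f g : ℝ → ℂ} (hf : Continuous f) (hg : Continuous g)
    (hfim : ∀ s, 0 ≤ (f s).im) (hgim : ∀ s, 0 ≤ (g s).im) (hf0 : (f 0).im = 0)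
    (hg0 : (g 0).im = 0) (hne : ∀ s t, f s ≠ g t) :
    ∃ r ∈ Icc (0 : ℝ) 1, ∃ c : ℝ, 0 < c ∧ f (1 - r) - g (-r) = c * (f (-r) - g (1 - r)) := by
  rcases lt_trichotomy (g 0).re (f 0).re with hlt | heq | hlt
  · exact exists_parallel_chords_of_lt hf hg hfim hgim hf0 hg0 hne hlt
  · exact absurd (Complex.ext heq.symm (hf0.trans hg0.symm)) (hne 0 0)
  · obtain ⟨r, hr, c, hc, h⟩ :=
      exists_parallel_chords_of_lt hg hf hgim hfim hg0 hf0 (fun s t => (hne t s).symm) hlt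
    refine ⟨r, hr, c⁻¹, inv_pos.2 hc, ?_⟩
    have hc' : (c : ℂ) ≠ 0 := by exact_mod_cast hc.ne'
    rw [Complex.ofReal_inv, eq_inv_mul_iff_mul_eq₀ hc']
    linear_combination h

/-- Uniformly close curves do not have parallel chords across a long chord. -/
theorem not_parallel_of_close {u v w : ℂ} {δ : ℝ} (hu : δ ≤ ‖u‖) (hv : ‖v - u‖ < δ)
    (hw : ‖w + u‖ < δ) {c : ℝ} (hc : 0 < c) : v ≠ c * w := by
  intro h
  have h1 : 0 < inner ℝ u v := by
    have := real_inner_le_norm u (u - v)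
    rw [inner_sub_right, real_inner_self_eq_norm_sq, norm_sub_rev] at this
    nlinarith [norm_nonneg (v - u)]
  have h2 : inner ℝ u w < 0 := by
    have := real_inner_le_norm u (w + u)
    rw [inner_add_right, real_inner_self_eq_norm_sq] at this
    nlinarith [norm_nonneg (w + u)]
  rw [h, ← Complex.real_smul, inner_smul_right] at h1
  nlinarith

theorem exists_accumulation_of_uncountable {α ι : Type*} [TopologicalSpace α]
    [SecondCountableTopology α] [Uncountable ι] {f : ι → α} (hf : Function.Injective f) :
    ∃ i, ∀ U ∈ 𝓝 (f i), ∃ j, j ≠ i ∧ f j ∈ U := by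
  by_contra! h
  have : DiscreteTopology (range f) := by
    rw [discreteTopology_iff_isOpen_singleton]
    rintro ⟨_, i, rfl⟩
    obtain ⟨U, hU, hi⟩ := h i
    obtain ⟨V, hVU, hV, hiV⟩ := mem_nhds_iff.1 hU
    refine ⟨V, hV, ?_⟩
    ext ⟨_, j, rfl⟩
    refine ⟨fun hj => by_contra fun hne => hi j (fun e => hne (e ▸ rfl)) (hVU hj), fun hj => ?_⟩
    have hij : f j = f i := congrArg Subtype.val hj
    exact (show f j ∈ V from hij.symm ▸ hiV)
  have : Countable (range f) := TopologicalSpace.separableSpace_iff_countable.1 inferInstance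
  exact not_countable (hf.codRestrict mem_range_self).countable

/-- Only countably many pairwise disjoint arcs in the closed upper half-plane have their
midpoints on the real axis. -/
theorem countable_of_disjoint_arcs {ι : Type*} (f : ι → C(Icc (-1 : ℝ) 1, ℂ))
    (hinj : ∀ i, Function.Injective (f i)) (him : ∀ i t, 0 ≤ (f i t).im)
    (him0 : ∀ i, (f i ⟨0, by norm_num, by norm_num⟩).im = 0)
    (hdisj : ∀ i j, i ≠ j → ∀ s t, f i s ≠ f j t) : Countable ι := by
  by_contra hcount
  have : Uncountable ι := not_countable_iff.1 hcount
  have hle : (-1 : ℝ) ≤ 1 := by norm_num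
  have hfinj : Function.Injective f := fun i j hij => by
    by_contra hne
    exact hdisj i j hne ⟨0, by norm_num, by norm_num⟩ ⟨0, by norm_num, by norm_num⟩ (by rw [hij])
  obtain ⟨i, hi⟩ := exists_accumulation_of_uncountable hfinj
  let F : ι → ℝ → ℂ := fun i t => f i (projIcc (-1) 1 hle t)
  have hF : ∀ i, Continuous (F i) := fun i => (f i).continuous.comp continuous_projIcc
  have hF0 : ∀ i, (F i 0).im = 0 := fun i => by
    simp only [F]
    rw [projIcc_of_mem hle ⟨by norm_num, by norm_num⟩]
    exact him0 i
  obtain ⟨r₀, hr₀, hmin⟩ := isCompact_Icc.exists_isMinOn (nonempty_Icc.2 zero_le_one)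
    (f := fun r => ‖F i (1 - r) - F i (-r)‖)
    (((hF i).comp (by fun_prop)).sub ((hF i).comp (by fun_prop))).norm.continuousOn
  have hδ : 0 < ‖F i (1 - r₀) - F i (-r₀)‖ := by
    rw [norm_pos_iff, sub_ne_zero]
    intro h
    have h' := hinj i h
    rw [projIcc_of_mem hle ⟨by linarith [hr₀.2], by linarith [hr₀.1]⟩,
      projIcc_of_mem hle ⟨by linarith [hr₀.2], by linarith [hr₀.1]⟩] at h'
    linarith [congrArg Subtype.val h']
  obtain ⟨j, hji, hj⟩ := hi _ (Metric.ball_mem_nhds (f i) hδ)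
  have hclose : ∀ t, ‖F j t - F i t‖ < ‖F i (1 - r₀) - F i (-r₀)‖ := fun t => by
    rw [← dist_eq_norm]
    exact (ContinuousMap.dist_apply_le_dist _).trans_lt hj
  obtain ⟨r, hr, c, hc, h⟩ := exists_parallel_chords (hF i) (hF j) (fun s => him i _)
    (fun s => him j _) (hF0 i) (hF0 j) fun s t => hdisj i j hji.symm _ _
  refine not_parallel_of_close (hmin hr) ?_ ?_ hc h
  · rw [sub_sub_sub_cancel_left, norm_sub_rev]
    exact hclose _
  · rw [show F i (-r) - F j (1 - r) + (F i (1 - r) - F i (-r)) = -(F j (1 - r) - F i (1 - r)) by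
      ring, norm_neg]
    exact hclose _

theorem IsCircle.exists_arc {X : Type*} [TopologicalSpace X] {C U : Set X} (hC : IsCircle C)
    {x : X} (hx : x ∈ C) (hU : U ∈ 𝓝 x) :
    ∃ γ : C(Icc (-1 : ℝ) 1, X), Function.Injective γ ∧ γ ⟨0, by norm_num, by norm_num⟩ = x ∧
      ∀ t, γ t ∈ C ∩ U := by
  obtain ⟨φ⟩ := hC
  let p : ℝ → X := fun s => φ.symm (φ ⟨x, hx⟩ * Circle.exp s)
  have hp : Continuous p := by fun_prop
  have hp0 : p 0 = x := by simp [p]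
  obtain ⟨ε, hε, hball⟩ := Metric.mem_nhds_iff.1 (hp.continuousAt.preimage_mem_nhds
    (t := U) (x := 0) (by rwa [hp0]))
  set η : ℝ := min (ε / 2) 1 with hη
  have hη0 : 0 < η := lt_min (half_pos hε) one_pos
  refine ⟨⟨fun t => p (η * t), by fun_prop⟩, ?_, by simp [hp0], fun t => ⟨Subtype.coe_prop _, ?_⟩⟩
  · intro s t hst
    have h := mul_left_cancel (φ.symm.injective (Subtype.ext hst))
    obtain ⟨m, hm⟩ := Circle.exp_eq_exp.1 h
    have hpi := Real.pi_gt_three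
    have hη1 : η ≤ 1 := min_le_right _ _
    have hs := s.2
    have ht := t.2
    have hd : |(m : ℝ) * (2 * Real.pi)| ≤ 2 := by
      rw [show (m : ℝ) * (2 * Real.pi) = η * (s - t) by linarith, abs_mul, abs_of_pos hη0]
      have : |(s : ℝ) - t| ≤ 2 := abs_le.2 ⟨by linarith [hs.1, ht.2], by linarith [hs.2, ht.1]⟩
      nlinarith [abs_nonneg ((s : ℝ) - t)]
    have hm0 : m = 0 := by
      by_contra hne
      have : (1 : ℝ) ≤ |(m : ℝ)| := by exact_mod_cast Int.one_le_abs hne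
      rw [abs_mul, abs_of_pos (by positivity : (0 : ℝ) < 2 * Real.pi)] at hd
      nlinarith
    rw [hm0, Int.cast_zero, zero_mul, add_zero] at hm
    exact Subtype.ext (mul_left_cancel₀ hη0.ne' hm)
  · apply hball
    rw [Metric.mem_ball, dist_zero_right, Real.norm_eq_abs, abs_mul, abs_of_pos hη0]
    have : |(t : ℝ)| ≤ 1 := abs_le.2 t.2
    have : η ≤ ε / 2 := min_le_left _ _
    nlinarith

theorem isManifoldInteriorPt_of_chart_pos {S : Type*} [TopologicalSpace S]
    (e : OpenPartialHomeomorph S (EuclideanHalfSpace 2)) {x : S} (hx : x ∈ e.source)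
    (hpos : 0 < (e x).1 0) : IsManifoldInteriorPt x := by
  obtain ⟨W, hW, hWe⟩ := isOpen_induced_iff.1 e.open_target
  have hWmem : ∀ v : EuclideanHalfSpace 2, v.1 ∈ W ↔ v ∈ e.target := fun v => by
    rw [← hWe]; rfl
  set V : Set (EuclideanSpace ℝ (Fin 2)) := W ∩ {v | 0 < v 0} with hV
  have hVopen : IsOpen V := hW.inter (isOpen_lt continuous_const (by fun_prop))
  obtain ⟨r, hr, hball⟩ := Metric.isOpen_iff.1 hVopen (e x).1
    ⟨(hWmem _).2 (e.map_source hx), hpos⟩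
  set b := OpenPartialHomeomorph.univBall (e x).1 r with hb
  have hbt : b.target = Metric.ball (e x).1 r := OpenPartialHomeomorph.univBall_target _ hr
  have hbs : b.source = univ := OpenPartialHomeomorph.univBall_source _ _
  have hbmem : ∀ v, b v ∈ Metric.ball (e x).1 r := fun v => hbt ▸ b.map_source (hbs ▸ mem_univ v)
  have hval : Continuous (Subtype.val : EuclideanHalfSpace 2 → EuclideanSpace ℝ (Fin 2)) :=
    continuous_subtype_val
  let h : EuclideanSpace ℝ (Fin 2) → EuclideanHalfSpace 2 := fun v =>
    ⟨b v, (hball (hbmem v)).2.le⟩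
  have hcont : Continuous h := by
    refine Continuous.subtype_mk ?_ _
    rw [← continuousOn_univ, ← hbs]
    exact b.continuousOn
  have htarget : ∀ v, h v ∈ e.target := fun v => (hWmem _).1 (hball (hbmem v)).1
  refine ⟨e.source ∩ e ⁻¹' (Subtype.val ⁻¹' Metric.ball (e x).1 r),
    e.isOpen_inter_preimage (Metric.isOpen_ball.preimage hval),
    ⟨hx, Metric.mem_ball_self hr⟩, ⟨?_⟩⟩
  exact
    { toFun := fun y => b.symm (e y).1
      invFun := fun v => ⟨e.symm (h v), e.map_target (htarget v), by
        rw [mem_preimage, e.right_inv (htarget v)]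
        exact hbmem v⟩
      left_inv := fun y => by
        have hy : (e y).1 ∈ b.target := by
          rw [hbt]
          exact y.2.2
        have hhy : h (b.symm (e y).1) = e y := Subtype.ext (b.right_inv hy)
        exact Subtype.ext ((congrArg e.symm hhy).trans (e.left_inv y.2.1))
      right_inv := fun v =>
        (congrArg (fun w => b.symm w.1) (e.right_inv (htarget v))).trans
          (b.left_inv (hbs ▸ mem_univ v))
      continuous_toFun := b.symm.continuousOn.comp_continuous
        (hval.comp (e.continuousOn.comp_continuous continuous_subtype_val fun y => y.2.1))
        fun y => by rw [b.symm_source, hbt]; exact y.2.2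
      continuous_invFun := Continuous.subtype_mk
        (e.symm.continuousOn.comp_continuous hcont htarget) _ }

theorem isClosed_setOf_not_isManifoldInteriorPt {S : Type*} [TopologicalSpace S] :
    IsClosed {x : S | ¬ IsManifoldInteriorPt x} := by
  rw [← isOpen_compl_iff, isOpen_iff_forall_mem_open]
  intro x hx
  obtain ⟨U, hU, hxU, hhomeo⟩ := not_not.1 hx
  exact ⟨U, fun y hy => not_not.2 ⟨U, hU, hy, hhomeo⟩, hU, hxU⟩

/-- Only countably many members of a circle decomposition meet the boundary of a surface. -/
theorem countable_circles_meeting_boundary {S : Type*} [TopologicalSpace S]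
    [SecondCountableTopology S] [ChartedSpace (EuclideanHalfSpace 2) S] {𝒞 : Set (Set S)}
    (hcirc : ∀ C ∈ 𝒞, IsCircle C) (hdisj : ∀ C ∈ 𝒞, ∀ D ∈ 𝒞, C ≠ D → Disjoint C D) :
    {C ∈ 𝒞 | (C ∩ {x : S | ¬ IsManifoldInteriorPt x}).Nonempty}.Countable := by
  obtain ⟨T, hT, hcover⟩ := TopologicalSpace.countable_cover_nhds
    (fun x : S => chart_source_mem_nhds (EuclideanHalfSpace 2) x)
  have hsub : {C ∈ 𝒞 | (C ∩ {x : S | ¬ IsManifoldInteriorPt x}).Nonempty} ⊆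
      ⋃ y ∈ T, {C ∈ 𝒞 | ∃ x ∈ C, ¬ IsManifoldInteriorPt x ∧
        x ∈ (chartAt (EuclideanHalfSpace 2) y).source} := by
    rintro C ⟨hC, x, hxC, hx⟩
    obtain ⟨y, hy, hxy⟩ := mem_iUnion₂.1 (hcover ▸ mem_univ x)
    exact mem_iUnion₂.2 ⟨y, hy, hC, x, hxC, hx, hxy⟩
  refine (hT.biUnion fun y _ => ?_).mono hsub
  set e := chartAt (EuclideanHalfSpace 2) y
  rw [← countable_coe_iff]
  have harc : ∀ C : {C ∈ 𝒞 | ∃ x ∈ C, ¬ IsManifoldInteriorPt x ∧ x ∈ e.source},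
      ∃ γ : C(Icc (-1 : ℝ) 1, S), Function.Injective γ ∧
        ¬ IsManifoldInteriorPt (γ ⟨0, by norm_num, by norm_num⟩) ∧ ∀ t, γ t ∈ C.1 ∩ e.source := by
    rintro ⟨C, hC, x, hxC, hx, hxe⟩
    obtain ⟨γ, hinj, hγ0, hγ⟩ := (hcirc C hC).exists_arc hxC (e.open_source.mem_nhds hxe)
    exact ⟨γ, hinj, hγ0 ▸ hx, hγ⟩
  choose γ hinj hbdry hmem using harc
  let q : EuclideanHalfSpace 2 → ℂ := fun v => ⟨v.1 1, v.1 0⟩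
  have hq : Continuous q := by
    have hval : Continuous (Subtype.val : EuclideanHalfSpace 2 → EuclideanSpace ℝ (Fin 2)) :=
      continuous_subtype_val
    refine Complex.equivRealProdCLM.symm.continuous.comp
      (f := fun v : EuclideanHalfSpace 2 => (v.1 1, v.1 0)) ?_
    fun_prop
  have hqinj : Function.Injective q := fun v w hvw => by
    have h1 := congrArg Complex.re hvw
    have h0 := congrArg Complex.im hvw
    apply Subtype.ext
    ext i
    fin_cases i
    · exact h0
    · exact h1
  refine countable_of_disjoint_arcs
    (fun C => ⟨fun t => q (e (γ C t)), hq.comp (e.continuousOn.comp_continuous (γ C).continuous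
      fun t => (hmem C t).2)⟩) ?_ ?_ ?_ ?_
  · intro C s t hst
    exact hinj C (e.injOn (hmem C s).2 (hmem C t).2 (hqinj hst))
  · exact fun C t => (e (γ C t)).2
  · intro C
    by_contra hne
    exact hbdry C (isManifoldInteriorPt_of_chart_pos e (hmem C _).2
      (lt_of_le_of_ne (e (γ C _)).2 (Ne.symm hne)))
  · intro C D hCD s t hst
    have heq := e.injOn (hmem C s).2 (hmem D t).2 (hqinj hst)
    exact disjoint_left.1 (hdisj C.1 C.2.1 D.1 D.2.1 fun h => hCD (Subtype.ext h))
      (hmem C s).1 (heq ▸ (hmem D t).1)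

/-- If a surface `S` admits a circle decomposition, then no connected component of the
boundary `∂S` is homeomorphic to the real line. -/
theorem no_line_boundary_component
    {S : Type*} [TopologicalSpace S] [T2Space S] [SecondCountableTopology S]
    [ConnectedSpace S] [Nonempty S] [ChartedSpace (EuclideanHalfSpace 2) S]
    (h : ∃ 𝒞 : Set (Set S), IsCircleDecomposition 𝒞) :
    ∀ C : Set S,
      (∃ x ∈ {y : S | ¬ IsManifoldInteriorPt y},
        C = connectedComponentIn {y : S | ¬ IsManifoldInteriorPt y} x) →
      ¬ Nonempty (C ≃ₜ ℝ) := by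
  obtain ⟨𝒞, hcirc, hdisj, hcover⟩ := h
  rintro L ⟨x, hx, rfl⟩ ⟨φ⟩
  set B : Set S := {y : S | ¬ IsManifoldInteriorPt y} with hB
  set L := connectedComponentIn B x with hL
  have hLclosed : IsClosed L := by
    rw [hL, connectedComponentIn_eq_image hx]
    exact isClosed_setOf_not_isManifoldInteriorPt.isClosedEmbedding_subtypeVal.isClosedMap _
      isClosed_connectedComponent
  have hcount := countable_circles_meeting_boundary hcirc hdisj
  have : Countable {C ∈ 𝒞 | (C ∩ B).Nonempty} := hcount.to_subtype
  have hcompact : ∀ C ∈ 𝒞, IsCompact C := fun C hC => by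
    obtain ⟨ψ⟩ := hcirc C hC
    exact isCompact_iff_compactSpace.2 ψ.symm.compactSpace
  obtain ⟨C, hC⟩ := exists_eq_univ_of_countable_closed_partition
    (E := fun C : {C ∈ 𝒞 | (C ∩ B).Nonempty} => {s : ℝ | (φ.symm s : S) ∈ C.1})
    (fun C => (hcompact C.1 C.2.1).isClosed.preimage
      (continuous_subtype_val.comp φ.symm.continuous))
    (fun C D hCD => disjoint_left.2 fun s hsC hsD => disjoint_left.1
      (hdisj C.1 C.2.1 D.1 D.2.1 fun h => hCD (Subtype.ext h)) hsC hsD)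
    (eq_univ_of_forall fun s => by
      obtain ⟨C, hC, hsC⟩ := mem_sUnion.1 (hcover ▸ mem_univ (φ.symm s : S))
      exact mem_iUnion.2
        ⟨⟨C, hC, _, hsC, connectedComponentIn_subset B x (φ.symm s).2⟩, hsC⟩)
  have hsub : L ⊆ C.1 := fun y hy => by
    have : φ ⟨y, hy⟩ ∈ {s : ℝ | (φ.symm s : S) ∈ C.1} := hC ▸ mem_univ _
    simpa using this
  have : CompactSpace L :=
    isCompact_iff_compactSpace.1 ((hcompact C.1 C.2.1).of_isClosed_subset hLclosed hsub)
  have : CompactSpace ℝ := φ.compactSpace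
  exact noncompact_univ ℝ isCompact_univ
end
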